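/- arXiv:math/0701571 — 6 statements merged into one kernel-verified Lean document; each statement's English description precedes it below -/
import Mathlib

section
/- Let m, n be positive integers and let C be a complex hermitian mn×mn matrix that is H_+(m)⊗H_+(n)-separable, i.e. C = Σ_{l=1}^N A_l ⊗ B_l (Kronecker product) for some finite N, positive semidefinite complex hermitian m×m matrices A_l and positive semidefinite complex hermitian n×n matrices B_l. Then C is positive semidefinite and its partial transpose C^Γ is positive semidefinite, i.e. C is a PPT matrix. -/
open Matrix Kronecker
open scoped ComplexOrder

/-- A `H₊(m) ⊗ H₊(n)`-separable complex hermitian matrix is PPT: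
both it and its partial transpose are positive semidefinite. -/
theorem stmt_0 (m n : ℕ) (hm : 0 < m) (hn : 0 < n)
    (C : Matrix (Fin m × Fin n) (Fin m × Fin n) ℂ)
    (hherm : C.IsHermitian)
    (N : ℕ) (A : Fin N → Matrix (Fin m) (Fin m) ℂ)
    (B : Fin N → Matrix (Fin n) (Fin n) ℂ)
    (hA : ∀ l, (A l).PosSemidef) (hB : ∀ l, (B l).PosSemidef)
    (hC : C = ∑ l, A l ⊗ₖ B l) :
    C.PosSemidef ∧
      (Matrix.of fun p q : Fin m × Fin n => C (q.1, p.2) (p.1, q.2)).PosSemidef := by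
  constructor
  · rw [hC]
    exact Matrix.posSemidef_sum _ fun l _ => (hA l).kronecker (hB l)
  · have h : (Matrix.of fun p q : Fin m × Fin n => C (q.1, p.2) (p.1, q.2))
        = ∑ l, (A l)ᵀ ⊗ₖ B l := by
      ext p q
      simp [hC, Matrix.sum_apply, Matrix.kroneckerMap_apply]
    rw [h]
    exact Matrix.posSemidef_sum _ fun l _ => (hA l).transpose.kronecker (hB l)
end

section
/- Let n be a positive integer and let B be a real symmetric 2n×2n matrix partitioned into four n×n blocks B = [[B11, B12], [B12, B22]], where B11, B12, B22 are real symmetric n×n matrices (so B lies in the tensor product space S(2)⊗S(n)). If B is positive semidefinite, then B is S_+(2)⊗S_+(n)-separable, i.e. B = Σ_{l=1}^N a_l ⊗ C_l (Kronecker product) for some finite N, positive semidefinite real symmetric 2×2 matrices a_l and positive semidefinite real symmetric n×n matrices C_l. -/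
open Matrix Kronecker

lemma spec_aux {n : ℕ} (Y : Matrix (Fin n) (Fin n) ℝ) (hY : Y.IsHermitian) :
    ∃ (V : Matrix (Fin n) (Fin n) ℝ), V * Vᵀ = 1 ∧ Vᵀ * V = 1 ∧
      Y = V * diagonal hY.eigenvalues * Vᵀ := by
  refine ⟨hY.eigenvectorUnitary, ?_, ?_, ?_⟩
  · have := Unitary.coe_mul_star_self hY.eigenvectorUnitary
    simpa [star_eq_conjTranspose] using this
  · have := Unitary.coe_star_mul_self hY.eigenvectorUnitary
    simpa [star_eq_conjTranspose] using this
  · have := hY.spectral_theorem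
    simpa [Unitary.conjStarAlgAut_apply, star_eq_conjTranspose, Function.comp_def] using this

lemma root_aux {n : ℕ} (A : Matrix (Fin n) (Fin n) ℝ) (hA : A.PosSemidef) :
    ∃ S T : Matrix (Fin n) (Fin n) ℝ, Sᵀ = S ∧ Tᵀ = T ∧ S * S = A ∧ S * T = T * S ∧
      S * T * S = S ∧ T * S * T = T := by
  obtain ⟨V, h1, h2, h3⟩ := spec_aux A hA.1
  set d := hA.1.eigenvalues with hd
  have hd0 : ∀ i, 0 ≤ d i := hA.eigenvalues_nonneg
  have key : ∀ P Q : Matrix (Fin n) (Fin n) ℝ,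
      V * P * Vᵀ * (V * Q * Vᵀ) = V * (P * Q) * Vᵀ := by
    intro P Q
    calc _ = V * P * (Vᵀ * V) * Q * Vᵀ := by simp only [Matrix.mul_assoc]
      _ = _ := by rw [h2]; simp only [Matrix.mul_assoc, Matrix.one_mul]
  refine ⟨V * diagonal (fun i => √(d i)) * Vᵀ, V * diagonal (fun i => (√(d i))⁻¹) * Vᵀ,
    ?_, ?_, ?_, ?_, ?_, ?_⟩
  · simp [Matrix.mul_assoc]
  · simp [Matrix.mul_assoc]
  · rw [key, diagonal_mul_diagonal, h3]
    simp only [Real.mul_self_sqrt (hd0 _)]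
  · rw [key, key, diagonal_mul_diagonal, diagonal_mul_diagonal]
    simp only [mul_comm]
  · rw [key, key, diagonal_mul_diagonal, diagonal_mul_diagonal]
    congr; ext i
    by_cases h : √(d i) = 0
    · simp [h]
    · field_simp
  · rw [key, key, diagonal_mul_diagonal, diagonal_mul_diagonal]
    congr; ext i
    by_cases h : √(d i) = 0
    · simp [h]
    · field_simp

lemma main_aux {n : ℕ} (A X D : Matrix (Fin n) (Fin n) ℝ) (hX : Xᵀ = X)
    (hA : A.PosSemidef) (hB : (fromBlocks A X X D).PosSemidef) :
    ∃ (G : Matrix (Fin n) (Fin n) ℝ) (r : Fin n → ℝ), A = G * Gᵀ ∧ X = G * diagonal r * Gᵀ ∧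
      (D - G * diagonal (fun i => r i * r i) * Gᵀ).PosSemidef := by
  obtain ⟨S, T, hS, hT, hSS, hc, hSTS, hTST⟩ := root_aux A hA
  have hker : ∀ x, A *ᵥ x = 0 → X *ᵥ x = 0 := by
    intro x hx
    have := (hB.dotProduct_mulVec_zero_iff (Sum.elim x 0)).1 (by
      simp only [fromBlocks_mulVec, Sum.elim_comp_inl, Sum.elim_comp_inr, mulVec_zero,
        add_zero, hx]
      simp [dotProduct])
    simp only [fromBlocks_mulVec, Sum.elim_comp_inl, Sum.elim_comp_inr, mulVec_zero,
      add_zero] at this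
    funext i
    exact congrFun this (Sum.inr i)
  have hAP : A * (1 - T * S) = 0 := by
    rw [← hSS, Matrix.mul_sub, Matrix.mul_one, Matrix.mul_assoc, ← Matrix.mul_assoc S T S, hSTS,
      sub_self]
  have hXP0 : X * (1 - T * S) = 0 := by
    ext i j
    have := hker (fun k => (1 - T * S) k j) (by
      funext i; exact congrFun (congrFun hAP i) j)
    exact congrFun this i
  have hXP : X * (T * S) = X := by
    rw [Matrix.mul_sub, Matrix.mul_one] at hXP0
    exact (sub_eq_zero.1 hXP0).symm
  have hPX : S * T * X = X := by
    have := congrArg transpose hXP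
    simpa [hS, hT, hX] using this
  have hY : (T * X * T).IsHermitian := by
    simp [IsHermitian, conjTranspose_eq_transpose_of_trivial, hT, hX, Matrix.mul_assoc]
  obtain ⟨V, h1, h2, h3⟩ := spec_aux _ hY
  set r := hY.eigenvalues
  have eX : S * (T * X * T) * S = X := by
    calc _ = S * T * X * (T * S) := by simp only [Matrix.mul_assoc]
      _ = X := by rw [hPX, hXP]
  have eXX : S * (T * X * T * (T * X * T)) * S = X * (T * T) * X := by
    calc _ = S * T * X * (T * T) * (X * (T * S)) := by simp only [Matrix.mul_assoc]
      _ = _ := by rw [hPX, hXP]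
  refine ⟨S * V, r, ?_, ?_, ?_⟩
  · calc A = S * (V * Vᵀ) * S := by rw [h1, Matrix.mul_one, hSS]
      _ = _ := by rw [transpose_mul, hS]; simp only [Matrix.mul_assoc]
  · calc X = S * (T * X * T) * S := eX.symm
      _ = S * (V * diagonal r * Vᵀ) * S := by rw [← h3]
      _ = _ := by rw [transpose_mul, hS]; simp only [Matrix.mul_assoc]
  · have e : S * V * diagonal (fun i => r i * r i) * (S * V)ᵀ = X * (T * T) * X := by
      rw [← eXX]
      calc _ = S * (V * diagonal r * (1 * diagonal r) * Vᵀ) * S := by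
            rw [transpose_mul, hS, ← diagonal_mul_diagonal]
            simp only [Matrix.mul_assoc, Matrix.one_mul]
        _ = S * (V * diagonal r * Vᵀ * (V * diagonal r * Vᵀ)) * S := by
            rw [← h2]; simp only [Matrix.mul_assoc]
        _ = _ := by rw [← h3]
    rw [e]
    have hp := hB.conjTranspose_mul_mul_same (fromRows (-(T * T * X)) 1)
    have hTA : T * T * A = T * S := by
      rw [← hSS]
      calc _ = T * (T * S) * S := by simp only [Matrix.mul_assoc]
        _ = T * (S * T * S) := by rw [← hc]; simp only [Matrix.mul_assoc]
        _ = _ := by rw [hSTS]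
    convert hp using 1
    rw [conjTranspose_eq_transpose_of_trivial, transpose_fromRows, ← fromRows_fromCols_eq_fromBlocks,
      Matrix.mul_assoc (fromCols _ _), fromRows_mul, fromCols_mul_fromRows, fromCols_mul_fromRows,
      fromCols_mul_fromRows]
    have hz : A * -(T * T * X) + X * 1 = 0 := by
      have : A * (T * T) = S * T := by
        have := congrArg transpose hTA
        simpa [hS, hT, ← hSS] using this
      rw [Matrix.mul_neg, ← Matrix.mul_assoc, this, hPX]; simp
    rw [hz]
    simp only [Matrix.mul_zero, zero_add, transpose_one, Matrix.one_mul, Matrix.mul_one,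
      Matrix.mul_neg, Matrix.mul_assoc]
    abel

/-- A positive semidefinite real symmetric `2n × 2n` matrix lying in
`S(2) ⊗ S(n)` (four symmetric blocks, equal off-diagonal blocks) is
`S₊(2) ⊗ S₊(n)`-separable. -/
theorem stmt_2 (n : ℕ) (hn : 0 < n)
    (B : Matrix (Fin 2 × Fin n) (Fin 2 × Fin n) ℝ)
    (B11 B12 B22 : Matrix (Fin n) (Fin n) ℝ)
    (h11 : B11.IsSymm) (h12 : B12.IsSymm) (h22 : B22.IsSymm)
    (hblock : ∀ (a b : Fin 2) (i j : Fin n),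
      B (a, i) (b, j) = ![![B11, B12], ![B12, B22]] a b i j)
    (hpsd : B.PosSemidef) :
    ∃ (N : ℕ) (a : Fin N → Matrix (Fin 2) (Fin 2) ℝ)
      (C : Fin N → Matrix (Fin n) (Fin n) ℝ),
      (∀ l, (a l).PosSemidef) ∧ (∀ l, (C l).PosSemidef) ∧
      B = ∑ l, a l ⊗ₖ C l := by
  have hA : B11.PosSemidef := by
    convert hpsd.submatrix (fun i : Fin n => ((0 : Fin 2), i)) using 1
    ext i j; simp [hblock]
  have hB : (fromBlocks B11 B12 B12 B22).PosSemidef := by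
    convert hpsd.submatrix (Sum.elim (fun i : Fin n => ((0 : Fin 2), i)) (fun i => (1, i))) using 1
    ext i j; rcases i with i | i <;> rcases j with j | j <;> simp [hblock]
  obtain ⟨G, r, e1, e2, hD⟩ := main_aux B11 B12 B22 h12 hA hB
  have hv : ∀ (m : ℕ) (v : Fin m → ℝ), (vecMulVec v v).PosSemidef := by
    intro m v
    simpa using posSemidef_vecMulVec_self_star v
  refine ⟨n + 1, Fin.cons (vecMulVec ![0, 1] ![0, 1]) (fun l => vecMulVec ![1, r l] ![1, r l]),
    Fin.cons (B22 - G * diagonal (fun i => r i * r i) * Gᵀ)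
      (fun l => vecMulVec (fun i => G i l) (fun i => G i l)), ?_, ?_, ?_⟩
  · intro l; refine Fin.cases ?_ (fun l => ?_) l
    · exact hv _ _
    · exact hv _ _
  · intro l; refine Fin.cases ?_ (fun l => ?_) l
    · exact hD
    · exact hv _ _
  · have f1 : ∀ i j, B11 i j = ∑ l, G i l * G j l := by
      intro i j; rw [e1]; simp [Matrix.mul_apply]
    have f2 : ∀ i j, B12 i j = ∑ l, r l * (G i l * G j l) := by
      intro i j; rw [e2]; rw [Matrix.mul_apply]; simp only [mul_diagonal, transpose_apply]
      exact Finset.sum_congr rfl fun l _ => by ring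
    have f3 : ∀ i j, (G * diagonal (fun i => r i * r i) * Gᵀ) i j
        = ∑ l, r l * r l * (G i l * G j l) := by
      intro i j; rw [Matrix.mul_apply]; simp only [mul_diagonal, transpose_apply]
      exact Finset.sum_congr rfl fun l _ => by ring
    ext ⟨a, i⟩ ⟨b, j⟩
    rw [hblock, Fin.sum_univ_succ]
    simp only [Fin.cons_zero, Fin.cons_succ, Matrix.add_apply, Matrix.sum_apply,
      kroneckerMap_apply, vecMulVec_apply, Matrix.sub_apply, f3]
    fin_cases a <;> fin_cases b <;> simp [f1, f2]
end

section
/- Let n be a positive integer and let B be a complex hermitian 2n×2n matrix partitioned into four n×n blocks B = [[B11, B12], [B12, B22]], where B11, B12, B22 are complex hermitian n×n matrices (so B lies in the tensor product space S(2)⊗H(n)). Then B is positive semidefinite if and only if B is S_+(2)⊗H_+(n)-separable, i.e. B = Σ_{l=1}^N a_l ⊗ C_l (Kronecker product) for some finite N, positive semidefinite real symmetric 2×2 matrices a_l and positive semidefinite complex hermitian n×n matrices C_l. -/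
open Matrix Kronecker
open scoped ComplexOrder

lemma aux_spec {n : ℕ} (A : Matrix (Fin n) (Fin n) ℂ) (hA : A.IsHermitian) :
    ∃ (U : Matrix (Fin n) (Fin n) ℂ), U * Uᴴ = 1 ∧ Uᴴ * U = 1 ∧
      A = U * diagonal (fun i => (hA.eigenvalues i : ℂ)) * Uᴴ := by
  refine ⟨hA.eigenvectorUnitary, ?_, ?_, ?_⟩
  · exact Unitary.coe_mul_star_self hA.eigenvectorUnitary
  · exact Unitary.coe_star_mul_self hA.eigenvectorUnitary
  · have h := hA.spectral_theorem
    rw [Unitary.conjStarAlgAut_apply] at h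
    exact h

lemma aux_conj {n : ℕ} (U : Matrix (Fin n) (Fin n) ℂ) (hU : Uᴴ * U = 1) (f g : Fin n → ℂ) :
    (U * diagonal f * Uᴴ) * (U * diagonal g * Uᴴ) = U * diagonal (fun i => f i * g i) * Uᴴ := by
  calc _ = U * diagonal f * (Uᴴ * U) * diagonal g * Uᴴ := by simp only [Matrix.mul_assoc]
    _ = _ := by rw [hU, Matrix.mul_one, Matrix.mul_assoc U, diagonal_mul_diagonal]

lemma aux_herm {n : ℕ} (U : Matrix (Fin n) (Fin n) ℂ) (f : Fin n → ℝ) :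
    (U * diagonal (fun i => (f i : ℂ)) * Uᴴ)ᴴ = U * diagonal (fun i => (f i : ℂ)) * Uᴴ := by
  simp only [conjTranspose_mul, conjTranspose_conjTranspose, diagonal_conjTranspose,
    Matrix.mul_assoc]
  congr 3
  ext i
  simp

/-- square root and its pseudo-inverse -/
lemma aux_pinv {n : ℕ} (A : Matrix (Fin n) (Fin n) ℂ) (hA : A.PosSemidef) :
    ∃ X T : Matrix (Fin n) (Fin n) ℂ, Xᴴ = X ∧ Tᴴ = T ∧ X * X = A ∧ X * T = T * X ∧
      X * (T * X) = X := by
  obtain ⟨U, h1, h2, h3⟩ := aux_spec A hA.1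
  set s : Fin n → ℝ := fun i => Real.sqrt (hA.1.eigenvalues i) with hs
  refine ⟨U * diagonal (fun i => (s i : ℂ)) * Uᴴ,
    U * diagonal (fun i => (((s i)⁻¹ : ℝ) : ℂ)) * Uᴴ, aux_herm U s, aux_herm U fun i => (s i)⁻¹,
    ?_, ?_, ?_⟩
  · rw [aux_conj U h2]
    conv_rhs => rw [h3]
    congr 3
    ext i
    rw [← Complex.ofReal_mul, Real.mul_self_sqrt (hA.eigenvalues_nonneg i)]
  · rw [aux_conj U h2, aux_conj U h2]
    simp only [mul_comm]
  · rw [aux_conj U h2, aux_conj U h2]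
    congr 3
    ext i
    rw [← Complex.ofReal_mul, ← Complex.ofReal_mul]
    congr 1
    by_cases h : s i = 0
    · simp [h]
    · field_simp

lemma aux_ker {n : ℕ} (B11 B12 B22 P : Matrix (Fin n) (Fin n) ℂ)
    (hM : (fromBlocks B11 B12 B12 B22).PosSemidef) (hP : B11 * P = 0) : B12 * P = 0 := by
  apply Matrix.ext_of_mulVec_single
  intro j
  set u : Fin n → ℂ := Pi.single j 1
  have h := (hM.dotProduct_mulVec_zero_iff (Sum.elim (P *ᵥ u) 0)).1 (by
    rw [fromBlocks_mulVec]
    simp [hP, Sum.elim_comp_inl, dotProduct, ← Pi.star_def])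
  rw [fromBlocks_mulVec] at h
  have h2 := congrArg (fun f => f ∘ Sum.inr) h
  simpa [funext_iff] using h2

lemma aux_main {n : ℕ} (B11 B12 B22 : Matrix (Fin n) (Fin n) ℂ) (h12 : B12.IsHermitian)
    (hM : (fromBlocks B11 B12 B12 B22).PosSemidef) :
    ∃ X K : Matrix (Fin n) (Fin n) ℂ, Xᴴ = X ∧ K.IsHermitian ∧ X * X = B11 ∧ X * K * X = B12 ∧
      (B22 - X * (K * K) * X).PosSemidef := by
  have hA : B11.PosSemidef := by
    have := hM.submatrix (Sum.inl : Fin n → Fin n ⊕ Fin n)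
    exact this
  obtain ⟨X, T, hX, hT, hXX, hXT, hXTX⟩ := aux_pinv B11 hA
  have k1 : B12 * (T * X) = B12 := by
    have := aux_ker B11 B12 B22 (1 - T * X) hM (by
      rw [← hXX, Matrix.mul_sub, Matrix.mul_assoc, Matrix.mul_assoc, hXTX, Matrix.mul_one, sub_self])
    rw [Matrix.mul_sub, Matrix.mul_one, sub_eq_zero] at this
    exact this.symm
  have k2 : X * T * B12 = B12 := by
    have := congrArg conjTranspose k1
    simpa only [conjTranspose_mul, hX, hT, h12.eq] using this
  have e : X * (T * B12 * T * (T * B12 * T)) * X = B12 * T * T * B12 := by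
    calc _ = (X * T * B12) * T * T * (B12 * (T * X)) := by simp only [Matrix.mul_assoc]
      _ = _ := by rw [k1, k2]
  refine ⟨X, T * B12 * T, hX, ?_, hXX, ?_, ?_⟩
  · simp only [IsHermitian, conjTranspose_mul, hT, h12.eq, Matrix.mul_assoc]
  · calc _ = X * T * (B12 * (T * X)) := by simp only [Matrix.mul_assoc]
      _ = _ := by rw [k1, k2]
  · rw [e]
    have h := hM.conjTranspose_mul_mul_same (fromRows (-(T * T * B12)) (1 : Matrix (Fin n) (Fin n) ℂ))
    rw [Matrix.mul_assoc, fromBlocks_mul_fromRows,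
      conjTranspose_fromRows_eq_fromCols_conjTranspose, fromCols_mul_fromRows] at h
    have k3 : B11 * (T * T * B12) = B12 := by
      calc _ = X * (X * T) * (T * B12) := by rw [← hXX]; simp only [Matrix.mul_assoc]
        _ = (X * T) * (X * T * B12) := by rw [hXT, ← Matrix.mul_assoc X, hXT]; simp only [Matrix.mul_assoc]; rw [← Matrix.mul_assoc X T, hXT]; simp only [Matrix.mul_assoc]
        _ = _ := by rw [k2, k2]
    convert h using 1
    simp only [Matrix.mul_neg, k3, Matrix.mul_one, neg_add_cancel, Matrix.mul_zero,
      conjTranspose_one, Matrix.one_mul, zero_add]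
    simp only [Matrix.mul_assoc]
    abel

lemma aux_map {a : Matrix (Fin 2) (Fin 2) ℝ} (h : a.PosSemidef) :
    (a.map Complex.ofReal).PosSemidef := by
  obtain ⟨b, hb⟩ : ∃ b : Matrix (Fin 2) (Fin 2) ℝ, a = bᴴ * b := by
    open scoped MatrixOrder in
    exact CStarAlgebra.nonneg_iff_eq_star_mul_self.mp h.nonneg
  have : a.map Complex.ofReal = (b.map Complex.ofReal)ᴴ * b.map Complex.ofReal := by
    ext i j
    simp [hb, Matrix.mul_apply]
  rw [this]
  exact posSemidef_conjTranspose_mul_self _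

lemma aux_sum {n : ℕ} (V : Matrix (Fin n) (Fin n) ℂ) (f : Fin n → ℂ) (p q : Fin n) :
    (V * diagonal f * Vᴴ) p q = ∑ l, f l * vecMulVec (V.col l) (star (V.col l)) p q := by
  rw [Matrix.mul_apply]
  refine Finset.sum_congr rfl fun l _ => ?_
  simp [mul_diagonal, vecMulVec_apply]
  ring

open scoped ComplexOrder

/-- A complex hermitian `2n × 2n` matrix lying in `S(2) ⊗ H(n)`
(four hermitian blocks, equal off-diagonal blocks) is positive semidefinite
if and only if it is `S₊(2) ⊗ H₊(n)`-separable. -/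
theorem stmt_3 (n : ℕ) (hn : 0 < n)
    (B : Matrix (Fin 2 × Fin n) (Fin 2 × Fin n) ℂ)
    (B11 B12 B22 : Matrix (Fin n) (Fin n) ℂ)
    (h11 : B11.IsHermitian) (h12 : B12.IsHermitian) (h22 : B22.IsHermitian)
    (hblock : ∀ (a b : Fin 2) (i j : Fin n),
      B (a, i) (b, j) = ![![B11, B12], ![B12, B22]] a b i j) :
    B.PosSemidef ↔
      ∃ (N : ℕ) (a : Fin N → Matrix (Fin 2) (Fin 2) ℝ)
        (C : Fin N → Matrix (Fin n) (Fin n) ℂ),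
        (∀ l, (a l).PosSemidef) ∧ (∀ l, (C l).PosSemidef) ∧
        B = ∑ l, (a l).map Complex.ofReal ⊗ₖ C l := by
  constructor
  · intro hB
    have hM : (fromBlocks B11 B12 B12 B22).PosSemidef := by
      have := hB.submatrix (Sum.elim (fun i => ((0 : Fin 2), i)) (fun i => ((1 : Fin 2), i)))
      convert this using 1
      ext (i | i) (j | j) <;> simp [hblock]
    obtain ⟨X, K, hX, hK, hXX, hXK, hS⟩ := aux_main B11 B12 B22 h12 hM
    obtain ⟨U, hU1, hU2, hU⟩ := aux_spec K hK
    set ev := hK.eigenvalues with hev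
    have key : ∀ f : Fin n → ℂ, (X * U) * diagonal f * (X * U)ᴴ
        = X * (U * diagonal f * Uᴴ) * X := by
      intro f
      rw [conjTranspose_mul, hX]
      simp only [Matrix.mul_assoc]
    have e11 : (X * U) * diagonal (fun _ => (1 : ℂ)) * (X * U)ᴴ = B11 := by
      rw [key, diagonal_one, Matrix.mul_one, hU1, Matrix.mul_one, hXX]
    have e12 : (X * U) * diagonal (fun i => (ev i : ℂ)) * (X * U)ᴴ = B12 := by
      rw [key, ← hU, hXK]
    have e22 : (X * U) * diagonal (fun i => (ev i : ℂ) * (ev i : ℂ)) * (X * U)ᴴ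
        = X * (K * K) * X := by
      rw [key, ← aux_conj U hU2, ← hU]
    refine ⟨n + 1, Fin.cons !![0, 0; 0, 1] (fun l => !![1, ev l; ev l, ev l * ev l]),
      Fin.cons (B22 - X * (K * K) * X)
        (fun l => vecMulVec ((X * U).col l) (star ((X * U).col l))), ?_, ?_, ?_⟩
    · intro l
      refine Fin.cases ?_ (fun l => ?_) l
      · have := posSemidef_vecMulVec_self_star (![0, 1] : Fin 2 → ℝ)
        convert this using 1
        ext i j
        fin_cases i <;> fin_cases j <;> simp [vecMulVec_apply]
      · have := posSemidef_vecMulVec_self_star (![1, ev l] : Fin 2 → ℝ)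
        convert this using 1
        ext i j
        fin_cases i <;> fin_cases j <;> simp [vecMulVec_apply]
    · intro l
      refine Fin.cases ?_ (fun l => ?_) l
      · exact hS
      · exact posSemidef_vecMulVec_self_star _
    · ext ⟨a, i⟩ ⟨b, j⟩
      rw [hblock, Fin.sum_univ_succ]
      simp only [Fin.cons_zero, Fin.cons_succ, Matrix.add_apply, Matrix.sum_apply,
        kroneckerMap_apply, Matrix.map_apply]
      have f11 := aux_sum (X * U) (fun _ => (1 : ℂ)) i j
      have f12 := aux_sum (X * U) (fun i => (ev i : ℂ)) i j
      have f22 := aux_sum (X * U) (fun i => (ev i : ℂ) * (ev i : ℂ)) i j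
      rw [e11] at f11
      rw [e12] at f12
      rw [e22] at f22
      fin_cases a <;> fin_cases b
      · simpa using f11
      · simpa using f12
      · simpa using f12
      · simp only [Fin.mk_one, Matrix.of_apply, Matrix.cons_val_one, Matrix.cons_val_fin_one,
          Complex.ofReal_mul, Complex.ofReal_one, one_mul, Matrix.sub_apply]
        rw [← f22]
        ring
  · rintro ⟨N, a, C, ha, hC, rfl⟩
    exact posSemidef_sum _ fun l _ => (aux_map (ha l)).kronecker (hC l)
end

section
/- Let B be a quaternionic hermitian 4×4 matrix partitioned into four 2×2 blocks B = [[B11, B12], [B̄12, B22]], where B11 and B22 are real symmetric 2×2 matrices and B12 is a symmetric (B12ᵀ = B12, entrywise transpose without conjugation) quaternionic 2×2 matrix (so B lies in the tensor product space Q(2)⊗S(2)). If both B and its entrywise quaternionic conjugate B̄ are positive semidefinite, then B is Q_+(2)⊗S_+(2)-separable, i.e. B = Σ_{l=1}^N A_l ⊗ S_l (Kronecker product) for some finite N, positive semidefinite quaternionic hermitian 2×2 matrices A_l and positive semidefinite real symmetric 2×2 matrices S_l. -/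
open Matrix Kronecker

/-- A quaternionic matrix is positive semidefinite if it is hermitian and
`Re (x* A x) ≥ 0` for every quaternionic vector `x`. -/
def QuatPSD {ι : Type*} [Fintype ι] (A : Matrix ι ι (Quaternion ℝ)) : Prop :=
  A.IsHermitian ∧ ∀ x : ι → Quaternion ℝ, 0 ≤ (star x ⬝ᵥ A.mulVec x).re

theorem joint_basis (P Q : Matrix (Fin 3) (Fin 3) ℝ) (hP : P.IsSymm) (hQ : Q.IsSymm)
    (hc : P * Q = Q * P) : ∃ (b : OrthonormalBasis (Fin 3) ℝ (EuclideanSpace ℝ (Fin 3)))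
      (l m : Fin 3 → ℝ), (∀ a, toEuclideanLin P (b a) = l a • b a) ∧
        (∀ a, toEuclideanLin Q (b a) = m a • b a) := by
  classical
  have hA : (toEuclideanLin P).IsSymmetric := isSymmetric_toEuclideanLin_iff.mpr
    (by rw [IsHermitian, conjTranspose_eq_transpose_of_trivial]; exact hP)
  have hB : (toEuclideanLin Q).IsSymmetric := isSymmetric_toEuclideanLin_iff.mpr
    (by rw [IsHermitian, conjTranspose_eq_transpose_of_trivial]; exact hQ)
  have hAB : Commute (toEuclideanLin P) (toEuclideanLin Q) := by
    ext x i
    have := congrArg (fun M => (M *ᵥ x.ofLp) i) hc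
    simpa [Module.End.mul_apply, toLpLin_apply] using this
  have hint := LinearMap.IsSymmetric.directSum_isInternal_of_commute hA hB hAB
  have hort := LinearMap.IsSymmetric.orthogonalFamily_eigenspace_inf_eigenspace hA hB
  have hind := hint.submodule_iSupIndep
  have := hind.fintypeNeBotOfFiniteDimensional
  have hint' := DirectSum.isInternal_ne_bot_iff.mpr hint
  have hort' := hort.comp (Subtype.val_injective (p := fun i => Module.End.eigenspace (toEuclideanLin P) i.2 ⊓ Module.End.eigenspace (toEuclideanLin Q) i.1 ≠ ⊥))
  have hn : Module.finrank ℝ (EuclideanSpace ℝ (Fin 3)) = 3 := by simp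
  have hb := fun a => hint'.subordinateOrthonormalBasis_subordinate hn a hort'
  refine ⟨hint'.subordinateOrthonormalBasis hn hort',
    fun a => (hint'.subordinateOrthonormalBasisIndex hn a hort').1.2,
    fun a => (hint'.subordinateOrthonormalBasisIndex hn a hort').1.1, fun a => ?_, fun a => ?_⟩
  · exact Module.End.mem_eigenspace_iff.mp (hb a).1
  · exact Module.End.mem_eigenspace_iff.mp (hb a).2

theorem joint_diag (P Q : Matrix (Fin 3) (Fin 3) ℝ) (hP : P.IsSymm) (hQ : Q.IsSymm)
    (hc : P * Q = Q * P) : ∃ (V : Matrix (Fin 3) (Fin 3) ℝ) (l m : Fin 3 → ℝ),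
      V * Vᵀ = 1 ∧ Vᵀ * V = 1 ∧ P = V * diagonal l * Vᵀ ∧ Q = V * diagonal m * Vᵀ := by
  obtain ⟨b, l, m, e1, e2⟩ := joint_basis P Q hP hQ hc
  obtain ⟨V, hVd⟩ : ∃ V : Matrix (Fin 3) (Fin 3) ℝ, ∀ i a, V i a = b a i := ⟨of fun i a => b a i, fun _ _ => rfl⟩
  have hV : Vᵀ * V = 1 := by
    ext i j
    have := orthonormal_iff_ite.mp b.orthonormal i j
    simp only [mul_apply, transpose_apply, one_apply, hVd]
    rw [← this, PiLp.inner_apply]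
    refine Finset.sum_congr rfl fun k _ => ?_
    rw [mul_comm]; rfl
  have hV' : V * Vᵀ = 1 := mul_eq_one_comm.mp hV
  have key : ∀ (M : Matrix (Fin 3) (Fin 3) ℝ) (d : Fin 3 → ℝ),
      (∀ a, toEuclideanLin M (b a) = d a • b a) → M = V * diagonal d * Vᵀ := by
    intro M d h
    have : M * V = V * diagonal d := by
      ext i a
      have := congrArg (fun v : EuclideanSpace ℝ (Fin 3) => v i) (h a)
      simp only [toLpLin_apply, PiLp.smul_apply, smul_eq_mul] at this
      rw [mul_diagonal, hVd, mul_comm, ← this]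
      simp only [mul_apply, mulVec, dotProduct, hVd]
    rw [← this, Matrix.mul_assoc, hV', Matrix.mul_one]
  exact ⟨V, l, m, hV', hV, key P _ e1, key Q _ e2⟩

theorem quad_nonneg {a d Q : ℝ} (ha : 0 ≤ a) (hd : 0 ≤ d) (h : Q ^ 2 ≤ a * d) (X Y : ℝ) :
    0 ≤ a * X ^ 2 + 2 * Q * X * Y + d * Y ^ 2 := by
  rcases ha.eq_or_lt with rfl | ha
  · have : Q = 0 := by nlinarith
    subst this
    nlinarith [mul_nonneg hd (sq_nonneg Y)]
  · have : 0 ≤ a * (a * X ^ 2 + 2 * Q * X * Y + d * Y ^ 2) := by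
      nlinarith [sq_nonneg (a * X + Q * Y), mul_nonneg (sub_nonneg.mpr h) (sq_nonneg Y)]
    exact nonneg_of_mul_nonneg_right this ha

theorem psd_two {S : Matrix (Fin 2) (Fin 2) ℝ} (hs : S 1 0 = S 0 1) (h0 : 0 ≤ S 0 0)
    (h1 : 0 ≤ S 1 1) (h : S 0 1 ^ 2 ≤ S 0 0 * S 1 1) : S.PosSemidef := by
  refine PosSemidef.of_dotProduct_mulVec_nonneg ?_ fun x => ?_
  · ext i j
    fin_cases i <;> fin_cases j <;> simp [hs]
  · have := quad_nonneg h0 h1 h (x 0) (x 1)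
    simp [dotProduct, mulVec, Fin.sum_univ_two, hs]
    linarith

theorem quatPSD_two {a d : ℝ} {q : Quaternion ℝ} (ha : 0 ≤ a) (hd : 0 ≤ d)
    (h : ‖q‖ ^ 2 ≤ a * d) :
    QuatPSD (!![(a : Quaternion ℝ), q; star q, (d : Quaternion ℝ)]) := by
  constructor
  · ext1 i j
    fin_cases i <;> fin_cases j <;> simp
  · intro x
    have h1 : (star x ⬝ᵥ (!![(a : Quaternion ℝ), q; star q, (d : Quaternion ℝ)]).mulVec x).re
        = a * ‖x 0‖ ^ 2 + 2 * (star (x 0) * q * x 1).re + d * ‖x 1‖ ^ 2 := by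
      rw [sq, sq, ← Quaternion.normSq_eq_norm_mul_self, ← Quaternion.normSq_eq_norm_mul_self]
      simp [dotProduct, mulVec, Fin.sum_univ_two, Quaternion.normSq_def']
      ring
    have h2 : |(star (x 0) * q * x 1).re| ≤ ‖q‖ * ‖x 0‖ * ‖x 1‖ := by
      have h3 : ‖star (x 0) * q * x 1‖ = ‖q‖ * ‖x 0‖ * ‖x 1‖ := by
        rw [norm_mul, norm_mul, norm_star]; ring
      rw [← h3]
      refine abs_le_of_sq_le_sq ?_ (norm_nonneg _)
      rw [sq ‖_‖, ← Quaternion.normSq_eq_norm_mul_self, Quaternion.normSq_def']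
      nlinarith [sq_nonneg (star (x 0) * q * x 1).imI, sq_nonneg (star (x 0) * q * x 1).imJ, sq_nonneg (star (x 0) * q * x 1).imK]
    have h4 := quad_nonneg ha hd (Q := -‖q‖) (by linarith [neg_sq ‖q‖]) ‖x 0‖ ‖x 1‖
    rw [h1]
    have := (abs_le.mp h2).1
    linarith

/-- block data for separable elements -/
inductive SepD : Matrix (Fin 2) (Fin 2) ℝ → Matrix (Fin 2) (Fin 2) (Quaternion ℝ) →
    Matrix (Fin 2) (Fin 2) ℝ → Prop
  | zero : SepD 0 0 0
  | plus {P C R P' C' R'} : SepD P C R → SepD P' C' R' → SepD (P + P') (C + C') (R + R')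
  | gen (a d : ℝ) (q : Quaternion ℝ) (S : Matrix (Fin 2) (Fin 2) ℝ) :
      0 ≤ a → 0 ≤ d → ‖q‖ ^ 2 ≤ a * d → S.PosSemidef →
      SepD (a • S) (of fun i j => S i j • q) (d • S)

def mkB (P : Matrix (Fin 2) (Fin 2) ℝ) (C : Matrix (Fin 2) (Fin 2) (Quaternion ℝ))
    (R : Matrix (Fin 2) (Fin 2) ℝ) : Matrix (Fin 2 × Fin 2) (Fin 2 × Fin 2) (Quaternion ℝ) :=
  of fun u v => ![![P.map (algebraMap ℝ (Quaternion ℝ)), C],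
          ![C.map (star : Quaternion ℝ → Quaternion ℝ),
            R.map (algebraMap ℝ (Quaternion ℝ))]] u.1 v.1 u.2 v.2

def IsSepB (B : Matrix (Fin 2 × Fin 2) (Fin 2 × Fin 2) (Quaternion ℝ)) : Prop :=
  ∃ (N : ℕ) (A : Fin N → Matrix (Fin 2) (Fin 2) (Quaternion ℝ))
      (S : Fin N → Matrix (Fin 2) (Fin 2) ℝ),
      (∀ l, QuatPSD (A l)) ∧ (∀ l, (S l).PosSemidef) ∧
      B = ∑ l, A l ⊗ₖ (S l).map (algebraMap ℝ (Quaternion ℝ))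

theorem SepD.isSep {P C R} (h : SepD P C R) : IsSepB (mkB P C R) := by
  induction h with
  | zero =>
    refine ⟨0, fun _ => 0, fun _ => 0, fun l => l.elim0, fun l => l.elim0, ?_⟩
    ext1 ⟨a, i⟩ ⟨b, j⟩
    fin_cases a <;> fin_cases b <;> simp [mkB]
  | @plus P C R P' C' R' _ _ h1 h2 =>
    obtain ⟨N, A, S, hA, hS, hB⟩ := h1
    obtain ⟨N', A', S', hA', hS', hB'⟩ := h2
    refine ⟨N + N', Fin.append A A', Fin.append S S', ?_, ?_, ?_⟩
    · intro l
      refine Fin.addCases (fun l => ?_) (fun l => ?_) l <;> simp [hA, hA']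
    · intro l
      refine Fin.addCases (fun l => ?_) (fun l => ?_) l <;> simp [hS, hS']
    · rw [Fin.sum_univ_add]
      simp only [Fin.append_left, Fin.append_right]
      rw [← hB, ← hB']
      ext1 ⟨a, i⟩ ⟨b, j⟩
      fin_cases a <;> fin_cases b <;> simp [mkB]
  | gen a d q S ha hd hq hS =>
    refine ⟨1, fun _ => !![(a : Quaternion ℝ), q; star q, (d : Quaternion ℝ)], fun _ => S,
      fun _ => quatPSD_two ha hd hq, fun _ => hS, ?_⟩
    ext1 ⟨a, i⟩ ⟨b, j⟩
    fin_cases a <;> fin_cases b <;>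
      simp [mkB, ← Quaternion.mul_coe_eq_smul]
    exact Quaternion.coe_commutes _ _

theorem SepD.of_eq {P C R P' C' R'} (h : SepD P C R) (h1 : P = P') (h2 : C = C') (h3 : R = R') :
    SepD P' C' R' := by subst h1 h2 h3; exact h

def cong {α : Type*} [AddCommGroup α] [Module ℝ α] (T : Matrix (Fin 2) (Fin 2) ℝ)
    (C : Matrix (Fin 2) (Fin 2) α) : Matrix (Fin 2) (Fin 2) α :=
  of fun i j => ∑ k, ∑ l, (T i k * T j l) • C k l

theorem cong_cong {α : Type*} [AddCommGroup α] [Module ℝ α] (T U : Matrix (Fin 2) (Fin 2) ℝ)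
    (C : Matrix (Fin 2) (Fin 2) α) : cong T (cong U C) = cong (T * U) C := by
  ext i j
  simp only [cong, of_apply, Fin.sum_univ_two, mul_apply]
  module

theorem cong_one {α : Type*} [AddCommGroup α] [Module ℝ α] 
    (C : Matrix (Fin 2) (Fin 2) α) : cong 1 C = C := by
  ext i j
  fin_cases i <;> fin_cases j <;> simp [cong]

theorem cong_symm {α : Type*} [AddCommGroup α] [Module ℝ α] (T : Matrix (Fin 2) (Fin 2) ℝ)
    {C : Matrix (Fin 2) (Fin 2) α} (h : C.IsSymm) : (cong T C).IsSymm := by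
  have h1 := h.apply 0 1
  ext i j
  simp only [cong, of_apply, Fin.sum_univ_two, transpose_apply, h1]
  module

theorem cong_eq (T C : Matrix (Fin 2) (Fin 2) ℝ) : cong T C = T * C * Tᵀ := by
  ext i j
  simp [cong, mul_apply, Fin.sum_univ_two]
  ring

theorem SepD.cong {P C R} (T : Matrix (Fin 2) (Fin 2) ℝ) (h : SepD P C R) :
    SepD (cong T P) (cong T C) (cong T R) := by
  induction h with
  | zero => refine SepD.zero.of_eq ?_ ?_ ?_ <;> ext1 i j <;> simp [_root_.cong]
  | plus _ _ h1 h2 =>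
    refine (h1.plus h2).of_eq ?_ ?_ ?_ <;> ext1 i j <;>
      simp only [_root_.cong, of_apply, Fin.sum_univ_two, Matrix.add_apply, Matrix.smul_apply, smul_eq_mul] <;> first | ring1 | module
  | gen a d q S ha hd hq hS =>
    have hS' : (_root_.cong T S).PosSemidef := by
      rw [cong_eq]
      simpa using hS.mul_mul_conjTranspose_same T
    refine (SepD.gen a d q _ ha hd hq hS').of_eq ?_ ?_ ?_ <;> ext1 i j <;>
      simp only [_root_.cong, of_apply, Fin.sum_univ_two, Matrix.add_apply, Matrix.smul_apply, smul_eq_mul] <;> first | ring1 | module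

def PSDd (P : Matrix (Fin 2) (Fin 2) ℝ) (C : Matrix (Fin 2) (Fin 2) (Quaternion ℝ))
    (R : Matrix (Fin 2) (Fin 2) ℝ) : Prop :=
  ∀ x y : Fin 2 → Quaternion ℝ, 0 ≤ (∑ i, ∑ j, (P i j • (star (x i) * x j) +
    (2 : ℝ) • (star (x i) * C i j * y j) + R i j • (star (y i) * y j))).re

theorem PSDd.of_mkB {P C R} (hC : C.IsSymm) (h : QuatPSD (mkB P C R)) : PSDd P C R := by
  intro x y
  have h1 := h.2 (fun u => ![x, y] u.1 u.2)
  have hc := hC.apply 0 1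
  refine h1.trans_eq ?_
  simp [mkB, dotProduct, mulVec, Fintype.sum_prod_type, Fin.sum_univ_two, hc]
  ring

theorem PSDd.cong {P C R} (T : Matrix (Fin 2) (Fin 2) ℝ) (h : PSDd P C R) :
    PSDd (cong T P) (cong T C) (cong T R) := by
  intro x y
  have := h (fun k => ∑ i, T i k • x i) (fun k => ∑ i, T i k • y i)
  refine this.trans_eq ?_
  simp only [_root_.cong, of_apply, Fin.sum_univ_two, star_add, Quaternion.star_smul, add_mul, mul_add,
    smul_mul_assoc, mul_smul_comm, smul_eq_mul]
  simp only [Quaternion.re_add, Quaternion.re_smul, smul_eq_mul]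
  ring

theorem finish_sep (P Q : Matrix (Fin 3) (Fin 3) ℝ) (hP : P.IsSymm) (hQ : Q.IsSymm)
    (hc : P * Q = Q * P) (p q r : Quaternion ℝ) (C : Matrix (Fin 2) (Fin 2) (Quaternion ℝ))
    (R : Matrix (Fin 2) (Fin 2) ℝ)
    (hC : ∀ i j : Fin 2, C i j = (1 : Matrix (Fin 3) (Fin 3) ℝ) i.castSucc j.castSucc • p
      + P i.castSucc j.castSucc • q + Q i.castSucc j.castSucc • r)
    (hR : (R - of fun i j : Fin 2 =>
      Quaternion.normSq p * (1 : Matrix (Fin 3) (Fin 3) ℝ) i.castSucc j.castSucc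
      + Quaternion.normSq q * (P * P) i.castSucc j.castSucc
      + Quaternion.normSq r * (Q * Q) i.castSucc j.castSucc
      + 2 * (star p * q).re * P i.castSucc j.castSucc
      + 2 * (star p * r).re * Q i.castSucc j.castSucc
      + 2 * (star q * r).re * (P * Q) i.castSucc j.castSucc).PosSemidef) :
    SepD 1 C R := by
  obtain ⟨V, l, m, h1, h2, h3, h4⟩ := joint_diag P Q hP hQ hc
  have mm : ∀ a b : Fin 3 → ℝ, (V * diagonal a * Vᵀ) * (V * diagonal b * Vᵀ)
      = V * diagonal (fun i => a i * b i) * Vᵀ := by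
    intro a b
    rw [← diagonal_mul_diagonal]
    calc _ = V * diagonal a * (Vᵀ * V) * diagonal b * Vᵀ := by simp only [Matrix.mul_assoc]
      _ = _ := by rw [h2]; simp only [Matrix.mul_assoc, Matrix.one_mul]
  have ent : ∀ (a : Fin 3 → ℝ) i j, (V * diagonal a * Vᵀ) i j = V i 0 * a 0 * V j 0
      + V i 1 * a 1 * V j 1 + V i 2 * a 2 * V j 2 := by
    intro a i j
    simp [mul_apply, Fin.sum_univ_three, diagonal_apply]
  have one : (1 : Matrix (Fin 3) (Fin 3) ℝ) = V * diagonal (fun _ => 1) * Vᵀ := by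
    simp [h1]
  have hPP := mm l l
  have hQQ := mm m m
  have hPQ := mm l m
  rw [← h3] at hPP hPQ
  rw [← h4] at hQQ hPQ
  rw [hPP, hQQ, hPQ, h3, h4, one] at hR
  rw [h3, h4, one] at hC
  let G : Fin 3 → Matrix (Fin 2) (Fin 2) ℝ := fun k => of fun i j => V i.castSucc k * V j.castSucc k
  have hG : ∀ k, (G k).PosSemidef := by
    intro k
    have := posSemidef_vecMulVec_self_star (fun i : Fin 2 => V i.castSucc k)
    convert this using 1
    ext i j
    simp [G, vecMulVec_apply]
  have gens : ∀ k, SepD ((1 : ℝ) • G k) (of fun i j => G k i j • (p + l k • q + m k • r))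
      (Quaternion.normSq (p + l k • q + m k • r) • G k) := fun k =>
    SepD.gen 1 _ _ _ zero_le_one Quaternion.normSq_nonneg
      (by rw [Quaternion.normSq_eq_norm_mul_self]; linarith) (hG k)
  have rem := SepD.gen 0 1 0 _ le_rfl zero_le_one (by simp) hR
  have hn : ∀ k, Quaternion.normSq (p + l k • q + m k • r) = Quaternion.normSq p
      + l k ^ 2 * Quaternion.normSq q + m k ^ 2 * Quaternion.normSq r
      + 2 * l k * (star p * q).re + 2 * m k * (star p * r).re
      + 2 * l k * m k * (star q * r).re := by
    intro k
    simp only [Quaternion.normSq_def', Quaternion.re_add, Quaternion.imI_add, Quaternion.imJ_add,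
      Quaternion.imK_add, Quaternion.re_smul, Quaternion.imI_smul, Quaternion.imJ_smul,
      Quaternion.imK_smul, Quaternion.re_mul, Quaternion.re_star, Quaternion.imI_star,
      Quaternion.imJ_star, Quaternion.imK_star, smul_eq_mul]
    ring
  refine ((((gens 0).plus (gens 1)).plus (gens 2)).plus rem).of_eq ?_ ?_ ?_
  · ext i j
    have e := congrFun (congrFun one i.castSucc) j.castSucc
    rw [ent, one_apply] at e
    simp only [Fin.castSucc_inj] at e
    simp only [Matrix.add_apply, Matrix.smul_apply, G, of_apply, smul_eq_mul, one_apply, e]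
    ring
  · ext1 i j
    rw [hC, ent, ent, ent]
    simp only [Matrix.add_apply, G, of_apply]
    module
  · ext1 i j
    simp only [Matrix.add_apply, Matrix.smul_apply, Matrix.sub_apply, G, of_apply, smul_eq_mul,
      ent, hn]
    ring

theorem two_of_forall {a d : ℝ} {z : Quaternion ℝ}
    (h : ∀ y0 y1 : Quaternion ℝ, 0 ≤ a * Quaternion.normSq y0 + 2 * (star y0 * z * y1).re
      + d * Quaternion.normSq y1) : 0 ≤ a ∧ 0 ≤ d ∧ Quaternion.normSq z ≤ a * d := by
  have ha : 0 ≤ a := by simpa [Quaternion.re_zero] using h 1 0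
  have hd : 0 ≤ d := by simpa [Quaternion.re_zero] using h 0 1
  have hn := Quaternion.normSq_nonneg (a := z)
  have key : ∀ u v : ℝ, 0 ≤ a * u ^ 2 * Quaternion.normSq z + 2 * u * v * Quaternion.normSq z
      + d * v ^ 2 := by
    intro u v
    refine (h (u • z) (v : Quaternion ℝ)).trans_eq ?_
    simp [Quaternion.normSq_def']
    ring
  refine ⟨ha, hd, ?_⟩
  by_contra hlt
  push Not at hlt
  have k1 := key (-1) a
  have k2 := key (-d) (Quaternion.normSq z)
  have k3 := key (-1) 1
  have hpos : 0 < Quaternion.normSq z := lt_of_le_of_lt (mul_nonneg ha hd) hlt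
  rcases ha.eq_or_lt with h0 | h0
  · rcases hd.eq_or_lt with h1 | h1
    · rw [← h0, ← h1] at k3
      linarith
    · have : 0 < d * Quaternion.normSq z * (Quaternion.normSq z - a * d) :=
        mul_pos (mul_pos h1 hpos) (by linarith)
      nlinarith
  · have : 0 < a * (Quaternion.normSq z - a * d) := mul_pos h0 (by linarith)
    nlinarith

set_option maxRecDepth 20000 in
set_option maxHeartbeats 2000000 in
theorem schur_one {C : Matrix (Fin 2) (Fin 2) (Quaternion ℝ)} {R : Matrix (Fin 2) (Fin 2) ℝ}
    (hC : C 1 0 = C 0 1) (hR : R 1 0 = R 0 1) (h : PSDd 1 C R) :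
    0 ≤ R 0 0 - Quaternion.normSq (C 0 0) - Quaternion.normSq (C 0 1) ∧
    0 ≤ R 1 1 - Quaternion.normSq (C 0 1) - Quaternion.normSq (C 1 1) ∧
    Quaternion.normSq ((R 0 1 : Quaternion ℝ) - (star (C 0 0) * C 0 1 + star (C 0 1) * C 1 1)) ≤
      (R 0 0 - Quaternion.normSq (C 0 0) - Quaternion.normSq (C 0 1)) *
      (R 1 1 - Quaternion.normSq (C 0 1) - Quaternion.normSq (C 1 1)) := by
  apply two_of_forall
  intro y0 y1
  have := h ![-(C 0 0 * y0 + C 0 1 * y1), -(C 0 1 * y0 + C 1 1 * y1)] ![y0, y1]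
  refine this.trans_eq ?_
  have h01 : (1 : Matrix (Fin 2) (Fin 2) ℝ) 0 1 = 0 := by simp
  have h10 : (1 : Matrix (Fin 2) (Fin 2) ℝ) 1 0 = 0 := by simp
  clear this
  simp only [Fin.sum_univ_two, hC, hR]
  generalize C 0 0 = c0
  generalize C 1 1 = c2
  generalize C 0 1 = c1
  simp only [Quaternion.normSq_def', Quaternion.re_add, Quaternion.imI_add, Quaternion.imJ_add,
    Quaternion.imK_add, Quaternion.re_sub, Quaternion.imI_sub, Quaternion.imJ_sub,
    Quaternion.imK_sub, Quaternion.re_neg, Quaternion.imI_neg, Quaternion.imJ_neg,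
    Quaternion.imK_neg, Quaternion.re_smul, Quaternion.re_mul, Quaternion.imI_mul,
    Quaternion.imJ_mul, Quaternion.imK_mul, Quaternion.re_star, Quaternion.imI_star,
    Quaternion.imJ_star, Quaternion.imK_star, Quaternion.re_coe, Quaternion.imI_coe,
    Quaternion.imJ_coe, Quaternion.imK_coe, smul_eq_mul, one_apply_eq, cons_val_zero, cons_val_one,
    h01, h10]
  ring

theorem chol {x y z : ℝ} (hx : 0 ≤ x) (hd : 0 < x * z - y ^ 2) : ∃ m1 m2 m3 : ℝ, 0 < m1 ∧ 0 < m3 ∧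
    x = m1 ^ 2 ∧ y = m1 * m2 ∧ z = m2 ^ 2 + m3 ^ 2 := by
  have hx : 0 < x := by
    rcases hx.eq_or_lt with rfl | hx
    · nlinarith [sq_nonneg y]
    · exact hx
  have s1 := Real.sq_sqrt hx.le
  have p1 := Real.sqrt_pos.mpr hx
  have hd' : 0 < (x * z - y ^ 2) / x := div_pos hd hx
  refine ⟨√x, y / √x, √((x * z - y ^ 2) / x), p1, Real.sqrt_pos.mpr hd', s1.symm, ?_, ?_⟩
  · field_simp
  · rw [Real.sq_sqrt hd'.le, div_pow, s1]; field_simp; ring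

theorem exists_K {E0 E1 E2 g0 g1 g2 : ℝ} (hE0 : 0 ≤ E0) (hE2 : 0 ≤ E2) (hg0 : 0 ≤ g0)
    (hg : 0 < g0 * g2 - g1 ^ 2) (h : E1 ^ 2 + 4 * (g0 * g2 - g1 ^ 2) ≤ E0 * E2) :
    ∃ a1 a2 b1 b2 k : ℝ, k ≤ 1 ∧ a1 * b2 - a2 * b1 = 2 ∧
      g0 * a1 ^ 2 + 2 * g1 * a1 * b1 + g2 * b1 ^ 2 = k * E0 ∧
      g0 * (a1 * a2) + g1 * (a1 * b2 + a2 * b1) + g2 * (b1 * b2) = k * E1 ∧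
      g0 * a2 ^ 2 + 2 * g1 * a2 * b2 + g2 * b2 ^ 2 = k * E2 := by
  obtain ⟨l1, l2, l3, hl1, hl3, rfl, rfl, rfl⟩ := chol hg0 hg
  obtain ⟨m1, m2, m3, hm1, hm3, rfl, rfl, rfl⟩ := chol hE0 (y := E1) (z := E2) (by linarith)
  have hk : 0 < 2 * (l1 * l3) / (m1 * m3) := by positivity
  obtain ⟨c, hc⟩ : ∃ c : ℝ, c ^ 2 = 2 * (l1 * l3) / (m1 * m3) := ⟨√_, Real.sq_sqrt hk.le⟩
  have hle : 2 * (l1 * l3) ≤ m1 * m3 := by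
    apply le_of_sq_le_sq _ (by positivity)
    nlinarith
  refine ⟨c * (m1 / l1), c * (m2 / l1 - m3 * l2 / (l1 * l3)), 0, c * (m3 / l3), c ^ 2, ?_, ?_, ?_, ?_, ?_⟩
  · rw [hc, div_le_one (by positivity)]; exact hle
  · have : c * (m1 / l1) * (c * (m3 / l3)) = c ^ 2 * (m1 * m3 / (l1 * l3)) := by field_simp
    rw [mul_zero, sub_zero, this, hc]; field_simp
  · field_simp; ring
  · field_simp; ring
  · field_simp; ring

theorem sep_one {C : Matrix (Fin 2) (Fin 2) (Quaternion ℝ)} {R : Matrix (Fin 2) (Fin 2) ℝ}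
    (hC : C 1 0 = C 0 1) (hR : R 1 0 = R 0 1) (h : PSDd 1 C R) : SepD 1 C R := by
  obtain ⟨h0, h1, h2⟩ := schur_one hC hR h
  obtain ⟨p, hp⟩ : ∃ p, p = (1 / 2 : ℝ) • (C 0 0 + C 1 1) := ⟨_, rfl⟩
  obtain ⟨r, hr⟩ : ∃ r, r = (1 / 2 : ℝ) • (C 0 0 - C 1 1) := ⟨_, rfl⟩
  obtain ⟨q, hq⟩ : ∃ q, q = C 0 1 := ⟨_, rfl⟩
  have c0 : C 0 0 = p + r := by rw [hp, hr]; module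
  have c2 : C 1 1 = p - r := by rw [hp, hr]; module
  clear hp hr h
  rw [c0, c2, ← hq] at h2
  rw [c0, ← hq] at h0
  rw [c2, ← hq] at h1
  -- numeric data
  have en0 : Quaternion.normSq (p + r) = Quaternion.normSq p + 2 * (star p * r).re
      + Quaternion.normSq r := by
    simp [Quaternion.normSq_def']; ring
  have en1 : Quaternion.normSq (p - r) = Quaternion.normSq p - 2 * (star p * r).re
      + Quaternion.normSq r := by
    simp [Quaternion.normSq_def']; ring
  have en2 : Quaternion.normSq ((R 0 1 : Quaternion ℝ) - (star (p + r) * q + star q * (p - r)))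
      = (R 0 1 - 2 * (star p * q).re) ^ 2
        + 4 * (Quaternion.normSq q * Quaternion.normSq r - (star q * r).re ^ 2) := by
    simp [Quaternion.normSq_def']; ring
  rw [en2] at h2
  rw [en0] at h0 h2
  rw [en1] at h1 h2
  by_cases hD : 0 < Quaternion.normSq q * Quaternion.normSq r - (star q * r).re ^ 2
  · obtain ⟨a1, a2, b1, b2, k, hk, hdet, k0, k1, k2⟩ :=
      exists_K h0 h1 Quaternion.normSq_nonneg hD h2
    obtain ⟨s, hs⟩ : ∃ s : ℝ, s = (2 * a1 * a2 + a1 * b1 - a2 * b2) / 2 := ⟨_, rfl⟩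
    obtain ⟨t, ht⟩ : ∃ t : ℝ, t = (a1 * b2 - b2 ^ 2 + b1 * a2 + b1 ^ 2) / 2 := ⟨_, rfl⟩
    have m1 : b2 + a1 * t = a1 + b1 * s := by
      rw [hs, ht]; linear_combination (a1 - b2) / 2 * hdet
    have m2 : b1 + a2 * t = -a2 + b2 * s := by
      rw [hs, ht]; linear_combination (-a2 - b1) / 2 * hdet
    refine finish_sep !![0, 1, a1; 1, 0, a2; a1, a2, s] !![1, 0, b1; 0, -1, b2; b1, b2, t]
      ?_ ?_ ?_ p q r C R ?_ ?_
    · ext i j; fin_cases i <;> fin_cases j <;> rfl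
    · ext i j; fin_cases i <;> fin_cases j <;> rfl
    · ext i j
      fin_cases i <;> fin_cases j <;> simp [Matrix.mul_apply, Fin.sum_univ_three] <;> linarith
    · intro i j
      fin_cases i <;> fin_cases j <;> simp [c0, c2, hC, ← hq, sub_eq_add_neg]
    · have hk' : 0 ≤ 1 - k := by linarith
      have f0 := mul_nonneg hk' h0
      have f1 := mul_nonneg hk' h1
      have f2 : (R 0 1 - 2 * (star p * q).re) ^ 2 ≤ _ :=
        le_trans (by linarith) h2
      have f3 := mul_le_mul_of_nonneg_left f2 (mul_nonneg hk' hk')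
      generalize Quaternion.normSq p = np at *
      generalize Quaternion.normSq q = nq at *
      generalize Quaternion.normSq r = nr at *
      generalize (star p * q).re = pq at *
      generalize (star p * r).re = pr at *
      generalize (star q * r).re = qr at *
      have ab : a1 * b2 = 2 + a2 * b1 := by linarith
      have F : ∀ M : Matrix (Fin 2) (Fin 2) ℝ,
          M 0 0 = (1 - k) * (R 0 0 - (np + 2 * pr + nr) - nq) →
          M 0 1 = (1 - k) * (R 0 1 - 2 * pq) → M 1 0 = (1 - k) * (R 0 1 - 2 * pq) →
          M 1 1 = (1 - k) * (R 1 1 - nq - (np - 2 * pr + nr)) → M.PosSemidef := by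
        intro M e0 e1 e2 e3
        apply psd_two
        · rw [e1, e2]
        · rw [e0]; exact f0
        · rw [e3]; exact f1
        · rw [e0, e1, e3]; linarith
      apply F
      · simp [Matrix.mul_apply, Fin.sum_univ_three]
        linarith
      · simp [Matrix.mul_apply, Fin.sum_univ_three]
        linear_combination (-1 : ℝ) * k1 - qr * hdet
      · simp [Matrix.mul_apply, Fin.sum_univ_three, hR]
        linear_combination (-1 : ℝ) * k1 + qr * hdet
      · simp [Matrix.mul_apply, Fin.sum_univ_three]
        linarith
  · obtain ⟨w, x, y, hx, hy⟩ : ∃ (w : Quaternion ℝ) (x y : ℝ), q = x • w ∧ r = y • w := by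
      by_cases hq0 : q = 0
      · exact ⟨r, 0, 1, by simp [hq0], by simp⟩
      · refine ⟨q, 1, (star q * r).re / Quaternion.normSq q, by simp, ?_⟩
        have hne : Quaternion.normSq q ≠ 0 := by simpa using hq0
        have hpos : 0 ≤ Quaternion.normSq q := Quaternion.normSq_nonneg
        have e : Quaternion.normSq (Quaternion.normSq q • r - (star q * r).re • q) =
            Quaternion.normSq q * (Quaternion.normSq q * Quaternion.normSq r
              - (star q * r).re ^ 2) := by
          simp [Quaternion.normSq_def']; ring
        have e' : Quaternion.normSq (Quaternion.normSq q • r - (star q * r).re • q) = 0 := by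
          apply le_antisymm _ Quaternion.normSq_nonneg
          rw [e]
          exact mul_nonpos_of_nonneg_of_nonpos hpos (by linarith)
        rw [Quaternion.normSq_eq_zero, sub_eq_zero] at e'
        rw [div_eq_inv_mul, mul_smul, ← e', smul_smul, inv_mul_cancel₀ hne, one_smul]
    have nq : Quaternion.normSq q = x ^ 2 * Quaternion.normSq w := by
      rw [hx, Quaternion.normSq_smul]
    have nr : Quaternion.normSq r = y ^ 2 * Quaternion.normSq w := by
      rw [hy, Quaternion.normSq_smul]
    have qr : (star q * r).re = x * y * Quaternion.normSq w := by
      rw [hx, hy]; simp [Quaternion.normSq_def']; ring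
    have pq : (star p * q).re = x * (star p * w).re := by
      rw [hx]; simp
    have pr : (star p * r).re = y * (star p * w).re := by
      rw [hy]; simp
    rw [nq, nr, pr] at h0 h1
    rw [nq, nr, qr, pq, pr] at h2
    refine finish_sep !![y, x, 0; x, -y, 0; 0, 0, 0] 0
      ?_ ?_ ?_ p w 0 C R ?_ ?_
    · ext i j; fin_cases i <;> fin_cases j <;> rfl
    · ext i j; fin_cases i <;> fin_cases j <;> rfl
    · simp
    · intro i j
      fin_cases i <;> fin_cases j <;> simp [c0, c2, hC, ← hq, hx, hy, sub_eq_add_neg]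
    · generalize Quaternion.normSq p = np at *
      generalize Quaternion.normSq w = nw at *
      generalize (star p * w).re = pw at *
      have F : ∀ M : Matrix (Fin 2) (Fin 2) ℝ,
          M 0 0 = (R 0 0 - (np + 2 * (y * pw) + y ^ 2 * nw) - x ^ 2 * nw) →
          M 0 1 = (R 0 1 - 2 * (x * pw)) → M 1 0 = (R 0 1 - 2 * (x * pw)) →
          M 1 1 = (R 1 1 - x ^ 2 * nw - (np - 2 * (y * pw) + y ^ 2 * nw)) → M.PosSemidef := by
        intro M e0 e1 e2 e3
        apply psd_two
        · rw [e1, e2]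
        · rw [e0]; exact h0
        · rw [e3]; exact h1
        · rw [e0, e1, e3]; linarith
      apply F <;> simp [Matrix.mul_apply, Fin.sum_univ_three, hR] <;> ring

theorem sep_sing {C : Matrix (Fin 2) (Fin 2) (Quaternion ℝ)} {R : Matrix (Fin 2) (Fin 2) ℝ}
    (hC : C 1 0 = C 0 1) (hR : R 1 0 = R 0 1) (e : ℝ) (he : e = 1 ∨ e = 0)
    (h : PSDd !![e, 0; 0, 0] C R) : SepD !![e, 0; 0, 0] C R := by
  have z1 : C 1 1 = 0 := by
    have := (two_of_forall (a := 0) (d := R 1 1) (z := C 1 1) fun y0 y1 => by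
      refine (h ![0, y0] ![0, y1]).trans_eq ?_
      simp [Fin.sum_univ_two, Quaternion.normSq_def']
      exact Or.inl (by ring)).2.2
    rw [zero_mul] at this
    exact Quaternion.normSq_eq_zero.mp (le_antisymm this Quaternion.normSq_nonneg)
  have z2 : C 0 1 = 0 := by
    have := (two_of_forall (a := 0) (d := R 0 0) (z := C 0 1) fun y0 y1 => by
      refine (h ![0, y0] ![y1, 0]).trans_eq ?_
      simp [Fin.sum_univ_two, Quaternion.normSq_def', hC]
      ring).2.2
    rw [zero_mul] at this
    exact Quaternion.normSq_eq_zero.mp (le_antisymm this Quaternion.normSq_nonneg)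
  have z3 : e = 1 ∨ e = 0 ∧ C 0 0 = 0 := by
    refine he.imp id fun he => ⟨he, ?_⟩
    have := (two_of_forall (a := 0) (d := R 0 0) (z := C 0 0) fun y0 y1 => by
      refine (h ![y0, 0] ![y1, 0]).trans_eq ?_
      simp [Fin.sum_univ_two, Quaternion.normSq_def', he]
      exact Or.inl (by ring)).2.2
    rw [zero_mul] at this
    exact Quaternion.normSq_eq_zero.mp (le_antisymm this Quaternion.normSq_nonneg)
  obtain ⟨w0, w1, w2⟩ := two_of_forall (a := R 0 0 - Quaternion.normSq (C 0 0)) (d := R 1 1)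
      (z := (R 0 1 : Quaternion ℝ)) fun y0 y1 => by
    refine (h ![- (C 0 0 * y0), 0] ![y0, y1]).trans_eq ?_
    rcases z3 with rfl | ⟨rfl, z3⟩
    · simp [Fin.sum_univ_two, Quaternion.normSq_def', hC, hR, z1, z2]
      ring
    · simp [Fin.sum_univ_two, Quaternion.normSq_def', hC, hR, z1, z2, z3, Quaternion.re_zero,
        Quaternion.imI_zero, Quaternion.imJ_zero, Quaternion.imK_zero]
      ring
  rw [Quaternion.normSq_coe] at w2
  have g1 := SepD.gen e (Quaternion.normSq (C 0 0)) (C 0 0) !![1, 0; 0, 0]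
    (by rcases he with rfl | rfl <;> norm_num) Quaternion.normSq_nonneg
    (by
      rw [sq, ← Quaternion.normSq_eq_norm_mul_self]
      rcases z3 with rfl | ⟨rfl, z3⟩
      · simp
      · simp [z3])
    (psd_two (by simp) (by simp) (by simp) (by simp))
  have g2 := SepD.gen 0 1 0 (R - !![Quaternion.normSq (C 0 0), 0; 0, 0]) le_rfl zero_le_one
    (by simp) (psd_two (by simp [hR]) (by simpa using w0) (by simpa using w1) (by simpa using w2))
  refine (g1.plus g2).of_eq ?_ ?_ ?_
  · ext i j; fin_cases i <;> fin_cases j <;> simp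
  · ext1 i j; fin_cases i <;> fin_cases j <;> simp [hC, z1, z2]
  · ext i j; fin_cases i <;> fin_cases j <;> simp

theorem factor {P : Matrix (Fin 2) (Fin 2) ℝ} (hs : P 1 0 = P 0 1) (h0 : 0 ≤ P 0 0)
    (h1 : 0 ≤ P 1 1) (h : P 0 1 ^ 2 ≤ P 0 0 * P 1 1) :
    ∃ T N : Matrix (Fin 2) (Fin 2) ℝ, T.det ≠ 0 ∧
      (N = 1 ∨ N = !![1, 0; 0, 0] ∨ N = !![0, 0; 0, 0]) ∧ cong T N = P := by
  rcases h.lt_or_eq with h | h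
  · obtain ⟨m1, m2, m3, hm1, hm3, e0, e1, e2⟩ := chol h0 (sub_pos.mpr h)
    refine ⟨!![m1, 0; m2, m3], 1, ?_, Or.inl rfl, ?_⟩
    · rw [det_fin_two_of]; nlinarith [mul_pos hm1 hm3]
    · ext i j
      fin_cases i <;> fin_cases j <;> simp [cong, Fin.sum_univ_two, hs, e0, e1, e2] <;> ring
  · have key : ∀ t1 t2 : ℝ, t1 ^ 2 + t2 ^ 2 ≠ 0 → P 0 0 = t1 ^ 2 → P 0 1 = t1 * t2 →
        P 1 1 = t2 ^ 2 → ∃ T N : Matrix (Fin 2) (Fin 2) ℝ, T.det ≠ 0 ∧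
      (N = 1 ∨ N = !![1, 0; 0, 0] ∨ N = !![0, 0; 0, 0]) ∧ cong T N = P := by
      intro t1 t2 ht e0 e1 e2
      refine ⟨!![t1, -t2; t2, t1], !![1, 0; 0, 0], ?_, Or.inr (Or.inl rfl), ?_⟩
      · rw [det_fin_two_of]; intro h; apply ht; linarith
      · ext i j
        fin_cases i <;> fin_cases j <;> simp [cong, Fin.sum_univ_two, hs, e0, e1, e2] <;> ring
    rcases h0.eq_or_lt with h0' | h0'
    · have h01 : P 0 1 = 0 := by rw [← h0', zero_mul] at h; exact pow_eq_zero_iff (two_ne_zero) |>.mp h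
      rcases h1.eq_or_lt with h1' | h1'
      · refine ⟨1, !![0, 0; 0, 0], by simp, Or.inr (Or.inr rfl), ?_⟩
        rw [cong_one]
        ext i j
        fin_cases i <;> fin_cases j <;> simp [hs, h01, ← h0', ← h1']
      · have := Real.sq_sqrt h1
        exact key 0 (√(P 1 1)) (by rw [this]; linarith) (by simp [← h0']) (by simp [h01]) this.symm
    · have s1 := Real.sq_sqrt h0
      have p1 := Real.sqrt_pos.mpr h0'
      refine key (√(P 0 0)) (P 0 1 / √(P 0 0)) (by positivity) s1.symm (by field_simp) ?_
      rw [div_pow, s1, h]; field_simp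

theorem sep_main {P R : Matrix (Fin 2) (Fin 2) ℝ} {C : Matrix (Fin 2) (Fin 2) (Quaternion ℝ)}
    (hP : P.IsSymm) (hC : C.IsSymm) (hR : R.IsSymm) (h : PSDd P C R) : SepD P C R := by
  have hP' := hP.apply 0 1
  obtain ⟨w0, w1, w2⟩ := two_of_forall (a := P 0 0) (d := P 1 1)
      (z := (P 0 1 : Quaternion ℝ)) fun y0 y1 => by
    refine (h ![y0, y1] 0).trans_eq ?_
    simp [Fin.sum_univ_two, Quaternion.normSq_def', hP']
    ring
  rw [Quaternion.normSq_coe] at w2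
  obtain ⟨T, N, hT, hN, rfl⟩ := factor hP' w0 w1 w2
  have hTU : T * T⁻¹ = 1 := mul_nonsing_inv _ (isUnit_iff_ne_zero.mpr hT)
  have hUT : T⁻¹ * T = 1 := nonsing_inv_mul _ (isUnit_iff_ne_zero.mpr hT)
  have h' := h.cong T⁻¹
  have c1 := (cong_symm T⁻¹ hC).apply 0 1
  have r1 := (cong_symm T⁻¹ hR).apply 0 1
  rw [cong_cong, hUT, cong_one] at h'
  have hs : SepD N (cong T⁻¹ C) (cong T⁻¹ R) := by
    rcases hN with rfl | rfl | rfl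
    · exact sep_one c1 r1 h'
    · exact sep_sing c1 r1 1 (Or.inl rfl) h'
    · exact sep_sing c1 r1 0 (Or.inr rfl) h'
  have := hs.cong T
  rwa [cong_cong, cong_cong, hTU, cong_one, cong_one] at this

/-- A quaternionic hermitian `4 × 4` matrix in `Q(2) ⊗ S(2)`
(blocks `[[B11, B12], [conj B12, B22]]` with `B11, B22` real symmetric and `B12`
symmetric) which is PPT (both it and its entrywise quaternionic conjugate are PSD)
is `Q₊(2) ⊗ S₊(2)`-separable. -/
theorem stmt_4
    (B : Matrix (Fin 2 × Fin 2) (Fin 2 × Fin 2) (Quaternion ℝ))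
    (B11 B22 : Matrix (Fin 2) (Fin 2) ℝ)
    (B12 : Matrix (Fin 2) (Fin 2) (Quaternion ℝ))
    (h11 : B11.IsSymm) (h22 : B22.IsSymm) (h12 : B12.IsSymm)
    (hblock : ∀ (a b : Fin 2) (i j : Fin 2),
      B (a, i) (b, j) =
        ![![B11.map (algebraMap ℝ (Quaternion ℝ)), B12],
          ![B12.map (star : Quaternion ℝ → Quaternion ℝ),
            B22.map (algebraMap ℝ (Quaternion ℝ))]] a b i j)
    (hpsd : QuatPSD B)
    (hpsdc : QuatPSD (B.map (star : Quaternion ℝ → Quaternion ℝ))) :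
    ∃ (N : ℕ) (A : Fin N → Matrix (Fin 2) (Fin 2) (Quaternion ℝ))
      (S : Fin N → Matrix (Fin 2) (Fin 2) ℝ),
      (∀ l, QuatPSD (A l)) ∧ (∀ l, (S l).PosSemidef) ∧
      B = ∑ l, A l ⊗ₖ (S l).map (algebraMap ℝ (Quaternion ℝ)) := by
  have hB : B = mkB B11 B12 B22 := by
    ext1 ⟨a, i⟩ ⟨b, j⟩
    exact hblock a b i j
  subst hB
  exact (sep_main h11 h12 h22 (PSDd.of_mkB h12 hpsd)).isSep
end

section
/- Let B be a complex hermitian 6×6 matrix partitioned into four 3×3 blocks B = [[B11, B12], [B̄12, B22]], where B11 and B22 are real symmetric 3×3 matrices and B12 is a symmetric (B12ᵀ = B12) complex 3×3 matrix (so B lies in the tensor product space H(2)⊗S(3)). If B is positive semidefinite, then B is H_+(2)⊗S_+(3)-separable, i.e. B = Σ_{l=1}^N A_l ⊗ S_l (Kronecker product) for some finite N, positive semidefinite complex hermitian 2×2 matrices A_l and positive semidefinite real symmetric 3×3 matrices S_l. -/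
open Matrix Kronecker
open scoped ComplexOrder

def SepCone (n : ℕ) : AddSubmonoid (Matrix (Fin 2 × Fin n) (Fin 2 × Fin n) ℂ) :=
  AddSubmonoid.closure {M | ∃ (A : Matrix (Fin 2) (Fin 2) ℂ) (S : Matrix (Fin n) (Fin n) ℝ),
    A.PosSemidef ∧ S.PosSemidef ∧ M = A ⊗ₖ S.map Complex.ofReal}

def InL {n : ℕ} (B : Matrix (Fin 2 × Fin n) (Fin 2 × Fin n) ℂ) : Prop :=
  ∀ a b i j, B (a, i) (b, j) = B (a, j) (b, i)

def PSep (n : ℕ) : Prop :=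
  ∀ B : Matrix (Fin 2 × Fin n) (Fin 2 × Fin n) ℂ, B.PosSemidef → InL B → B ∈ SepCone n

lemma sep_smul {n : ℕ} (t : ℝ) (ht : 0 ≤ t) {B : Matrix (Fin 2 × Fin n) (Fin 2 × Fin n) ℂ}
    (hB : B ∈ SepCone n) : (t : ℂ) • B ∈ SepCone n := by
  unfold SepCone at hB
  induction hB using AddSubmonoid.closure_induction with
  | mem x hx =>
    obtain ⟨A, S, hA, hS, rfl⟩ := hx
    apply AddSubmonoid.subset_closure
    refine ⟨(t : ℂ) • A, S, hA.smul (by exact_mod_cast ht), hS, ?_⟩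
    rw [Matrix.smul_kronecker]
  | zero => simp [zero_mem]
  | add x y _ _ hx hy => rw [smul_add]; exact add_mem hx hy

lemma sep_conj {n m : ℕ} (R : Matrix (Fin n) (Fin m) ℝ)
    {B : Matrix (Fin 2 × Fin n) (Fin 2 × Fin n) ℂ} (hB : B ∈ SepCone n) :
    ((1 : Matrix (Fin 2) (Fin 2) ℂ) ⊗ₖ R.map Complex.ofReal)ᴴ * B *
      ((1 : Matrix (Fin 2) (Fin 2) ℂ) ⊗ₖ R.map Complex.ofReal) ∈ SepCone m := by
  unfold SepCone at hB
  induction hB using AddSubmonoid.closure_induction with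
  | mem x hx =>
    obtain ⟨A, S, hA, hS, rfl⟩ := hx
    apply AddSubmonoid.subset_closure
    refine ⟨A, Rᴴ * S * R, hA, hS.conjTranspose_mul_mul_same R, ?_⟩
    rw [Matrix.conjTranspose_kronecker, ← Matrix.mul_kronecker_mul, ← Matrix.mul_kronecker_mul]
    congr 1
    · simp
    · ext i j
      simp [Matrix.mul_apply]
  | zero => simp [zero_mem]
  | add x y _ _ hx hy => rw [Matrix.mul_add, Matrix.add_mul]; exact add_mem hx hy

noncomputable def redMat {n : ℕ} (x : Fin (n+1) → ℝ) (p : Fin (n+1)) : Matrix (Fin n) (Fin (n+1)) ℝ :=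
  fun q r => if r = p then - x (p.succAbove q) / x p else if r = p.succAbove q then 1 else 0

lemma col_red {n : ℕ} {κ : Type*} [Fintype κ] (x : Fin (n+1) → ℝ) (p : Fin (n+1)) (hp : x p ≠ 0)
    (M : Matrix κ (Fin 2 × Fin (n+1)) ℂ)
    (h : ∀ k b, ∑ j, M k (b, j) * (x j : ℂ) = 0) :
    M = M.submatrix id (Prod.map id p.succAbove) *
      ((1 : Matrix (Fin 2) (Fin 2) ℂ) ⊗ₖ (redMat x p).map Complex.ofReal) := by
  ext k ⟨b, r⟩
  have hp' : (x p : ℂ) ≠ 0 := by exact_mod_cast hp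
  have hk := h k b
  rw [Fin.sum_univ_succAbove _ p] at hk
  have : (M.submatrix id (Prod.map id p.succAbove) *
      ((1 : Matrix (Fin 2) (Fin 2) ℂ) ⊗ₖ (redMat x p).map Complex.ofReal)) k (b, r)
      = ∑ q, M k (b, p.succAbove q) * (redMat x p q r : ℂ) := by
    rw [Matrix.mul_apply, Fintype.sum_prod_type, Finset.sum_eq_single b]
    · simp
    · intro c _ hc
      simp [hc]
    · simp
  rw [this]
  rcases Fin.eq_self_or_eq_succAbove p r with rfl | ⟨q, rfl⟩
  · simp only [redMat, if_true]
    have : ∑ q, M k (b, r.succAbove q) * ((-x (r.succAbove q) / x r : ℝ) : ℂ)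
      = -(∑ q, M k (b, r.succAbove q) * (x (r.succAbove q) : ℂ)) / x r := by
      rw [neg_div, Finset.sum_div, ← Finset.sum_neg_distrib]
      refine Finset.sum_congr rfl fun q _ => ?_
      push_cast; ring
    rw [this, eq_div_iff hp']
    linear_combination hk
  · rw [Finset.sum_eq_single q]
    · simp [redMat, Fin.succAbove_ne]
    · intro c _ hc
      have : p.succAbove q ≠ p.succAbove c := fun h => hc (Fin.succAbove_right_injective h).symm
      simp [redMat, Fin.succAbove_ne, this]
    · simp

lemma kernel_red {n : ℕ} (hP : PSep n) (B : Matrix (Fin 2 × Fin (n+1)) (Fin 2 × Fin (n+1)) ℂ)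
    (hB : B.PosSemidef) (hL : InL B) (x : Fin (n+1) → ℝ) (hx : x ≠ 0)
    (h : ∀ k b, ∑ j, B k (b, j) * (x j : ℂ) = 0) : B ∈ SepCone (n+1) := by
  obtain ⟨p, hp⟩ := Function.ne_iff.mp hx
  have h1 := col_red x p hp B h
  have h2 := col_red x p hp (B.submatrix (Prod.map id p.succAbove : Fin 2 × Fin n → _) id)
    (fun k b => h _ _)
  have h3 : B.submatrix id (Prod.map id p.succAbove : Fin 2 × Fin n → _) =
    ((1 : Matrix (Fin 2) (Fin 2) ℂ) ⊗ₖ (redMat x p).map Complex.ofReal)ᴴ *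
     B.submatrix (Prod.map id p.succAbove) (Prod.map id p.succAbove) := by
    have := congrArg Matrix.conjTranspose h2
    rw [Matrix.conjTranspose_mul] at this
    simpa [Matrix.conjTranspose_submatrix, hB.isHermitian.eq] using this
  rw [h1, h3]
  apply sep_conj
  apply hP _ (hB.submatrix _)
  intro a b i j
  exact hL _ _ _ _

/-- real kernel vector of the pencil -/
lemma exists_pencil {n : ℕ} (V : Fin 2 → Matrix (Fin (n+1)) (Fin (n+1)) ℂ) :
    ∃ (k : Fin 2) (c : Fin 2 → ℂ) (z : Fin (n+1) → ℂ), z ≠ 0 ∧ c k = 1 ∧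
      ∀ j, V j *ᵥ z = c j • (V k *ᵥ z) := by
  by_cases hd : (V 1).det = 0
  · obtain ⟨z, hz, hz0⟩ := Matrix.exists_mulVec_eq_zero_iff.mpr hd
    refine ⟨0, ![1, 0], z, hz, rfl, fun j => ?_⟩
    fin_cases j <;> simp [hz0]
  · obtain ⟨c, hc⟩ := Module.End.exists_eigenvalue (Matrix.toLin' ((V 1)⁻¹ * V 0))
    obtain ⟨z, hz⟩ := hc.exists_hasEigenvector
    refine ⟨1, ![c, 1], z, hz.2, rfl, fun j => ?_⟩
    have := hz.apply_eq_smul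
    rw [Matrix.toLin'_apply] at this
    have h2 := congrArg (fun v => V 1 *ᵥ v) this
    simp only [Matrix.mulVec_mulVec, ← Matrix.mul_assoc,
      Matrix.mul_nonsing_inv _ (Ne.isUnit hd), Matrix.one_mul, Matrix.mulVec_smul] at h2
    fin_cases j <;> simp [h2]

lemma real_kernel {n : ℕ} (M : Matrix (Fin n) (Fin n) ℂ) (h : (Mᴴ * M).IsSymm)
    (z : Fin n → ℂ) (hz : M *ᵥ z = 0) : M *ᵥ (star z) = 0 := by
  have h0 : (Mᴴ * M) *ᵥ z = 0 := by rw [← Matrix.mulVec_mulVec, hz, Matrix.mulVec_zero]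
  rw [← Matrix.conjTranspose_mul_self_mulVec_eq_zero]
  have h1 := congrArg star h0
  rw [Matrix.star_mulVec, (Matrix.isHermitian_conjTranspose_mul_self M).eq,
    ← Matrix.mulVec_transpose, h.eq] at h1
  simpa using h1

lemma diag_red {r n : ℕ}
    (hP : ∀ V : Matrix (Fin r) (Fin 2 × Fin n) ℂ, InL (Vᴴ * V) → Vᴴ * V ∈ SepCone n)
    (V : Matrix (Fin (r+1)) (Fin 2 × Fin n) ℂ) (e : Fin (r+1) → ℝ) (he : ∀ i, 0 ≤ e i)
    (m : Fin (r+1)) (hm : e m = 0)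
    (hL : InL (Vᴴ * Matrix.diagonal (fun i => (e i : ℂ)) * V)) :
    Vᴴ * Matrix.diagonal (fun i => (e i : ℂ)) * V ∈ SepCone n := by
  have : Vᴴ * Matrix.diagonal (fun i => (e i : ℂ)) * V =
    (Matrix.of fun i j => (Real.sqrt (e (m.succAbove i)) : ℂ) * V (m.succAbove i) j)ᴴ *
    (Matrix.of fun i j => (Real.sqrt (e (m.succAbove i)) : ℂ) * V (m.succAbove i) j) := by
    ext a b
    rw [Matrix.mul_apply, Matrix.mul_apply]
    simp only [Matrix.mul_diagonal, Matrix.conjTranspose_apply, Matrix.of_apply]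
    rw [Fin.sum_univ_succAbove _ m, hm]
    simp only [Complex.ofReal_zero, mul_zero, zero_mul, zero_add]
    refine Finset.sum_congr rfl fun i _ => ?_
    have : (Real.sqrt (e (m.succAbove i)) : ℂ) * (Real.sqrt (e (m.succAbove i)) : ℂ)
      = e (m.succAbove i) := by
      exact_mod_cast Real.mul_self_sqrt (he _)
    rw [← this]
    simp
    ring
  rw [this] at hL ⊢
  exact hP _ hL

lemma exists_real {n : ℕ} (V : Matrix (Fin (n+1)) (Fin 2 × Fin (n+1)) ℂ) (hL : InL (Vᴴ * V)) :
    ∃ (k : Fin 2) (c : Fin 2 → ℂ) (x : Fin (n+1) → ℝ), x ≠ 0 ∧ c k = 1 ∧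
      ∀ j p, ∑ q, V p (j, q) * (x q : ℂ) = c j * ∑ q, V p (k, q) * (x q : ℂ) := by
  obtain ⟨k, c, z, hz, hck, h⟩ := exists_pencil (fun j => V.submatrix id (fun i => (j, i)))
  have h1 : ∀ j, V.submatrix id (fun i => (j, i)) *ᵥ (star z)
      = c j • (V.submatrix id (fun i => (k, i)) *ᵥ (star z)) := by
    intro j
    have key := real_kernel (V.submatrix id (fun i => (j, i)) - c j • V.submatrix id (fun i => (k, i)))
      ?_ z ?_
    · rw [Matrix.sub_mulVec, Matrix.smul_mulVec, sub_eq_zero] at key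
      exact key
    · have e : ∀ a b, (V.submatrix id (fun i => (a, i)))ᴴ * V.submatrix id (fun i => (b, i))
          = Matrix.of fun i j => (Vᴴ * V) (a, i) (b, j) := by
        intro a b; ext i j; simp [Matrix.mul_apply]
      rw [Matrix.conjTranspose_sub, Matrix.conjTranspose_smul, Matrix.sub_mul, Matrix.mul_sub,
        Matrix.mul_sub, Matrix.smul_mul, Matrix.smul_mul, Matrix.mul_smul, Matrix.mul_smul]
      simp only [e]
      ext p q
      simp only [Matrix.transpose_apply, Matrix.sub_apply, Matrix.smul_apply, Matrix.of_apply]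
      rw [hL j j, hL j k, hL k j, hL k k]
    · rw [Matrix.sub_mulVec, Matrix.smul_mulVec, sub_eq_zero]
      exact h j
  have A : ∀ j p, ∑ q, V p (j, q) * z q = c j * ∑ q, V p (k, q) * z q := by
    intro j p
    have := congrFun (h j) p
    simpa [Matrix.mulVec, dotProduct] using this
  have A' : ∀ j p, ∑ q, V p (j, q) * star (z q) = c j * ∑ q, V p (k, q) * star (z q) := by
    intro j p
    have := congrFun (h1 j) p
    simpa [Matrix.mulVec, dotProduct] using this
  by_cases hre : (fun q => (z q).re) = 0
  · have him : (fun q => (z q).im) ≠ 0 := by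
      intro him
      apply hz
      ext q
      exact Complex.ext (congrFun hre q) (congrFun him q)
    refine ⟨k, c, _, him, hck, fun j p => ?_⟩
    have e : ∀ j, ∑ q, V p (j, q) * ((z q).im : ℂ) =
        (∑ q, V p (j, q) * z q - ∑ q, V p (j, q) * star (z q)) / (2 * Complex.I) := by
      intro j
      rw [← Finset.sum_sub_distrib, Finset.sum_div]
      refine Finset.sum_congr rfl fun q _ => ?_
      rw [Complex.im_eq_sub_conj]
      simp; ring
    rw [e, e, A, A']; ring
  · refine ⟨k, c, _, hre, hck, fun j p => ?_⟩
    have e : ∀ j, ∑ q, V p (j, q) * ((z q).re : ℂ) =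
        (∑ q, V p (j, q) * z q + ∑ q, V p (j, q) * star (z q)) / 2 := by
      intro j
      rw [← Finset.sum_add_distrib, Finset.sum_div]
      refine Finset.sum_congr rfl fun q _ => ?_
      rw [Complex.re_eq_add_conj]
      simp; ring
    rw [e, e, A, A']; ring

lemma square_case {n : ℕ} (hP : PSep n) (V : Matrix (Fin (n+1)) (Fin 2 × Fin (n+1)) ℂ)
    (hL : InL (Vᴴ * V)) : Vᴴ * V ∈ SepCone (n+1) := by
  obtain ⟨k, c, x, hx, hck, h⟩ := exists_real V hL
  -- generic kernel fact
  have hker : ∀ U : Matrix (Fin (n+1)) (Fin 2 × Fin (n+1)) ℂ,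
      (∀ j p, ∑ q, U p (j, q) * (x q : ℂ) = 0) →
      ∀ l b, ∑ j, (Uᴴ * U) l (b, j) * (x j : ℂ) = 0 := by
    intro U hU l b
    simp only [Matrix.mul_apply, Finset.sum_mul]
    rw [Finset.sum_comm]
    refine Finset.sum_eq_zero fun p _ => ?_
    simp only [mul_assoc]
    rw [← Finset.mul_sum, hU, mul_zero]
  set y : Fin (n+1) → ℂ := fun p => ∑ q, V p (k, q) * (x q : ℂ) with hy
  by_cases hy0 : y = 0
  · refine kernel_red hP _ (Matrix.posSemidef_conjTranspose_mul_self V) hL x hx (hker V ?_)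
    intro j p
    rw [h]
    have := congrFun hy0 p
    simp only [hy, Pi.zero_apply] at this
    rw [this, mul_zero]
  -- main case
  set s : ℝ := ∑ p, Complex.normSq (y p) with hs
  have hsC : (s : ℂ) = ∑ p, star (y p) * y p := by
    rw [hs]; push_cast
    refine Finset.sum_congr rfl fun p _ => ?_
    rw [Complex.normSq_eq_conj_mul_self]; rfl
  have hspos : 0 < s := by
    obtain ⟨p, hp⟩ := Function.ne_iff.mp hy0
    exact Finset.sum_pos' (fun p _ => Complex.normSq_nonneg _)
      ⟨p, Finset.mem_univ _, Complex.normSq_pos.mpr hp⟩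
  have hs0 : (s : ℂ) ≠ 0 := by exact_mod_cast hspos.ne'
  set w : Fin 2 × Fin (n+1) → ℂ := fun t => ∑ p, star (y p) * V p t with hw
  have hw1 : ∀ j i, w (j, i) = c j * star (w (k, i)) := by
    intro j i
    have e1 : w (j, i) = ∑ q, (Vᴴ * V) (k, q) (j, i) * (x q : ℂ) := by
      simp only [hw, hy, Matrix.mul_apply, Matrix.conjTranspose_apply, Finset.sum_mul, star_sum]
      rw [Finset.sum_comm]
      refine Finset.sum_congr rfl fun p _ => Finset.sum_congr rfl fun q _ => ?_
      simp; ring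
    rw [e1]
    simp only [hL k j _ i]
    simp only [Matrix.mul_apply, Matrix.conjTranspose_apply, Finset.sum_mul, hw]
    rw [Finset.sum_comm, star_sum, Finset.mul_sum]
    refine Finset.sum_congr rfl fun p _ => ?_
    simp only [mul_assoc]
    rw [← Finset.mul_sum, h]
    simp [hy]; ring
  have hreal : ∀ i, star (w (k, i)) = w (k, i) := by
    intro i; have := hw1 k i; rw [hck, one_mul] at this; exact this.symm
  set g : Fin (n+1) → ℝ := fun i => (w (k, i)).re with hg
  have hgw : ∀ j i, w (j, i) = c j * (g i : ℂ) := by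
    intro j i
    rw [hw1, hreal, hg]
    congr 1
    exact (Complex.conj_eq_iff_re.mp (hreal i)).symm
  have hwx : ∀ j, ∑ q, w (j, q) * (x q : ℂ) = c j * s := by
    intro j
    simp only [hw, Finset.sum_mul]
    rw [Finset.sum_comm, hsC, Finset.mul_sum]
    refine Finset.sum_congr rfl fun p _ => ?_
    simp only [mul_assoc]
    rw [← Finset.mul_sum, h]
    simp only [hy]; ring
  set V' : Matrix (Fin (n+1)) (Fin 2 × Fin (n+1)) ℂ := Matrix.of fun p t => V p t - y p * w t / s
    with hV'
  have hdec : ∀ t u, (Vᴴ * V) t u = (V'ᴴ * V') t u + star (w t) * w u / s := by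
    intro t u
    have e : (V'ᴴ * V') t u = (Vᴴ * V) t u - (∑ p, star (V p t) * y p) * w u / s
        - star (w t) * (∑ p, star (y p) * V p u) / s
        + star (w t) * w u / s / s * ∑ p, star (y p) * y p := by
      simp only [Matrix.mul_apply, Matrix.conjTranspose_apply, hV', Matrix.of_apply,
        Finset.mul_sum, Finset.sum_mul, Finset.sum_div]
      rw [← Finset.sum_sub_distrib, ← Finset.sum_sub_distrib, ← Finset.sum_add_distrib]
      refine Finset.sum_congr rfl fun p _ => ?_
      simp; ring
    have e2 : (∑ p, star (V p t) * y p) = star (w t) := by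
      simp only [hw, star_sum]
      refine Finset.sum_congr rfl fun p _ => ?_
      simp; ring
    have e3 : (∑ p, star (y p) * V p u) = w u := rfl
    rw [e, e2, e3, ← hsC]
    field_simp
    ring
  have hmem : (Matrix.vecMulVec (star c) c) ⊗ₖ
      ((Matrix.vecMulVec g (star g)).map Complex.ofReal) ∈ SepCone (n+1) := by
    apply AddSubmonoid.subset_closure
    refine ⟨_, _, ?_, Matrix.posSemidef_vecMulVec_self_star g, rfl⟩
    exact Matrix.posSemidef_vecMulVec_star_self c
  have hsum : Vᴴ * V = V'ᴴ * V' + ((s⁻¹ : ℝ) : ℂ) • ((Matrix.vecMulVec (star c) c) ⊗ₖ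
      ((Matrix.vecMulVec g (star g)).map Complex.ofReal)) := by
    ext ⟨a, i⟩ ⟨b, j⟩
    rw [hdec, Matrix.add_apply, hgw, hgw]
    simp [Matrix.vecMulVec_apply]
    ring
  rw [hsum]
  refine add_mem ?_ (sep_smul _ (inv_nonneg.mpr hspos.le) hmem)
  refine kernel_red hP _ (Matrix.posSemidef_conjTranspose_mul_self V') ?_ x hx (hker V' ?_)
  · intro a b i j
    have h1 := hdec (a, i) (b, j)
    have h2 := hdec (a, j) (b, i)
    rw [hL a b i j, h2] at h1
    simp only [hgw] at h1
    simp at h1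
    linear_combination -h1
  · intro j p
    simp only [hV', Matrix.of_apply, sub_mul, Finset.sum_sub_distrib]
    have : ∑ q, y p * w (j, q) / s * (x q : ℂ) = y p * (∑ q, w (j, q) * (x q : ℂ)) / s := by
      rw [Finset.mul_sum, Finset.sum_div]
      exact Finset.sum_congr rfl fun q _ => by ring
    rw [this, hwx, h]
    field_simp
    simp [hy]

noncomputable def hermOf (r : ℕ) : Matrix (Fin r) (Fin r) ℝ →ₗ[ℝ] Matrix (Fin r) (Fin r) ℂ where
  toFun M := Matrix.of fun p q => ⟨M p q + M q p, M p q - M q p⟩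
  map_add' M N := by
    ext p q; apply Complex.ext <;> simp <;> ring
  map_smul' t M := by
    ext p q; apply Complex.ext <;> simp <;> ring

noncomputable def cons {r n : ℕ} (V : Matrix (Fin r) (Fin 2 × Fin n) ℂ) :
    Matrix (Fin r) (Fin r) ℝ →ₗ[ℝ] ℝ × ({t : Fin n × Fin n // t.1 < t.2} × Fin 2 × Fin 2 → ℝ) where
  toFun M := (M.trace, fun u =>
    ((Vᴴ * hermOf r M * V) (u.2.1, u.1.1.1) (u.2.2, u.1.1.2)
      - (Vᴴ * hermOf r M * V) (u.2.1, u.1.1.2) (u.2.2, u.1.1.1)).re +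
    ((Vᴴ * hermOf r M * V) (u.2.1, u.1.1.1) (u.2.2, u.1.1.2)
      - (Vᴴ * hermOf r M * V) (u.2.1, u.1.1.2) (u.2.2, u.1.1.1)).im)
  map_add' M N := by
    ext u
    · simp
    · simp [Matrix.mul_add, Matrix.add_mul]; ring
  map_smul' t M := by
    ext u
    · simp
    · simp; ring

lemma exists_herm {r n : ℕ} (hn0 : 0 < n) (hn : n ≤ 3) (hr : n < r) (V : Matrix (Fin r) (Fin 2 × Fin n) ℂ) :
    ∃ H : Matrix (Fin r) (Fin r) ℂ, H.IsHermitian ∧ H ≠ 0 ∧ H.trace = 0 ∧ InL (Vᴴ * H * V) := by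
  have hk : LinearMap.ker (cons V) ≠ ⊥ := by
    apply LinearMap.ker_ne_bot_of_finrank_lt
    rw [Module.finrank_prod, Module.finrank_self, Module.finrank_fintype_fun_eq_card,
      Module.finrank_matrix, Module.finrank_self]
    simp only [Fintype.card_prod, Fintype.card_fin]
    have h1 : (n + 1) * (n + 1) ≤ r * r := Nat.mul_le_mul hr hr
    have h2 : 1 + Fintype.card {t : Fin n × Fin n // t.1 < t.2} * (2 * 2) < (n+1) * (n+1) := by
      clear h1 V hr
      interval_cases n <;> decide
    omega
  obtain ⟨M, hM, hM0⟩ := (Submodule.ne_bot_iff _).mp hk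
  rw [LinearMap.mem_ker] at hM
  have hH : (hermOf r M).IsHermitian := by
    ext p q; apply Complex.ext <;> simp [hermOf] <;> ring
  refine ⟨hermOf r M, hH, ?_, ?_, ?_⟩
  · intro h0
    apply hM0
    ext p q
    have := congrFun (congrFun h0 p) q
    have h1 := congrArg Complex.re this
    have h2 := congrArg Complex.im this
    simp [hermOf] at h1 h2
    simp; linarith
  · have := congrArg Prod.fst hM
    simp [cons, Matrix.trace] at this
    apply Complex.ext
    · simp [hermOf, Matrix.trace, Finset.sum_add_distrib, this]
    · simp [hermOf, Matrix.trace]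
  · have hK : (Vᴴ * hermOf r M * V).IsHermitian := Matrix.isHermitian_conjTranspose_mul_mul V hH
    set K := Vᴴ * hermOf r M * V with hKdef
    have main : ∀ (p q : Fin n), p < q → ∀ a b, K (a, p) (b, q) = K (a, q) (b, p) := by
      intro p q hpq a b
      have f : ∀ a b, (K (a, p) (b, q) - K (a, q) (b, p)).re +
          (K (a, p) (b, q) - K (a, q) (b, p)).im = 0 := fun a b =>
        congrFun (congrArg Prod.snd hM) (⟨(p, q), hpq⟩, a, b)
      have f1 := f a b
      have f2 := f b a
      rw [← hK.apply (b, p) (a, q), ← hK.apply (b, q) (a, p)] at f2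
      simp at f1 f2
      apply Complex.ext <;> linarith
    intro a b i j
    rcases lt_trichotomy i j with hij | rfl | hij
    · exact main i j hij a b
    · rfl
    · exact (main j i hij a b).symm

lemma row_red {r n : ℕ} (hn0 : 0 < n) (hn : n ≤ 3) (hr : n ≤ r)
    (hP : ∀ V : Matrix (Fin r) (Fin 2 × Fin n) ℂ, InL (Vᴴ * V) → Vᴴ * V ∈ SepCone n)
    (V : Matrix (Fin (r+1)) (Fin 2 × Fin n) ℂ) (hL : InL (Vᴴ * V)) :
    Vᴴ * V ∈ SepCone n := by
  obtain ⟨H, hH, hH0, htr, hHL⟩ := exists_herm hn0 hn (Nat.lt_succ_of_le hr) V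
  obtain ⟨U, d, hU, hsp⟩ : ∃ (U : Matrix (Fin (r+1)) (Fin (r+1)) ℂ) (d : Fin (r+1) → ℝ),
      U * Uᴴ = 1 ∧ H = U * Matrix.diagonal (fun i => (d i : ℂ)) * Uᴴ := by
    refine ⟨hH.eigenvectorUnitary, hH.eigenvalues, ?_, ?_⟩
    · exact Unitary.coe_mul_star_self _
    · have := hH.spectral_theorem
      rw [Unitary.conjStarAlgAut_apply] at this
      exact this
  have hU' : Uᴴ * U = 1 := mul_eq_one_comm.mp hU
  have htr' : ∑ i, d i = 0 := by
    rw [hsp, Matrix.trace_mul_comm, ← Matrix.mul_assoc, hU', Matrix.one_mul,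
      Matrix.trace_diagonal] at htr
    exact_mod_cast htr
  set W := Uᴴ * V with hW
  have hWW : Wᴴ * W = Vᴴ * V := by
    rw [hW, Matrix.conjTranspose_mul, Matrix.conjTranspose_conjTranspose, Matrix.mul_assoc,
      ← Matrix.mul_assoc U, hU, Matrix.one_mul]
  have hWH : Wᴴ * Matrix.diagonal (fun i => (d i : ℂ)) * W = Vᴴ * H * V := by
    rw [hW, hsp, Matrix.conjTranspose_mul, Matrix.conjTranspose_conjTranspose]
    simp only [Matrix.mul_assoc]
  obtain ⟨m, hm⟩ := Finite.exists_min d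
  obtain ⟨m', hm'⟩ := Finite.exists_max d
  have hlt : d m < d m' := by
    by_contra hcon
    have hall : ∀ i, d i = d m := fun i => le_antisymm ((hm' i).trans (not_lt.mp hcon)) (hm i)
    apply hH0
    have h0 : d m = 0 := by
      simp only [hall, Finset.sum_const, Finset.card_univ, Fintype.card_fin, nsmul_eq_mul] at htr'
      rcases mul_eq_zero.mp htr' with h | h
      · exact absurd h (by positivity)
      · exact h
    rw [hsp]
    simp [hall, h0]
  have key : ∀ α β : ℝ, Wᴴ * Matrix.diagonal (fun i => ((α * d i + β : ℝ) : ℂ)) * W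
      = (α : ℂ) • (Vᴴ * H * V) + (β : ℂ) • (Vᴴ * V) := by
    intro α β
    rw [← hWH, ← hWW]
    have : Matrix.diagonal (fun i => ((α * d i + β : ℝ) : ℂ))
        = (α : ℂ) • Matrix.diagonal (fun i => (d i : ℂ)) + (β : ℂ) • 1 := by
      ext i j
      by_cases hij : i = j
      · subst hij; simp
      · simp [hij]
    rw [this]
    simp [Matrix.mul_add, Matrix.add_mul]
  have keyL : ∀ α β : ℝ, InL (Wᴴ * Matrix.diagonal (fun i => ((α * d i + β : ℝ) : ℂ)) * W) := by
    intro α β a b i j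
    rw [key]
    simp only [Matrix.add_apply, Matrix.smul_apply]
    rw [hL a b i j, hHL a b i j]
  have m1 := diag_red hP W (fun i => 1 * d i + (- d m)) (fun i => by linarith [hm i]) m
    (by ring) (keyL _ _)
  have m2 := diag_red hP W (fun i => (-1) * d i + d m') (fun i => by linarith [hm' i]) m'
    (by ring) (keyL _ _)
  rw [key] at m1 m2
  have hpos : 0 < d m' - d m := sub_pos.mpr hlt
  have fin := sep_smul _ (inv_nonneg.mpr hpos.le) (add_mem m1 m2)
  convert fin using 1
  have hne : (d m' : ℂ) - d m ≠ 0 := by exact_mod_cast hpos.ne'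
  ext t u
  simp
  field_simp
  ring

section
open scoped MatrixOrder Matrix.Norms.L2Operator
lemma psd_fac {n : ℕ} {B : Matrix (Fin 2 × Fin n) (Fin 2 × Fin n) ℂ} (hB : B.PosSemidef) :
    ∃ C : Matrix (Fin 2 × Fin n) (Fin 2 × Fin n) ℂ, B = Cᴴ * C :=
  CStarAlgebra.nonneg_iff_eq_star_mul_self.mp hB.nonneg
end

lemma all_sep : ∀ n, n ≤ 3 → PSep n := by
  intro n
  induction n with
  | zero =>
    intro _ B _ _
    have : B = 0 := by ext ⟨_, i⟩; exact i.elim0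
    rw [this]; exact zero_mem _
  | succ n ih =>
    intro hn B hB hL
    have hP := ih (by omega)
    have hall : ∀ d (V : Matrix (Fin (n+1+d)) (Fin 2 × Fin (n+1)) ℂ),
        InL (Vᴴ * V) → Vᴴ * V ∈ SepCone (n+1) := by
      intro d
      induction d with
      | zero => exact fun V hV => square_case hP V hV
      | succ d ihd => exact fun V hV => row_red (r := n+1+d) (Nat.succ_pos n) hn (by omega) ihd V hV
    obtain ⟨C, hC⟩ := psd_fac hB
    let e : Fin (n+1+(n+1)) ≃ Fin 2 × Fin (n+1) :=
      (Fintype.equivFinOfCardEq (by simp; ring)).symm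
    have h2 : (C.submatrix e id)ᴴ * C.submatrix e id = B := by
      rw [hC]
      ext i j
      simp only [Matrix.mul_apply, Matrix.conjTranspose_apply, Matrix.submatrix_apply, id]
      exact e.sum_comp (fun p => star (C p i) * C p j)
    rw [← h2] at hL ⊢
    exact hall _ _ hL

lemma sep_exists {n : ℕ} {B : Matrix (Fin 2 × Fin n) (Fin 2 × Fin n) ℂ} (hB : B ∈ SepCone n) :
    ∃ (N : ℕ) (A : Fin N → Matrix (Fin 2) (Fin 2) ℂ)
      (S : Fin N → Matrix (Fin n) (Fin n) ℝ),
      (∀ l, (A l).PosSemidef) ∧ (∀ l, (S l).PosSemidef) ∧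
      B = ∑ l, A l ⊗ₖ (S l).map Complex.ofReal := by
  unfold SepCone at hB
  induction hB using AddSubmonoid.closure_induction with
  | mem x hx =>
    obtain ⟨A, S, hA, hS, rfl⟩ := hx
    exact ⟨1, fun _ => A, fun _ => S, fun _ => hA, fun _ => hS, by simp⟩
  | zero => exact ⟨0, fun _ => 0, fun _ => 0, fun l => l.elim0, fun l => l.elim0, by simp⟩
  | add x y _ _ hx hy =>
    obtain ⟨N, A, S, hA, hS, rfl⟩ := hx
    obtain ⟨N', A', S', hA', hS', rfl⟩ := hy
    refine ⟨N + N', Fin.append A A', Fin.append S S', ?_, ?_, ?_⟩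
    · intro l; refine Fin.addCases (fun i => ?_) (fun i => ?_) l <;> simp [hA, hA']
    · intro l; refine Fin.addCases (fun i => ?_) (fun i => ?_) l <;> simp [hS, hS']
    · rw [Fin.sum_univ_add]; simp

/-- A positive semidefinite complex hermitian `6 × 6` matrix in
`H(2) ⊗ S(3)` (blocks `[[B11, B12], [conj B12, B22]]` with `B11, B22` real
symmetric and `B12` complex symmetric) is `H₊(2) ⊗ S₊(3)`-separable. -/
theorem stmt_5
    (B : Matrix (Fin 2 × Fin 3) (Fin 2 × Fin 3) ℂ)
    (B11 B22 : Matrix (Fin 3) (Fin 3) ℝ)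
    (B12 : Matrix (Fin 3) (Fin 3) ℂ)
    (h11 : B11.IsSymm) (h22 : B22.IsSymm) (h12 : B12.IsSymm)
    (hblock : ∀ (a b : Fin 2) (i j : Fin 3),
      B (a, i) (b, j) =
        ![![B11.map Complex.ofReal, B12],
          ![B12.map (starRingEnd ℂ), B22.map Complex.ofReal]] a b i j)
    (hpsd : B.PosSemidef) :
    ∃ (N : ℕ) (A : Fin N → Matrix (Fin 2) (Fin 2) ℂ)
      (S : Fin N → Matrix (Fin 3) (Fin 3) ℝ),
      (∀ l, (A l).PosSemidef) ∧ (∀ l, (S l).PosSemidef) ∧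
      B = ∑ l, A l ⊗ₖ (S l).map Complex.ofReal := by
  apply sep_exists
  apply all_sep 3 le_rfl B hpsd
  intro a b i j
  rw [hblock, hblock]
  fin_cases a <;> fin_cases b
  · simp [h11.apply i j]
  · simp [h12.apply i j]
  · simp [h12.apply i j]
  · simp [h22.apply i j]
end

section
/- Let B be a quaternionic hermitian 6×6 matrix all of whose entries have zero k-component, partitioned into four 3×3 blocks B = [[B11, B12], [B̄12, B22]], where B11 and B22 are real symmetric 3×3 matrices and B12 is a symmetric (B12ᵀ = B12, entrywise transpose without conjugation) quaternionic 3×3 matrix with zero k-components (so B lies in the tensor product space Q^k(2)⊗S(3)). If both B and its entrywise quaternionic conjugate B̄ are positive semidefinite, then B = Σ_{l=1}^N A_l ⊗ S_l (Kronecker product) for some finite N, positive semidefinite quaternionic hermitian 2×2 matrices A_l with all entries having zero k-component, and positive semidefinite real symmetric 3×3 matrices S_l. -/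
open Matrix Kronecker

namespace Q6

open Quaternion

set_option linter.unusedSectionVars false

section general

variable {ι κ : Type*} [Fintype ι] [Fintype κ]

lemma psd_congr {A : Matrix ι ι ℍ[ℝ]} (h : QuatPSD A) (T : Matrix ι κ ℍ[ℝ]) :
    QuatPSD (Tᴴ * A * T) := by
  refine ⟨isHermitian_conjTranspose_mul_mul T h.1, fun x => ?_⟩
  have := h.2 (T *ᵥ x)
  rw [star_mulVec, dotProduct_mulVec, vecMul_vecMul, ← dotProduct_mulVec, mulVec_mulVec] at this
  exact this

lemma dot_star_self_re (w : ι → ℍ[ℝ]) : (star w ⬝ᵥ w).re = ∑ i, normSq (w i) := by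
  have : star w ⬝ᵥ w = ((∑ i, normSq (w i) : ℝ) : ℍ[ℝ]) := by
    simp only [dotProduct, Pi.star_apply, Quaternion.star_mul_self]
    exact (map_sum (algebraMap ℝ ℍ[ℝ]) _ _).symm
  rw [this]; simp

lemma dot_star_self_eq_zero {w : ι → ℍ[ℝ]} (h : (star w ⬝ᵥ w).re = 0) : w = 0 := by
  rw [dot_star_self_re, Finset.sum_eq_zero_iff_of_nonneg (fun _ _ => normSq_nonneg)] at h
  ext1 i
  simpa using h i (Finset.mem_univ i)

lemma herm_im {A : Matrix ι ι ℍ[ℝ]} (h : A.IsHermitian) (z : ι → ℍ[ℝ]) :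
    star z ⬝ᵥ A *ᵥ z = (((star z ⬝ᵥ A *ᵥ z).re : ℝ) : ℍ[ℝ]) := by
  have h1 : star (star z ⬝ᵥ A *ᵥ z) = star z ⬝ᵥ A *ᵥ z := by
    rw [← star_dotProduct_star, star_star, star_mulVec, h.eq, dotProduct_mulVec]
  exact (Quaternion.star_eq_self).1 h1

lemma star_smul_fun (t : ℝ) (z : ι → ℍ[ℝ]) : star (t • z) = t • star z := by
  funext i; exact Quaternion.star_smul t (z i)

lemma conjT_smul (t : ℝ) (z : Matrix ι κ ℍ[ℝ]) : (t • z)ᴴ = t • zᴴ := by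
  funext i j; exact Quaternion.star_smul t (z j i)

lemma psd_ker {A : Matrix ι ι ℍ[ℝ]} (h : QuatPSD A) {z : ι → ℍ[ℝ]}
    (hz : (star z ⬝ᵥ A *ᵥ z).re = 0) : A *ᵥ z = 0 := by
  set w := A *ᵥ z with hw
  apply dot_star_self_eq_zero
  have hzw : star z ᵥ* A = star w := by rw [hw, star_mulVec, h.1.eq]
  have key : ∀ t : ℝ, 0 ≤ 2 * t * (star w ⬝ᵥ w).re + (star w ⬝ᵥ A *ᵥ w).re := by
    intro t
    have := h.2 (t • z + w)
    have e : star (t • z + w) ⬝ᵥ A *ᵥ (t • z + w) =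
        (t * t) • (star z ⬝ᵥ A *ᵥ z) + (2 * t) • (star w ⬝ᵥ w) + star w ⬝ᵥ A *ᵥ w := by
      rw [mulVec_add, mulVec_smul, star_add, star_smul_fun, add_dotProduct, dotProduct_add,
        dotProduct_add, smul_dotProduct, smul_dotProduct, dotProduct_smul, dotProduct_smul,
        dotProduct_mulVec (star z) A w, hzw]
      simp only [smul_smul]
      module
    rw [e] at this
    rw [hw] at hz
    simp [hz] at this
    linarith
  have h0 : 0 ≤ (star w ⬝ᵥ w).re := by
    rw [dot_star_self_re]; exact Finset.sum_nonneg fun _ _ => normSq_nonneg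
  by_contra hne
  have hpos := lt_of_le_of_ne h0 (Ne.symm hne)
  have := key (-((star w ⬝ᵥ A *ᵥ w).re + 1) / (2 * (star w ⬝ᵥ w).re))
  field_simp at this
  linarith

lemma psd_sub {A : Matrix ι ι ℍ[ℝ]} [DecidableEq ι] (h : QuatPSD A) {z w : ι → ℍ[ℝ]}
    (hw : A *ᵥ z = w) (hw0 : w ≠ 0) :
    ∃ c : ℝ, 0 < c ∧ QuatPSD (A - c • vecMulVec w (star w)) ∧
      (A - c • vecMulVec w (star w)) *ᵥ z = 0 ∧
      ∀ u, A *ᵥ u = 0 → (A - c • vecMulVec w (star w)) *ᵥ u = 0 := by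
  have hzw : star z ᵥ* A = star w := by rw [← hw, star_mulVec, h.1.eq]
  set r := (star z ⬝ᵥ A *ᵥ z).re with hr
  have hr0 : 0 < r := by
    refine lt_of_le_of_ne (h.2 z) fun h0 => hw0 ?_
    rw [← hw]; exact psd_ker h h0.symm
  have hzz : star z ⬝ᵥ w = (r : ℍ[ℝ]) := by rw [← hw]; exact herm_im h.1 z
  have hzz' : star w ⬝ᵥ z = (r : ℍ[ℝ]) := by rw [← hzw, ← dotProduct_mulVec, hw, hzz]
  have hk : (A - r⁻¹ • vecMulVec w (star w)) *ᵥ z = 0 := by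
    rw [sub_mulVec, smul_mulVec, hw, vecMulVec_mulVec, hzz']
    funext i
    have : w i * (r : ℍ[ℝ]) = r • w i := by
      rw [← Quaternion.coe_commutes, Quaternion.coe_mul_eq_smul]
    simp [this, smul_smul, hr0.ne']
  refine ⟨r⁻¹, inv_pos.2 hr0, ?_, ?_, ?_⟩
  · have := psd_congr h (1 - r⁻¹ • vecMulVec z (star w))
    convert this using 1
    have e1 : (1 - r⁻¹ • vecMulVec z (star w))ᴴ = 1 - r⁻¹ • vecMulVec w (star z) := by
      rw [conjTranspose_sub, conjT_smul, conjTranspose_vecMulVec]; simp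
    rw [e1]
    simp only [Matrix.sub_mul, Matrix.mul_sub, Matrix.one_mul, Matrix.mul_one, Matrix.smul_mul,
      Matrix.mul_smul, vecMulVec_mul, mul_vecMulVec, hzw]
    rw [hk, zero_vecMulVec, smul_zero, sub_zero]
  · exact hk
  · intro u hu
    rw [sub_mulVec, smul_mulVec, hu]
    have : star w ⬝ᵥ u = 0 := by rw [← hzw, ← dotProduct_mulVec, hu, dotProduct_zero]
    simp [vecMulVec_mulVec, this]
end general

section qm
variable {l m n : Type*}

def qm (X Y Z W : Matrix m n ℝ) : Matrix m n ℍ[ℝ] :=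
  fun i j => ⟨X i j, Y i j, Z i j, W i j⟩

@[simp] lemma qm_re (X Y Z W : Matrix m n ℝ) (i j) : (qm X Y Z W i j).re = X i j := rfl
@[simp] lemma qm_imI (X Y Z W : Matrix m n ℝ) (i j) : (qm X Y Z W i j).imI = Y i j := rfl
@[simp] lemma qm_imJ (X Y Z W : Matrix m n ℝ) (i j) : (qm X Y Z W i j).imJ = Z i j := rfl
@[simp] lemma qm_imK (X Y Z W : Matrix m n ℝ) (i j) : (qm X Y Z W i j).imK = W i j := rfl

lemma qm_conjTranspose (X Y Z W : Matrix m n ℝ) :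
    (qm X Y Z W)ᴴ = qm Xᵀ (-Yᵀ) (-Zᵀ) (-Wᵀ) := by
  ext i j <;> simp

lemma qm_add (X Y Z W X' Y' Z' W' : Matrix m n ℝ) :
    qm X Y Z W + qm X' Y' Z' W' = qm (X + X') (Y + Y') (Z + Z') (W + W') := by
  ext i j <;> simp

lemma qm_sub (X Y Z W X' Y' Z' W' : Matrix m n ℝ) :
    qm X Y Z W - qm X' Y' Z' W' = qm (X - X') (Y - Y') (Z - Z') (W - W') := by
  ext i j <;> simp

lemma qm_smul (c : ℝ) (X Y Z W : Matrix m n ℝ) :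
    c • qm X Y Z W = qm (c • X) (c • Y) (c • Z) (c • W) := by
  ext i j <;> simp

lemma qm_neg (X Y Z W : Matrix m n ℝ) :
    - qm X Y Z W = qm (-X) (-Y) (-Z) (-W) := by
  ext i j <;> simp

lemma qm_zero : qm (0 : Matrix m n ℝ) 0 0 0 = 0 := by
  ext i j <;> simp

lemma qm_inj {X Y Z W X' Y' Z' W' : Matrix m n ℝ}
    (h : qm X Y Z W = qm X' Y' Z' W') : X = X' ∧ Y = Y' ∧ Z = Z' ∧ W = W' := by
  refine ⟨?_, ?_, ?_, ?_⟩ <;> ext i j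
  · exact congrArg QuaternionAlgebra.re (congrFun₂ h i j)
  · exact congrArg QuaternionAlgebra.imI (congrFun₂ h i j)
  · exact congrArg QuaternionAlgebra.imJ (congrFun₂ h i j)
  · exact congrArg QuaternionAlgebra.imK (congrFun₂ h i j)

lemma re_sum {ι : Type*} (s : Finset ι) (f : ι → ℍ[ℝ]) : (∑ i ∈ s, f i).re = ∑ i ∈ s, (f i).re := by
  classical
  induction s using Finset.induction_on with
  | empty => simp
  | insert a s ha ih => simp [Finset.sum_insert ha, ih]
lemma imI_sum {ι : Type*} (s : Finset ι) (f : ι → ℍ[ℝ]) : (∑ i ∈ s, f i).imI = ∑ i ∈ s, (f i).imI := by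
  classical
  induction s using Finset.induction_on with
  | empty => simp
  | insert a s ha ih => simp [Finset.sum_insert ha, ih]
lemma imJ_sum {ι : Type*} (s : Finset ι) (f : ι → ℍ[ℝ]) : (∑ i ∈ s, f i).imJ = ∑ i ∈ s, (f i).imJ := by
  classical
  induction s using Finset.induction_on with
  | empty => simp
  | insert a s ha ih => simp [Finset.sum_insert ha, ih]
lemma imK_sum {ι : Type*} (s : Finset ι) (f : ι → ℍ[ℝ]) : (∑ i ∈ s, f i).imK = ∑ i ∈ s, (f i).imK := by
  classical
  induction s using Finset.induction_on with
  | empty => simp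
  | insert a s ha ih => simp [Finset.sum_insert ha, ih]

lemma qm_mul [Fintype m] (X Y Z W : Matrix l m ℝ) (X' Y' Z' W' : Matrix m n ℝ) :
    qm X Y Z W * qm X' Y' Z' W' =
      qm (X * X' - Y * Y' - Z * Z' - W * W') (X * Y' + Y * X' + Z * W' - W * Z')
        (X * Z' - Y * W' + Z * X' + W * Y') (X * W' + Y * Z' - Z * Y' + W * X') := by
  ext i j <;>
  simp [Matrix.mul_apply, re_sum, imI_sum, imJ_sum, imK_sum, Finset.sum_add_distrib,
    Finset.sum_sub_distrib]

end qm

section real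

variable {ι κ : Type*} [Fintype ι] [Fintype κ] [DecidableEq ι] [DecidableEq κ]

abbrev Dat (ι : Type*) := Matrix ι ι ℝ × (Fin 3 → Matrix ι ι ℝ) × Matrix ι ι ℝ

def gen (ι : Type*) [Fintype ι] : Set (Dat ι) :=
  {d | ∃ (α δ : ℝ) (q : Fin 3 → ℝ) (S : Matrix ι ι ℝ), 0 ≤ α ∧ 0 ≤ δ ∧
    q 0 ^ 2 + q 1 ^ 2 + q 2 ^ 2 ≤ α * δ ∧ S.PosSemidef ∧
    d = (α • S, fun a => q a • S, δ • S)}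

def RS (d : Dat ι) : Prop := d ∈ AddSubmonoid.closure (gen ι)

def cong (T : Matrix ι κ ℝ) : Dat ι →+ Dat κ where
  toFun d := (Tᵀ * d.1 * T, fun a => Tᵀ * d.2.1 a * T, Tᵀ * d.2.2 * T)
  map_zero' := by ext <;> simp
  map_add' d e := by
    refine Prod.ext ?_ (Prod.ext ?_ ?_)
    · simp [Matrix.mul_add, Matrix.add_mul]
    · funext a; simp [Matrix.mul_add, Matrix.add_mul]
    · simp [Matrix.mul_add, Matrix.add_mul]

lemma RS_cong {d : Dat ι} (h : RS d) (T : Matrix ι κ ℝ) : RS (cong T d) := by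
  unfold RS at *
  induction h using AddSubmonoid.closure_induction with
  | mem x hx =>
    apply AddSubmonoid.subset_closure
    obtain ⟨α, δ, q, S, h1, h2, h3, h4, rfl⟩ := hx
    refine ⟨α, δ, q, Tᵀ * S * T, h1, h2, h3, ?_, ?_⟩
    · simpa using h4.conjTranspose_mul_mul_same T
    · simp [cong]
  | zero => simp
  | add x y _ _ hx hy => rw [map_add]; exact add_mem hx hy

lemma posSemidef_vv (s : ι → ℝ) : (vecMulVec s s).PosSemidef := by
  simpa using posSemidef_vecMulVec_self_star s

lemma RS_vv (s : ι → ℝ) : RS ((0, fun _ => 0, vecMulVec s s) : Dat ι) :=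
  AddSubmonoid.subset_closure ⟨0, 1, fun _ => 0, vecMulVec s s, le_rfl, zero_le_one, by simp,
    posSemidef_vv s, by simp⟩

lemma joint_basis (X : Fin 3 → Matrix ι ι ℝ) (hX : ∀ a, (X a).IsSymm)
    (hc : ∀ a b, X a * X b = X b * X a) :
    ∃ (N : Type) (_ : Fintype N) (b : N → ι → ℝ) (l : N → Fin 3 → ℝ),
      (∀ k a, X a *ᵥ b k = l k a • b k) ∧ ∑ k, vecMulVec (b k) (b k) = 1 := by
  classical
  let T : Fin 3 → (EuclideanSpace ℝ ι →ₗ[ℝ] EuclideanSpace ℝ ι) := fun a => (X a).toEuclideanLin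
  have hT : ∀ a, (T a).IsSymmetric := fun a => by
    rw [isSymmetric_toEuclideanLin_iff]
    exact hX a
  have hcom : Pairwise (Function.onFun Commute T) := by
    intro a b _
    ext v i
    simp [T, Matrix.toLpLin_apply, mulVec_mulVec, hc a b]
  have hint := LinearMap.IsSymmetric.directSum_isInternal_of_pairwise_commute hT hcom
  have hort := LinearMap.IsSymmetric.orthogonalFamily_iInf_eigenspaces hT
  let v := fun γ : Fin 3 → ℝ =>
    stdOrthonormalBasis ℝ (⨅ j, Module.End.eigenspace (T j) (γ j) : Submodule ℝ (EuclideanSpace ℝ ι))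
  let B := hint.collectedBasis (fun γ => (v γ).toBasis)
  let _ : Fintype (Σ γ : Fin 3 → ℝ, Fin (Module.finrank ℝ
      (⨅ j, Module.End.eigenspace (T j) (γ j) : Submodule ℝ (EuclideanSpace ℝ ι)))) :=
    FiniteDimensional.fintypeBasisIndex B
  have hB : Orthonormal ℝ B := by
    have := hort.orthonormal_sigma_orthonormal (fun γ => (v γ).orthonormal)
    simpa [B] using! this
  let b := B.toOrthonormalBasis hB
  refine ⟨_, inferInstance, fun k => (b k).ofLp, fun k => k.1, fun k a => ?_, ?_⟩
  · have h1 : b k ∈ (⨅ j, Module.End.eigenspace (T j) (k.1 j) :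
        Submodule ℝ (EuclideanSpace ℝ ι)) := by
      have hbk : b k = B k := by simp [b]
      rw [hbk]; exact hint.collectedBasis_mem (fun γ => (v γ).toBasis) k
    have h2 := Module.End.mem_eigenspace_iff.1 ((Submodule.mem_iInf _).1 h1 a)
    have h3 := congrArg WithLp.ofLp h2
    simpa [T, Matrix.toLpLin_apply] using h3
  · ext i j
    have := b.sum_inner_mul_inner (EuclideanSpace.single i (1:ℝ)) (EuclideanSpace.single j (1:ℝ))
    simp only [EuclideanSpace.inner_single_left, EuclideanSpace.inner_single_right] at this
    rw [Matrix.sum_apply]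
    simp only [vecMulVec_apply, Matrix.one_apply]
    simpa [Pi.single_apply, eq_comm] using this

lemma RS_comm (X : Fin 3 → Matrix ι ι ℝ) (hX : ∀ a, (X a).IsSymm)
    (hc : ∀ a b, X a * X b = X b * X a) :
    RS ((1, X, ∑ a, X a * X a) : Dat ι) := by
  obtain ⟨N, _, b, l, h1, h2⟩ := joint_basis X hX hc
  have e1 : ∀ a, X a = ∑ k, l k a • vecMulVec (b k) (b k) := fun a => by
    conv_lhs => rw [← Matrix.mul_one (X a), ← h2]
    rw [Matrix.mul_sum]
    refine Finset.sum_congr rfl fun k _ => ?_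
    rw [mul_vecMulVec, h1, smul_vecMulVec]
  have e2 : ∀ a, X a * X a = ∑ k, (l k a * l k a) • vecMulVec (b k) (b k) := fun a => by
    conv_lhs => rw [e1 a, ← e1 a, e1 a]
    conv_lhs => lhs; rw [← e1 a]
    rw [Matrix.mul_sum]
    refine Finset.sum_congr rfl fun k _ => ?_
    rw [Matrix.mul_smul, mul_vecMulVec, h1, smul_vecMulVec, smul_smul]
  have e : ((1, X, ∑ a, X a * X a) : Dat ι) = ∑ k, ((1:ℝ) • vecMulVec (b k) (b k),
      (fun a => l k a • vecMulVec (b k) (b k)),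
      (l k 0 ^ 2 + l k 1 ^ 2 + l k 2 ^ 2) • vecMulVec (b k) (b k)) := by
    refine Prod.ext ?_ (Prod.ext ?_ ?_)
    · simp [Prod.fst_sum, h2]
    · funext a
      simp [Prod.fst_sum, Prod.snd_sum, ← e1]
    · simp [Prod.snd_sum, Fin.sum_univ_three, e2, ← Finset.sum_add_distrib, ← add_smul, sq]
  rw [e]
  refine sum_mem fun k _ => AddSubmonoid.subset_closure ?_
  exact ⟨1, _, l k, _, zero_le_one, by positivity, by simp, posSemidef_vv (b k), rfl⟩

end real

section quad

lemma quad_core (a b A B d e f : ℝ) (ha : 0 ≤ a) (hb : 0 ≤ b) (hab : a + b = 1) :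
    ∃ x y z : ℝ, (x, y) ≠ (0, 0) ∧ z ^ 2 = a * x ^ 2 + b * y ^ 2 ∧
      A * x ^ 2 + B * y ^ 2 - (A + B) * z ^ 2 + d * (x * y) + e * (x * z) + f * (y * z) = 0 := by
  let F : ℝ × ℝ → ℝ := fun p => A * p.1 ^ 2 + B * p.2 ^ 2
    - (A + B) * (√(a * p.1 ^ 2 + b * p.2 ^ 2)) ^ 2 + d * (p.1 * p.2)
    + e * (p.1 * √(a * p.1 ^ 2 + b * p.2 ^ 2)) + f * (p.2 * √(a * p.1 ^ 2 + b * p.2 ^ 2))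
  have hF : Continuous F := by fun_prop
  have hpre : IsPreconnected ({(0, 0)}ᶜ : Set (ℝ × ℝ)) := by
    apply (isConnected_compl_singleton_of_one_lt_rank _ _).isPreconnected
    rw [← Module.finrank_eq_rank]
    simp
  have hv : ∀ x y : ℝ, x ^ 2 = 1 → y ^ 2 = 1 → F (x, y) = d * (x * y) + e * x + f * y := by
    intro x y hx hy
    simp only [F, hx, hy, mul_one, hab, Real.sqrt_one]
    ring
  have m : ∀ x y : ℝ, x ^ 2 = 1 → (x, y) ∈ ({(0, 0)}ᶜ : Set (ℝ × ℝ)) := by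
    intro x y hx h
    simp at h
    simp [h.1] at hx
  have h1 := hv 1 1 (by norm_num) (by norm_num)
  have h2 := hv 1 (-1) (by norm_num) (by norm_num)
  have h3 := hv (-1) 1 (by norm_num) (by norm_num)
  have h4 := hv (-1) (-1) (by norm_num) (by norm_num)
  have hex : ∃ p ∈ ({(0, 0)}ᶜ : Set (ℝ × ℝ)), F p ≤ 0 := by
    by_contra hcon
    push Not at hcon
    have := hcon _ (m 1 1 (by norm_num))
    have := hcon _ (m 1 (-1) (by norm_num))
    have := hcon _ (m (-1) 1 (by norm_num))
    have := hcon _ (m (-1) (-1) (by norm_num))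
    linarith
  have hex' : ∃ p ∈ ({(0, 0)}ᶜ : Set (ℝ × ℝ)), 0 ≤ F p := by
    by_contra hcon
    push Not at hcon
    have := hcon _ (m 1 1 (by norm_num))
    have := hcon _ (m 1 (-1) (by norm_num))
    have := hcon _ (m (-1) 1 (by norm_num))
    have := hcon _ (m (-1) (-1) (by norm_num))
    linarith
  obtain ⟨p, hp, hp0⟩ := hex
  obtain ⟨r, hr, hr0⟩ := hex'
  obtain ⟨w, hw, hw0⟩ := hpre.intermediate_value hp hr hF.continuousOn ⟨hp0, hr0⟩
  exact ⟨w.1, w.2, √(a * w.1 ^ 2 + b * w.2 ^ 2), hw, Real.sq_sqrt (by positivity), hw0⟩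

lemma quad_diag (l : Fin 3 → ℝ) (hl : l 0 + l 1 + l 2 = 0) (hl0 : l ≠ 0)
    (Q : Matrix (Fin 3) (Fin 3) ℝ) (hQ : Q.trace = 0) :
    ∃ s : Fin 3 → ℝ, s ≠ 0 ∧ s ⬝ᵥ (diagonal l) *ᵥ s = 0 ∧ s ⬝ᵥ Q *ᵥ s = 0 := by
  rw [Matrix.trace_fin_three] at hQ
  have key : ∀ i j k : Fin 3, l i + l j + l k = 0 → 0 ≤ l i * l j → l k ≠ 0 →
      ∃ x y z : ℝ, (x, y) ≠ (0, 0) ∧ l i * x ^ 2 + l j * y ^ 2 + l k * z ^ 2 = 0 ∧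
      Q i i * x ^ 2 + Q j j * y ^ 2 - (Q i i + Q j j) * z ^ 2 + (Q i j + Q j i) * (x * y)
        + (Q i k + Q k i) * (x * z) + (Q j k + Q k j) * (y * z) = 0 := by
    intro i j k h1 h2 h3
    have hk2 : 0 < l k * l k := mul_self_pos.2 h3
    have hkk : l k = -(l i + l j) := by linarith
    have e1 : 0 ≤ - (l i * l k) := by rw [hkk]; nlinarith [sq_nonneg (l i)]
    have e2 : 0 ≤ - (l j * l k) := by rw [hkk]; nlinarith [sq_nonneg (l j)]
    obtain ⟨x, y, z, g1, g2, g3⟩ := quad_core (-(l i * l k) / (l k * l k))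
      (-(l j * l k) / (l k * l k)) (Q i i) (Q j j) (Q i j + Q j i) (Q i k + Q k i) (Q j k + Q k j)
      (by positivity) (by positivity)
      (by field_simp; linarith)
    refine ⟨x, y, z, g1, ?_, g3⟩
    rw [g2]; field_simp; ring
  by_cases c1 : 0 ≤ l 0 * l 1
  · have : l 2 ≠ 0 := by
      intro h
      apply hl0
      have : l 0 = 0 := by nlinarith
      have : l 1 = 0 := by linarith
      funext i; fin_cases i <;> simpa
    obtain ⟨x, y, z, g1, g2, g3⟩ := key 0 1 2 hl c1 this
    refine ⟨![x, y, z], ?_, ?_, ?_⟩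
    · intro h
      apply g1
      have h0 := congrFun h 0
      have h1 := congrFun h 1
      simp at h0 h1
      simp [h0, h1]
    · simp [dotProduct, mulVec_diagonal, Fin.sum_univ_three]; linarith
    · simp [dotProduct, mulVec, Fin.sum_univ_three]
      have : Q 2 2 = -(Q 0 0 + Q 1 1) := by linarith
      rw [this]; linarith
  by_cases c2 : 0 ≤ l 0 * l 2
  · have : l 1 ≠ 0 := by
      intro h
      simp [h] at c1
    obtain ⟨x, y, z, g1, g2, g3⟩ := key 0 2 1 (by linarith) c2 this
    refine ⟨![x, z, y], ?_, ?_, ?_⟩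
    · intro h
      apply g1
      have h0 := congrFun h 0
      have h1 := congrFun h 2
      simp at h0 h1
      simp [h0, h1]
    · simp [dotProduct, mulVec_diagonal, Fin.sum_univ_three]; linarith
    · simp [dotProduct, mulVec, Fin.sum_univ_three]
      have : Q 1 1 = -(Q 0 0 + Q 2 2) := by linarith
      rw [this]; linarith
  · have : l 0 ≠ 0 := by
      intro h
      simp [h] at c1
    obtain ⟨x, y, z, g1, g2, g3⟩ := key 1 2 0 (by linarith) (by
      push Not at c1 c2
      by_contra hh
      push Not at hh
      nlinarith [mul_pos_of_neg_of_neg c1 c2, sq_nonneg (l 0), sq_nonneg (l 0 * l 1), mul_pos_of_neg_of_neg c1 c2, mul_nonneg (sq_nonneg (l 0)) (neg_nonneg.2 hh.le)]) this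
    refine ⟨![z, x, y], ?_, ?_, ?_⟩
    · intro h
      apply g1
      have h0 := congrFun h 1
      have h1 := congrFun h 2
      simp at h0 h1
      simp [h0, h1]
    · simp [dotProduct, mulVec_diagonal, Fin.sum_univ_three]; linarith
    · simp [dotProduct, mulVec, Fin.sum_univ_three]
      have : Q 0 0 = -(Q 1 1 + Q 2 2) := by linarith
      rw [this]; linarith

lemma quad_symm (P Q : Matrix (Fin 3) (Fin 3) ℝ) (hP : P.trace = 0) (hQ : Q.trace = 0)
    (hs : P.IsSymm) (hP0 : P ≠ 0) :
    ∃ s : Fin 3 → ℝ, s ≠ 0 ∧ s ⬝ᵥ P *ᵥ s = 0 ∧ s ⬝ᵥ Q *ᵥ s = 0 := by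
  have hh : P.IsHermitian := hs
  have hsp := hh.spectral_theorem
  have htr := hh.trace_eq_sum_eigenvalues
  rw [hP] at htr
  set U : Matrix (Fin 3) (Fin 3) ℝ := hh.eigenvectorUnitary.1 with hU
  set l := hh.eigenvalues with hl
  have hUU : Uᵀ * U = 1 := by
    have := Matrix.UnitaryGroup.star_mul_self hh.eigenvectorUnitary
    simpa [star_eq_conjTranspose] using this
  have hUU' : U * Uᵀ = 1 := by exact mul_eq_one_comm.1 hUU
  have hPU : P = U * diagonal l * Uᵀ := by
    rw [Unitary.conjStarAlgAut_apply] at hsp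
    simpa [star_eq_conjTranspose, Function.comp_def] using hsp
  have hl0 : l ≠ 0 := by
    intro h0
    apply hP0
    rw [hPU, h0]; simp
  obtain ⟨s, h1, h2, h3⟩ := quad_diag l (by simpa [Fin.sum_univ_three] using htr.symm) hl0
    (Uᵀ * Q * U) (by rw [Matrix.mul_assoc, trace_mul_comm, Matrix.mul_assoc, hUU', Matrix.mul_one, hQ])
  refine ⟨U *ᵥ s, ?_, ?_, ?_⟩
  · intro h
    apply h1
    have := congrArg (fun v => Uᵀ *ᵥ v) h
    simpa [mulVec_mulVec, hUU] using this
  · rw [hPU, mulVec_mulVec, Matrix.mul_assoc, hUU, Matrix.mul_one, dotProduct_mulVec,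
      ← vecMul_transpose, vecMul_vecMul, ← Matrix.mul_assoc, hUU, Matrix.one_mul,
      ← dotProduct_mulVec, h2]
  · rw [mulVec_mulVec, dotProduct_mulVec, ← vecMul_transpose, vecMul_vecMul, ← dotProduct_mulVec,
      ← Matrix.mul_assoc, h3]

lemma quad_symmetrize (P : Matrix (Fin 3) (Fin 3) ℝ) (s : Fin 3 → ℝ) :
    s ⬝ᵥ (P + Pᵀ) *ᵥ s = 2 * (s ⬝ᵥ P *ᵥ s) := by
  rw [add_mulVec, dotProduct_add, mulVec_transpose, dotProduct_comm s (s ᵥ* P),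
    ← dotProduct_mulVec]
  ring

lemma quad (P Q : Matrix (Fin 3) (Fin 3) ℝ) (hP : P.trace = 0) (hQ : Q.trace = 0) :
    ∃ s : Fin 3 → ℝ, s ≠ 0 ∧ s ⬝ᵥ P *ᵥ s = 0 ∧ s ⬝ᵥ Q *ᵥ s = 0 := by
  have tP : (P + Pᵀ).trace = 0 := by rw [trace_add, trace_transpose, hP, add_zero]
  have tQ : (Q + Qᵀ).trace = 0 := by rw [trace_add, trace_transpose, hQ, add_zero]
  have sP : (P + Pᵀ).IsSymm := by rw [IsSymm, transpose_add, transpose_transpose, add_comm]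
  have sQ : (Q + Qᵀ).IsSymm := by rw [IsSymm, transpose_add, transpose_transpose, add_comm]
  have : ∃ s : Fin 3 → ℝ, s ≠ 0 ∧ s ⬝ᵥ (P + Pᵀ) *ᵥ s = 0 ∧ s ⬝ᵥ (Q + Qᵀ) *ᵥ s = 0 := by
    by_cases hp : P + Pᵀ = 0
    · by_cases hq : Q + Qᵀ = 0
      · exact ⟨1, one_ne_zero, by simp [hp], by simp [hq]⟩
      · obtain ⟨s, a, b, c⟩ := quad_symm _ _ tQ tP sQ hq
        exact ⟨s, a, c, b⟩
    · exact quad_symm _ _ tP tQ sP hp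
  obtain ⟨s, a, b, c⟩ := this
  rw [quad_symmetrize] at b c
  exact ⟨s, a, by linarith, by linarith⟩

end quad

section alpha

variable {n : ℕ}

lemma symm_dot {ι : Type*} [Fintype ι] {X : Matrix ι ι ℝ} (hX : X.IsSymm) (a b : ι → ℝ) :
    (X *ᵥ a) ⬝ᵥ b = a ⬝ᵥ X *ᵥ b := by
  rw [dotProduct_mulVec, ← mulVec_transpose, hX.eq]

lemma dual_card {k : ℕ} (v w : Fin k → Fin n → ℝ) (h0 : ∀ i, v i ⬝ᵥ w i ≠ 0)
    (h1 : ∀ i j, i ≠ j → v i ⬝ᵥ w j = 0) : k ≤ n := by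
  have : LinearIndependent ℝ v := by
    rw [Fintype.linearIndependent_iff]
    intro g hg i
    have := congrArg (fun x => x ⬝ᵥ w i) hg
    simp only [sum_dotProduct, smul_dotProduct, zero_dotProduct] at this
    rw [Finset.sum_eq_single i (fun b _ hb => by rw [h1 b i hb]; simp) (by simp)] at this
    simpa [h0 i] using this
  simpa using this.fintype_card_le_finrank

lemma wedge_zero {u v : Fin n → ℝ} (h : (u ⬝ᵥ u) * (v ⬝ᵥ v) - (u ⬝ᵥ v) * (u ⬝ᵥ v) = 0) :
    vecMulVec u v = vecMulVec v u := by
  have key : ∑ i, ∑ j, (u i * v j - v i * u j) ^ 2 = 0 := by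
    have : ∀ i j, (u i * v j - v i * u j) ^ 2 =
      (u i * u i) * (v j * v j) + (v i * v i) * (u j * u j) - 2 * ((u i * v i) * (u j * v j)) := by
      intros; ring
    simp only [this, Finset.sum_sub_distrib, Finset.sum_add_distrib, ← Finset.mul_sum,
      ← Finset.sum_mul]
    simp only [dotProduct] at h
    linarith
  ext i j
  rw [Finset.sum_eq_zero_iff_of_nonneg (fun i _ => Finset.sum_nonneg fun j _ => sq_nonneg _)] at key
  have := key i (Finset.mem_univ i)
  rw [Finset.sum_eq_zero_iff_of_nonneg (fun j _ => sq_nonneg _)] at this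
  have := this j (Finset.mem_univ j)
  simp only [vecMulVec_apply]
  have := pow_eq_zero_iff (two_ne_zero) |>.1 this
  linarith

lemma alpha4_solve (Xu Xv : Matrix (Fin 3) (Fin 3) ℝ) (sU : Xu.IsSymm) (sV : Xv.IsSymm)
    (hu hv gu gv m : Fin 3 → ℝ) (a1 : gu ⬝ᵥ hu = 1) (a2 : gu ⬝ᵥ hv = 0)
    (a3 : gv ⬝ᵥ hu = 0) (a4 : gv ⬝ᵥ hv = 1) (a5 : m ⬝ᵥ hu = 0) (a6 : m ⬝ᵥ hv = 0)
    (hdec : ∀ x, gu ⬝ᵥ x = 0 → gv ⬝ᵥ x = 0 → m ⬝ᵥ x = 0 → x = 0) :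
    ∃ (s : Fin 3 → ℝ) (qu qv l τ : ℝ), s ≠ 0 ∧ Xu *ᵥ s = qu • s + l • hu - τ • hv ∧
      Xv *ᵥ s = qv • s + l • hv + τ • hu := by
  obtain ⟨s, hs, h1, h2⟩ := quad
    (vecMulVec m (Xu *ᵥ gu - Xv *ᵥ gv) - vecMulVec (Xu *ᵥ m) gu + vecMulVec (Xv *ᵥ m) gv)
    (vecMulVec m (Xu *ᵥ gv + Xv *ᵥ gu) - vecMulVec (Xu *ᵥ m) gv - vecMulVec (Xv *ᵥ m) gu)
    (by simp only [trace_add, trace_sub, trace_vecMulVec, dotProduct_sub, symm_dot sU, symm_dot sV]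
        ring)
    (by simp only [trace_add, trace_sub, trace_vecMulVec, dotProduct_add, symm_dot sU, symm_dot sV]
        ring)
  simp only [add_mulVec, sub_mulVec, vecMulVec_mulVec, sub_dotProduct, add_dotProduct,
    symm_dot sU, symm_dot sV, dotProduct_sub, dotProduct_add] at h1 h2
  simp only [op_smul_eq_smul, dotProduct_smul, smul_eq_mul] at h1 h2
  rw [dotProduct_comm s (Xu *ᵥ m), dotProduct_comm s (Xv *ᵥ m), dotProduct_comm s m] at h1 h2
  simp only [symm_dot sU, symm_dot sV] at h1 h2
  set σ := gu ⬝ᵥ s with hσ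
  set ρ := gv ⬝ᵥ s with hρ
  set μ := m ⬝ᵥ s with hμ
  suffices H : ∃ qu qv l τ : ℝ, gu ⬝ᵥ Xu *ᵥ s = qu * σ + l ∧ gv ⬝ᵥ Xu *ᵥ s = qu * ρ - τ ∧
      m ⬝ᵥ Xu *ᵥ s = qu * μ ∧ gu ⬝ᵥ Xv *ᵥ s = qv * σ + τ ∧ gv ⬝ᵥ Xv *ᵥ s = qv * ρ + l ∧
      m ⬝ᵥ Xv *ᵥ s = qv * μ by
    obtain ⟨qu, qv, l, τ, e1, e2, e3, e4, e5, e6⟩ := H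
    refine ⟨s, qu, qv, l, τ, hs, sub_eq_zero.1 (hdec _ ?_ ?_ ?_), sub_eq_zero.1 (hdec _ ?_ ?_ ?_)⟩
    all_goals
      simp only [dotProduct_sub, dotProduct_add, dotProduct_smul, smul_eq_mul, a1, a2, a3, a4, a5, a6,
        ← hσ, ← hρ, ← hμ]
      linarith
  by_cases c : μ = 0
  · have hne : 0 < σ ^ 2 + ρ ^ 2 := by
      by_contra hcon
      have : σ = 0 := by nlinarith
      have : ρ = 0 := by nlinarith
      exact hs (hdec s ‹_› ‹_› c)
    rw [c] at h1 h2
    have p0 : m ⬝ᵥ Xu *ᵥ s = 0 := by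
      have : (m ⬝ᵥ Xu *ᵥ s) * (σ ^ 2 + ρ ^ 2) = 0 := by linear_combination (-σ) * h1 - ρ * h2
      simpa [hne.ne'] using this
    have r0 : m ⬝ᵥ Xv *ᵥ s = 0 := by
      have : (m ⬝ᵥ Xv *ᵥ s) * (σ ^ 2 + ρ ^ 2) = 0 := by linear_combination (ρ) * h1 - σ * h2
      simpa [hne.ne'] using this
    set E := gu ⬝ᵥ Xu *ᵥ s - gv ⬝ᵥ Xv *ᵥ s with hE
    set F := gv ⬝ᵥ Xu *ᵥ s + gu ⬝ᵥ Xv *ᵥ s with hF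
    set qu := (σ * E + ρ * F) / (σ ^ 2 + ρ ^ 2) with hqu
    set qv := (σ * F - ρ * E) / (σ ^ 2 + ρ ^ 2) with hqv
    have f1 : qu * σ - qv * ρ = E := by rw [hqu, hqv]; field_simp; ring
    have f2 : qu * ρ + qv * σ = F := by rw [hqu, hqv]; field_simp; ring
    refine ⟨qu, qv, gu ⬝ᵥ Xu *ᵥ s - qu * σ, qu * ρ - gv ⬝ᵥ Xu *ᵥ s, by ring, by ring, ?_, ?_, ?_, ?_⟩
    · rw [p0, c, mul_zero]
    · linarith
    · linarith
    · rw [r0, c, mul_zero]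
  · refine ⟨m ⬝ᵥ Xu *ᵥ s / μ, m ⬝ᵥ Xv *ᵥ s / μ, gu ⬝ᵥ Xu *ᵥ s - m ⬝ᵥ Xu *ᵥ s / μ * σ,
      m ⬝ᵥ Xu *ᵥ s / μ * ρ - gv ⬝ᵥ Xu *ᵥ s, by ring, by ring, by field_simp, ?_, ?_, by field_simp⟩
    · field_simp; linarith
    · field_simp; linarith

lemma alpha4 (hn : n ≤ 3) (Xu Xv Xt : Matrix (Fin n) (Fin n) ℝ) (sU : Xu.IsSymm) (sV : Xv.IsSymm)
    (sT : Xt.IsSymm)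
    (hu hv : Fin n → ℝ) (c1 : Xt * Xu = Xu * Xt) (c2 : Xt * Xv = Xv * Xt)
    (c3 : Xu * Xv - Xv * Xu = vecMulVec hv hu - vecMulVec hu hv) :
    vecMulVec hu hv = vecMulVec hv hu ∨
    (∃ cu cv ct : ℝ, Xt *ᵥ hu = ct • hu ∧ Xt *ᵥ hv = ct • hv ∧
      Xu *ᵥ hv - Xv *ᵥ hu = cu • hv - cv • hu) ∨
    ∃ (s : Fin n → ℝ) (qu qv qt l τ : ℝ), s ≠ 0 ∧ Xt *ᵥ s = qt • s ∧
      Xu *ᵥ s = qu • s + l • hu - τ • hv ∧ Xv *ᵥ s = qv • s + l • hv + τ • hu := by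
  set Δ := (hu ⬝ᵥ hu) * (hv ⬝ᵥ hv) - (hu ⬝ᵥ hv) * (hu ⬝ᵥ hv) with hΔ
  by_cases hd : Δ = 0
  · exact Or.inl (wedge_zero hd)
  right
  set gu := Δ⁻¹ • ((hv ⬝ᵥ hv) • hu - (hu ⬝ᵥ hv) • hv) with hgu
  set gv := Δ⁻¹ • ((hu ⬝ᵥ hu) • hv - (hu ⬝ᵥ hv) • hu) with hgv
  have hcm : hv ⬝ᵥ hu = hu ⬝ᵥ hv := dotProduct_comm _ _
  have a1 : gu ⬝ᵥ hu = 1 := by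
    simp only [hgu, smul_dotProduct, sub_dotProduct, smul_eq_mul, hcm]; field_simp; rw [hΔ]; ring
  have a2 : gu ⬝ᵥ hv = 0 := by
    simp only [hgu, smul_dotProduct, sub_dotProduct, smul_eq_mul, hcm]; ring
  have a3 : gv ⬝ᵥ hu = 0 := by
    simp only [hgv, smul_dotProduct, sub_dotProduct, smul_eq_mul, hcm]; ring
  have a4 : gv ⬝ᵥ hv = 1 := by
    simp only [hgv, smul_dotProduct, sub_dotProduct, smul_eq_mul, hcm]; field_simp; rw [hΔ]; ring
  have hW : Xt * (vecMulVec hv hu - vecMulVec hu hv) = (vecMulVec hv hu - vecMulVec hu hv) * Xt := by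
    rw [← c3, Matrix.mul_sub, Matrix.sub_mul, ← Matrix.mul_assoc, ← Matrix.mul_assoc, c1, c2,
      Matrix.mul_assoc, Matrix.mul_assoc, c1, c2, Matrix.mul_assoc, Matrix.mul_assoc]
  have hW' : ∀ x, (hu ⬝ᵥ x) • Xt *ᵥ hv - (hv ⬝ᵥ x) • Xt *ᵥ hu =
      (hu ⬝ᵥ Xt *ᵥ x) • hv - (hv ⬝ᵥ Xt *ᵥ x) • hu := by
    intro x
    have := congrArg (fun M => M *ᵥ x) hW
    simpa [← mulVec_mulVec, sub_mulVec, vecMulVec_mulVec, mulVec_sub, mulVec_smul] using this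
  have w1 := hW' gu
  have w2 := hW' gv
  rw [dotProduct_comm hu gu, dotProduct_comm hv gu, a1, a2] at w1
  rw [dotProduct_comm hu gv, dotProduct_comm hv gv, a3, a4] at w2
  simp only [← symm_dot sT, one_smul, zero_smul, sub_zero, zero_sub] at w1 w2
  have b1 : (Xt *ᵥ hv) ⬝ᵥ gu = 0 := by
    have := congrArg (fun x => x ⬝ᵥ gu) w1
    simp only [sub_dotProduct, smul_dotProduct, smul_eq_mul, dotProduct_comm hu gu,
      dotProduct_comm hv gu, a1, a2] at this
    linarith
  have b2 : (Xt *ᵥ hu) ⬝ᵥ gv = 0 := by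
    have := congrArg (fun x => x ⬝ᵥ gv) w2
    simp only [sub_dotProduct, smul_dotProduct, smul_eq_mul, dotProduct_comm hu gv,
      dotProduct_comm hv gv, a3, a4, neg_dotProduct] at this
    linarith
  set ct := (Xt *ᵥ hv) ⬝ᵥ gv with hct
  rw [b1, zero_smul, sub_zero] at w1
  rw [b2, zero_smul, zero_sub, neg_inj] at w2
  have b3 : (Xt *ᵥ hu) ⬝ᵥ gu = ct := by
    rw [hct, w1, smul_dotProduct, dotProduct_comm hv, a4, smul_eq_mul, mul_one]
  rw [b3] at w1
  set k := Xu *ᵥ hv - Xv *ᵥ hu with hk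
  set m := k - (gu ⬝ᵥ k) • hu - (gv ⬝ᵥ k) • hv with hm
  by_cases hm0 : m = 0
  · left
    refine ⟨gv ⬝ᵥ k, - (gu ⬝ᵥ k), ct, w2, w1, ?_⟩
    have : k - (gu ⬝ᵥ k) • hu - (gv ⬝ᵥ k) • hv = 0 := by rw [← hm, hm0]
    rw [sub_sub, sub_eq_zero] at this
    rw [this]
    simp only [dotProduct_add, dotProduct_smul, a1, a2, a3, a4]
    module
  right
  have m1 : gu ⬝ᵥ m = 0 := by
    simp only [hm, dotProduct_sub, dotProduct_smul, smul_eq_mul, a1, a2]; ring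
  have m2 : gv ⬝ᵥ m = 0 := by
    simp only [hm, dotProduct_sub, dotProduct_smul, smul_eq_mul, a3, a4]; ring
  have eu : hu = (hu ⬝ᵥ hu) • gu + (hu ⬝ᵥ hv) • gv := by
    funext i
    simp only [hgu, hgv, Pi.add_apply, Pi.smul_apply, Pi.sub_apply, smul_eq_mul]
    field_simp; rw [hΔ]; ring
  have ev : hv = (hu ⬝ᵥ hv) • gu + (hv ⬝ᵥ hv) • gv := by
    funext i
    simp only [hgu, hgv, Pi.add_apply, Pi.smul_apply, Pi.sub_apply, smul_eq_mul]
    field_simp; rw [hΔ]; ring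
  have du : ∀ x, gu ⬝ᵥ x = 0 → gv ⬝ᵥ x = 0 → x ⬝ᵥ hu = 0 := by
    intro x x1 x2
    rw [dotProduct_comm x hu, eu, add_dotProduct, smul_dotProduct _ gu, smul_dotProduct _ gv, x1, x2]
    simp
  have dv : ∀ x, gu ⬝ᵥ x = 0 → gv ⬝ᵥ x = 0 → x ⬝ᵥ hv = 0 := by
    intro x x1 x2
    rw [dotProduct_comm x hv, ev, add_dotProduct, smul_dotProduct _ gu, smul_dotProduct _ gv, x1, x2]
    simp
  have a5 := du m m1 m2
  have a6 := dv m m1 m2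
  have a7 : m ⬝ᵥ m ≠ 0 := by rwa [Ne, dotProduct_self_eq_zero]
  have hn3 : n = 3 := by
    refine le_antisymm hn (dual_card ![gu, gv, m] ![hu, hv, m] ?_ ?_)
    · intro i; fin_cases i <;> simp [a1, a4, a7, hm0]
    · intro i j hij; fin_cases i <;> fin_cases j <;> simp [a2, a3, a5, a6, m1, m2] at hij ⊢
  have hdec : ∀ x, gu ⬝ᵥ x = 0 → gv ⬝ᵥ x = 0 → m ⬝ᵥ x = 0 → x = 0 := by
    intro x x1 x2 x3
    by_contra hx
    have y1 := du x x1 x2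
    have y2 := dv x x1 x2
    have y3 : x ⬝ᵥ m = 0 := by rw [dotProduct_comm, x3]
    have : 4 ≤ n := by
      refine dual_card ![gu, gv, m, x] ![hu, hv, m, x] ?_ ?_
      · intro i; fin_cases i <;> simp [a1, a4, hm0, hx]
      · intro i j hij
        fin_cases i <;> fin_cases j <;> simp [a2, a3, a5, a6, m1, m2, x1, x2, x3, y1, y2, y3] at hij ⊢
    omega
  have hXk : Xt *ᵥ k = ct • k := by
    rw [hk, mulVec_sub, mulVec_mulVec, mulVec_mulVec, c1, c2, ← mulVec_mulVec, ← mulVec_mulVec, w1,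
      w2, mulVec_smul, mulVec_smul, smul_sub]
  have hXm : Xt *ᵥ m = ct • m := by
    rw [hm, mulVec_sub, mulVec_sub, mulVec_smul, mulVec_smul, hXk, w1, w2]
    module
  have hXg : ∀ g s : Fin n → ℝ, Xt *ᵥ g = ct • g → g ⬝ᵥ Xt *ᵥ s = ct * (g ⬝ᵥ s) := by
    intro g s hg
    rw [← symm_dot sT, hg, smul_dotProduct, smul_eq_mul]
  have hXs : ∀ s, Xt *ᵥ s = ct • s := by
    intro s
    refine sub_eq_zero.1 (hdec _ ?_ ?_ ?_)
    · rw [dotProduct_sub, hXg, dotProduct_smul, smul_eq_mul, sub_self]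
      rw [hgu, mulVec_smul, mulVec_sub, mulVec_smul, mulVec_smul, w1, w2]; module
    · rw [dotProduct_sub, hXg, dotProduct_smul, smul_eq_mul, sub_self]
      rw [hgv, mulVec_smul, mulVec_sub, mulVec_smul, mulVec_smul, w1, w2]; module
    · rw [dotProduct_sub, hXg _ _ hXm, dotProduct_smul, smul_eq_mul, sub_self]
  clear_value m k gu gv
  subst hn3
  obtain ⟨s, qu, qv, l, τ, h1, h2, h3⟩ := alpha4_solve Xu Xv sU sV hu hv gu gv m a1 a2 a3 a4 a5 a6 hdec
  exact ⟨s, qu, qv, ct, l, τ, h1, hXs s, h2, h3⟩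

lemma alpha1 {ι : Type*} [Fintype ι] [DecidableEq ι] (X : Fin 3 → Matrix ι ι ℝ)
    (hX : ∀ a, (X a).IsSymm) (h : Fin 3 → ι → ℝ)
    (hc : ∀ a b, X a * X b - X b * X a = vecMulVec (h b) (h a) - vecMulVec (h a) (h b))
    (c : Fin 3 → ℝ) (hk : ∀ a b, X a *ᵥ h b - X b *ᵥ h a = c a • h b - c b • h a) :
    RS ((1, X, ∑ a, X a * X a + ∑ a, vecMulVec (h a) (h a)) : Dat ι) := by
  let Y : Fin 3 → Matrix (ι ⊕ Unit) (ι ⊕ Unit) ℝ := fun a =>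
    fromBlocks (X a) (replicateCol Unit (h a)) (replicateRow Unit (h a)) (of fun _ _ => c a)
  have hk' : ∀ a b i, (X a *ᵥ h b) i + h a i * c b = (X b *ᵥ h a) i + h b i * c a := by
    intro a b i
    have := congrFun (hk a b) i
    simp at this
    linarith
  have e11 : ∀ a b, X a * X b + vecMulVec (h a) (h b) = X b * X a + vecMulVec (h b) (h a) := by
    intro a b
    have := hc a b
    rw [sub_eq_sub_iff_add_eq_add] at this
    rw [this, add_comm]
  have hY : ∀ a b, Y a * Y b = fromBlocks (X a * X b + vecMulVec (h a) (h b))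
      (of fun i _ => (X a *ᵥ h b) i + h a i * c b)
      (of fun _ i => (X b *ᵥ h a) i + h b i * c a) (of fun _ _ => h a ⬝ᵥ h b + c a * c b) := by
    intro a b
    simp only [Y, fromBlocks_multiply]
    congr 1
    · ext i j; simp [Matrix.mul_apply, vecMulVec_apply]
    · ext i j; simp [Matrix.mul_apply, mulVec, dotProduct]
    · ext i j
      have := congrFun (mulVec_transpose (X b) (h a)) j
      rw [(hX b).eq] at this
      simp [this, Matrix.mul_apply, vecMul, dotProduct, mul_comm]
    · ext i j; simp [Matrix.mul_apply, dotProduct]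
  have hcomm : ∀ a b, Y a * Y b = Y b * Y a := by
    intro a b
    rw [hY, hY, e11]
    congr 1
    · ext i j; exact hk' a b i
    · ext i j; exact hk' b a j
    · ext i j; simp [dotProduct_comm, mul_comm]
  have := RS_comm Y (fun a => by
    simp only [Y, IsSymm]; rw [fromBlocks_transpose, (hX a).eq]; rfl) hcomm
  have := RS_cong this (fromRows (1 : Matrix ι ι ℝ) (0 : Matrix Unit ι ℝ))
  convert this using 1
  have hJ : ∀ (A : Matrix ι ι ℝ) (B : Matrix ι Unit ℝ) (C : Matrix Unit ι ℝ) (D : Matrix Unit Unit ℝ),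
      (fromRows (1 : Matrix ι ι ℝ) (0 : Matrix Unit ι ℝ))ᵀ * fromBlocks A B C D *
      (fromRows (1 : Matrix ι ι ℝ) (0 : Matrix Unit ι ℝ)) = A := by
    intro A B C D
    rw [transpose_fromRows, fromCols_mul_fromBlocks, fromCols_mul_fromRows]
    simp
  refine Prod.ext ?_ (Prod.ext ?_ ?_)
  · simp only [cong, AddMonoidHom.coe_mk, ZeroHom.coe_mk]
    rw [← fromBlocks_one, hJ]
  · funext a
    simp only [cong, AddMonoidHom.coe_mk, ZeroHom.coe_mk, Y]
    rw [hJ]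
  · simp only [cong, AddMonoidHom.coe_mk, ZeroHom.coe_mk, Matrix.mul_sum, Matrix.sum_mul, hY, hJ,
      Finset.sum_add_distrib]

lemma alpha2 {ι : Type*} [Fintype ι] [DecidableEq ι] (X : Fin 3 → Matrix ι ι ℝ)
    (hX : ∀ a, (X a).IsSymm) (h : Fin 3 → ι → ℝ) (hc : ∀ a b, X a * X b = X b * X a) :
    RS ((1, X, ∑ a, X a * X a + ∑ a, vecMulVec (h a) (h a)) : Dat ι) := by
  have e : ((1, X, ∑ a, X a * X a + ∑ a, vecMulVec (h a) (h a)) : Dat ι) =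
      (1, X, ∑ a, X a * X a) + ∑ a, (0, fun _ => 0, vecMulVec (h a) (h a)) := by
    refine Prod.ext ?_ (Prod.ext ?_ ?_)
    · simp [Prod.fst_sum]
    · funext a
      simp [Prod.fst_sum, Prod.snd_sum]
    · simp [Prod.snd_sum]
  rw [e]
  exact add_mem (RS_comm X hX hc) (sum_mem fun a _ => RS_vv (h a))

lemma alpha3 (X : Fin 3 → Matrix (Fin 3) (Fin 3) ℝ)
    (hX : ∀ a, (X a).IsSymm) (h : Fin 3 → Fin 3 → ℝ)
    (hc : ∀ a b, X a * X b - X b * X a = vecMulVec (h b) (h a) - vecMulVec (h a) (h b))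
    (hi : LinearIndependent ℝ h) :
    ∃ c : Fin 3 → ℝ, ∀ a b, X a *ᵥ h b - X b *ᵥ h a = c a • h b - c b • h a := by
  let H : Matrix (Fin 3) (Fin 3) ℝ := of h
  have hH : IsUnit H := Matrix.linearIndependent_rows_iff_isUnit.1 hi
  have hHt : IsUnit Hᵀ := by rwa [Matrix.isUnit_transpose]
  let K : Matrix (Fin 3) (Fin 3) ℝ := of ![X 1 *ᵥ h 2 - X 2 *ᵥ h 1, X 2 *ᵥ h 0 - X 0 *ᵥ h 2,
    X 0 *ᵥ h 1 - X 1 *ᵥ h 0]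
  have hvm : ∀ a v, v ᵥ* X a = X a *ᵥ v := fun a v => by rw [← mulVec_transpose, (hX a).eq]
  have hJ : (X 0 * (X 1 * X 2 - X 2 * X 1) - (X 1 * X 2 - X 2 * X 1) * X 0)
      + (X 1 * (X 2 * X 0 - X 0 * X 2) - (X 2 * X 0 - X 0 * X 2) * X 1)
      + (X 2 * (X 0 * X 1 - X 1 * X 0) - (X 0 * X 1 - X 1 * X 0) * X 2) = 0 := by
    noncomm_ring
  rw [hc, hc, hc] at hJ
  simp only [Matrix.mul_sub, Matrix.sub_mul, mul_vecMulVec, vecMulVec_mul, hvm] at hJ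
  have hKH : Kᵀ * H + Hᵀ * K = 0 := by
    ext i j
    have := congrFun₂ hJ i j
    simp [vecMulVec_apply] at this
    simp [Matrix.mul_apply, Fin.sum_univ_three, K, H]
    linear_combination -this
  obtain ⟨A, hA⟩ : ∃ A, K = A * H := by
    obtain ⟨u, hu⟩ := hH
    exact ⟨K * (↑u⁻¹ : Matrix (Fin 3) (Fin 3) ℝ), by rw [← hu, Matrix.mul_assoc]; simp⟩
  have hAs : Aᵀ + A = 0 := by
    have : Hᵀ * ((Aᵀ + A) * H) = 0 := by
      rw [hA, transpose_mul] at hKH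
      rw [← hKH]; noncomm_ring
    rwa [hHt.mul_right_eq_zero, hH.mul_left_eq_zero] at this
  have hAA : ∀ i j, A j i + A i j = 0 := fun i j => congrFun₂ hAs i j
  have hKr : ∀ i j, K i j = A i 0 * h 0 j + A i 1 * h 1 j + A i 2 * h 2 j := by
    intro i j
    rw [hA]; simp [Matrix.mul_apply, Fin.sum_univ_three, H]
  refine ⟨![A 2 1, A 0 2, A 1 0], fun a b => ?_⟩
  funext j
  have k0 := hKr 0 j
  have k1 := hKr 1 j
  have k2 := hKr 2 j
  simp [K] at k0 k1 k2
  have d0 : A 0 0 = 0 := by linarith [hAA 0 0]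
  have d1 : A 1 1 = 0 := by linarith [hAA 1 1]
  have d2 : A 2 2 = 0 := by linarith [hAA 2 2]
  have d3 : A 0 1 = - A 1 0 := by linarith [hAA 0 1]
  have d4 : A 2 0 = - A 0 2 := by linarith [hAA 0 2]
  have d5 : A 1 2 = - A 2 1 := by linarith [hAA 1 2]
  rw [d0, d3] at k0
  rw [d1, d5] at k1
  rw [d2, d4] at k2
  fin_cases a <;> fin_cases b <;> simp <;> linarith

lemma frame (t : Fin 3 → ℝ) (ht : t ≠ 0) : ∃ u : Fin 3 → ℝ,
    u 0 ^ 2 + u 1 ^ 2 + u 2 ^ 2 = 1 ∧ u 0 * t 0 + u 1 * t 1 + u 2 * t 2 = 0 := by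
  have : ∃ u : Fin 3 → ℝ, 0 < u 0 ^ 2 + u 1 ^ 2 + u 2 ^ 2 ∧ u 0 * t 0 + u 1 * t 1 + u 2 * t 2 = 0 := by
    by_cases c : t 0 = 0
    · exact ⟨![1, 0, 0], by simp, by simp [c]⟩
    · refine ⟨![t 1, - t 0, 0], ?_, by simp; ring⟩
      have := sq_pos_of_ne_zero c
      simp; positivity
  obtain ⟨u, h1, h2⟩ := this
  have h3 := Real.sq_sqrt h1.le
  have h4 := Real.sqrt_pos.2 h1
  set r := √(u 0 ^ 2 + u 1 ^ 2 + u 2 ^ 2)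
  refine ⟨fun a => u a / r, ?_, ?_⟩
  · field_simp; linarith
  · field_simp; linarith

lemma alpha (hn : n ≤ 3) (X : Fin 3 → Matrix (Fin n) (Fin n) ℝ)
    (hX : ∀ a, (X a).IsSymm) (h : Fin 3 → Fin n → ℝ)
    (hc : ∀ a b, X a * X b - X b * X a = vecMulVec (h b) (h a) - vecMulVec (h a) (h b)) :
    RS ((1, X, ∑ a, X a * X a + ∑ a, vecMulVec (h a) (h a)) : Dat (Fin n)) ∨
    ∃ (s : Fin n → ℝ) (q : Fin 3 → ℝ) (l : ℝ) (e : Fin 3 → ℝ), s ≠ 0 ∧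
      e 0 • h 0 + e 1 • h 1 + e 2 • h 2 = 0 ∧
      X 0 *ᵥ s = q 0 • s + l • h 0 + (e 1 • h 2 - e 2 • h 1) ∧
      X 1 *ᵥ s = q 1 • s + l • h 1 + (e 2 • h 0 - e 0 • h 2) ∧
      X 2 *ᵥ s = q 2 • s + l • h 2 + (e 0 • h 1 - e 1 • h 0) := by
  by_cases hi : LinearIndependent ℝ h
  · left
    have : n = 3 := le_antisymm hn (by simpa using hi.fintype_card_le_finrank)
    subst this
    obtain ⟨c, hk⟩ := alpha3 X hX h hc hi
    exact alpha1 X hX h hc c hk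
  obtain ⟨t', ht', i, hti⟩ := Fintype.not_linearIndependent_iff.1 hi
  rw [Fin.sum_univ_three] at ht'
  have hpos : 0 < t' 0 ^ 2 + t' 1 ^ 2 + t' 2 ^ 2 := by
    have := sq_pos_of_ne_zero hti
    fin_cases i <;> simp at this <;> positivity
  obtain ⟨t, ht1, ht⟩ : ∃ t : Fin 3 → ℝ, t 0 ^ 2 + t 1 ^ 2 + t 2 ^ 2 = 1 ∧
      t 0 • h 0 + t 1 • h 1 + t 2 • h 2 = 0 := by
    have h3 := Real.sq_sqrt hpos.le
    have h4 := Real.sqrt_pos.2 hpos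
    set r := √(t' 0 ^ 2 + t' 1 ^ 2 + t' 2 ^ 2)
    refine ⟨fun a => t' a / r, ?_, ?_⟩
    · field_simp; linarith
    · have := congrArg (fun x => r⁻¹ • x) ht'
      simp only [smul_add, smul_smul, smul_zero] at this
      simpa [div_eq_inv_mul] using this
  obtain ⟨u, hu1, hu2⟩ := frame t (by rintro rfl; simp at ht1)
  obtain ⟨v, hv0, hv1, hv2⟩ : ∃ v : Fin 3 → ℝ, t 1 * u 2 - t 2 * u 1 = v 0 ∧
      t 2 * u 0 - t 0 * u 2 = v 1 ∧ t 0 * u 1 - t 1 * u 0 = v 2 :=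
    ⟨![t 1 * u 2 - t 2 * u 1, t 2 * u 0 - t 0 * u 2, t 0 * u 1 - t 1 * u 0], rfl, rfl, rfl⟩
  have r0 : t 1 * v 2 - t 2 * v 1 = - u 0 := by
    rw [← hv1, ← hv2]; linear_combination t 0 * hu2 - u 0 * ht1
  have r1 : t 2 * v 0 - t 0 * v 2 = - u 1 := by
    rw [← hv0, ← hv2]; linear_combination t 1 * hu2 - u 1 * ht1
  have r2 : t 0 * v 1 - t 1 * v 0 = - u 2 := by
    rw [← hv0, ← hv1]; linear_combination t 2 * hu2 - u 2 * ht1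
  have vt : v 0 * t 0 + v 1 * t 1 + v 2 * t 2 = 0 := by rw [← hv0, ← hv1, ← hv2]; ring
  have uv : v 0 * u 0 + v 1 * u 1 + v 2 * u 2 = 0 := by rw [← hv0, ← hv1, ← hv2]; ring
  have vv : v 0 ^ 2 + v 1 ^ 2 + v 2 ^ 2 = 1 := by
    rw [← hv0, ← hv1, ← hv2]
    linear_combination (t 0 ^ 2 + t 1 ^ 2 + t 2 ^ 2) * hu1 + ht1
      - (u 0 * t 0 + u 1 * t 1 + u 2 * t 2) * hu2
  have hO : (of ![u, v, t])ᵀ * (of ![u, v, t]) = (1 : Matrix (Fin 3) (Fin 3) ℝ) := by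
    apply mul_eq_one_comm.1
    ext i j
    fin_cases i <;> fin_cases j <;> simp [Matrix.mul_apply, Fin.sum_univ_three] <;> linarith
  have hO' : ∀ a b, u a * u b + v a * v b + t a * t b = if a = b then 1 else 0 := by
    intro a b
    have := congrFun₂ hO a b
    simpa [Matrix.mul_apply, Fin.sum_univ_three, Matrix.one_apply] using this
  let L : (Fin 3 → ℝ) → Matrix (Fin n) (Fin n) ℝ := fun p => p 0 • X 0 + p 1 • X 1 + p 2 • X 2
  let G : (Fin 3 → ℝ) → Fin n → ℝ := fun p => p 0 • h 0 + p 1 • h 1 + p 2 • h 2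
  have hL : ∀ p, (L p).IsSymm := fun p => by
    simp only [L, IsSymm, transpose_add, transpose_smul, (hX _).eq]
  have hLG : ∀ p r, L p * L r - L r * L p = vecMulVec (G r) (G p) - vecMulVec (G p) (G r) := by
    intro p r
    ext i j
    have e1 := congrFun₂ (hc 0 1) i j
    have e2 := congrFun₂ (hc 0 2) i j
    have e3 := congrFun₂ (hc 1 2) i j
    simp only [L, G, Matrix.add_mul, Matrix.mul_add, Matrix.smul_mul, Matrix.mul_smul,
      Matrix.sub_apply, Matrix.add_apply, Matrix.smul_apply, vecMulVec_apply, Pi.add_apply,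
      Pi.smul_apply, smul_eq_mul] at e1 e2 e3 ⊢
    linear_combination (p 0 * r 1 - p 1 * r 0) * e1 + (p 0 * r 2 - p 2 * r 0) * e2
      + (p 1 * r 2 - p 2 * r 1) * e3
  have hXa : ∀ a, X a = u a • L u + v a • L v + t a • L t := by
    intro a
    have o0 := hO' a 0
    have o1 := hO' a 1
    have o2 := hO' a 2
    ext i j
    simp only [L, Matrix.add_apply, Matrix.smul_apply, smul_eq_mul]
    have : X a i j = (if a = 0 then 1 else 0) * X 0 i j + (if a = 1 then 1 else 0) * X 1 i j +
        (if a = 2 then 1 else 0) * X 2 i j := by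
      fin_cases a <;> simp
    rw [this, ← o0, ← o1, ← o2]; ring
  have hGt : G t = 0 := ht
  have hha : ∀ a, h a = u a • G u + v a • G v := by
    intro a
    have o0 := hO' a 0
    have o1 := hO' a 1
    have o2 := hO' a 2
    ext i
    have z := congrFun hGt i
    simp only [G, Pi.add_apply, Pi.smul_apply, smul_eq_mul, Pi.zero_apply] at z ⊢
    have : h a i = (if a = 0 then 1 else 0) * h 0 i + (if a = 1 then 1 else 0) * h 1 i +
        (if a = 2 then 1 else 0) * h 2 i := by
      fin_cases a <;> simp
    rw [this, ← o0, ← o1, ← o2]; linear_combination t a * z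
  have k1 := hLG t u
  have k2 := hLG t v
  have k3 := hLG u v
  rw [hGt, vecMulVec_zero, zero_vecMulVec, sub_zero, sub_eq_zero] at k1 k2
  have lu := hL u
  have lv := hL v
  have lt := hL t
  clear_value L G
  generalize L u = Xu at *
  generalize L v = Xv at *
  generalize L t = Xt at *
  generalize G u = hu at *
  generalize G v = hv at *
  rcases alpha4 hn Xu Xv Xt lu lv lt hu hv k1 k2 k3 with hw | ⟨cu, cv, ct, w1, w2, w3⟩ |
    ⟨s, qu, qv, qt, l, τ, hs, w1, w2, w3⟩
  · left
    refine alpha2 X hX h fun a b => ?_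
    rw [← sub_eq_zero, hc]
    ext i j
    have := congrFun₂ hw i j
    simp only [vecMulVec_apply] at this
    simp only [hha, vecMulVec_apply, Matrix.sub_apply, Pi.add_apply, Pi.smul_apply, smul_eq_mul,
      Matrix.zero_apply]
    linear_combination (u b * v a - v b * u a) * this
  · left
    refine alpha1 X hX h hc (fun a => u a * cu + v a * cv + t a * ct) fun a b => ?_
    rw [hXa a, hXa b, hha a, hha b]
    simp only [add_mulVec, smul_mulVec, mulVec_add, mulVec_smul, w1, w2]
    have w3' : Xu *ᵥ hv = cu • hv - cv • hu + Xv *ᵥ hu := by rw [← w3]; simp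
    rw [w3']
    module
  · right
    refine ⟨s, fun a => u a * qu + v a * qv + t a * qt, l, fun a => τ * t a, hs, ?_, ?_, ?_, ?_⟩
    · have := congrArg (fun x => τ • x) ht
      simpa [smul_add, smul_smul] using this
    · rw [hXa 0, hha 0, hha 1, hha 2]
      simp only [add_mulVec, smul_mulVec, w1, w2, w3]
      ext i
      simp only [Pi.add_apply, Pi.sub_apply, Pi.smul_apply, smul_eq_mul]
      linear_combination (-τ * hu i) * hv0 - (τ * hv i) * r0
    · rw [hXa 1, hha 0, hha 1, hha 2]
      simp only [add_mulVec, smul_mulVec, w1, w2, w3]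
      ext i
      simp only [Pi.add_apply, Pi.sub_apply, Pi.smul_apply, smul_eq_mul]
      linear_combination (-τ * hu i) * hv1 - (τ * hv i) * r1
    · rw [hXa 2, hha 0, hha 1, hha 2]
      simp only [add_mulVec, smul_mulVec, w1, w2, w3]
      ext i
      simp only [Pi.add_apply, Pi.sub_apply, Pi.smul_apply, smul_eq_mul]
      linear_combination (-τ * hu i) * hv2 - (τ * hv i) * r2

end alpha

section quat

variable {ι κ : Type*} [Fintype ι] [Fintype κ] [DecidableEq ι] [DecidableEq κ]

def cm (X : Fin 3 → Matrix ι ι ℝ) : Matrix ι ι ℍ[ℝ] := qm (X 0) (X 1) (X 2) 0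
def cb (X : Fin 3 → Matrix ι ι ℝ) : Matrix ι ι ℍ[ℝ] := qm (X 0) (-X 1) (-X 2) 0

def blk (d : Dat ι) : Matrix (ι ⊕ ι) (ι ⊕ ι) ℍ[ℝ] :=
  fromBlocks (qm d.1 0 0 0) (cm d.2.1) (cb d.2.1) (qm d.2.2 0 0 0)

structure Sym (d : Dat ι) : Prop where
  p : d.1.IsSymm
  x : ∀ a, (d.2.1 a).IsSymm
  d : d.2.2.IsSymm

def rv (s : ι → ℝ) : ι → ℍ[ℝ] := fun i => (s i : ℍ[ℝ])
def bv (q : Fin 3 → ℝ) (s : ι → ℝ) : ι → ℍ[ℝ] := fun i => ⟨q 0 * s i, - q 1 * s i, - q 2 * s i, 0⟩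
def wv (s : ι → ℝ) (α : ℝ) (q : Fin 3 → ℝ) : ι ⊕ ι → ℍ[ℝ] := Sum.elim (α • rv s) (bv q s)

def Prd (d : Dat ι) : Prop :=
  ∃ (s : ι → ℝ) (α : ℝ) (q : Fin 3 → ℝ) (z : ι ⊕ ι → ℍ[ℝ]), wv s α q ≠ 0 ∧ blk d *ᵥ z = wv s α q

lemma rv_ne {s : ι → ℝ} (hs : s ≠ 0) : rv s ≠ 0 := by
  intro h
  apply hs
  funext i
  have := congrArg QuaternionAlgebra.re (congrFun h i)
  simpa [rv] using this

lemma qm_one : qm (1 : Matrix ι ι ℝ) 0 0 0 = 1 := by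
  ext i j <;> by_cases h : i = j <;> simp [h, Matrix.one_apply]

lemma cm_conj {X : Fin 3 → Matrix ι ι ℝ} (hX : ∀ a, (X a).IsSymm) : (cm X)ᴴ = cb X := by
  rw [cm, cb, qm_conjTranspose, (hX 0).eq, (hX 1).eq, (hX 2).eq]; simp

lemma cb_conj {X : Fin 3 → Matrix ι ι ℝ} (hX : ∀ a, (X a).IsSymm) : (cb X)ᴴ = cm X := by
  rw [← cm_conj hX, conjTranspose_conjTranspose]

noncomputable def El (X : Fin 3 → Matrix ι ι ℝ) (D : Matrix ι ι ℝ) : Matrix ι ι ℍ[ℝ] :=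
  qm D 0 0 0 - cb X * cm X

lemma El_psd {X : Fin 3 → Matrix ι ι ℝ} {D : Matrix ι ι ℝ} (hX : ∀ a, (X a).IsSymm)
    (h : QuatPSD (blk (1, X, D))) : QuatPSD (El X D) := by
  have := psd_congr h (fromRows (-cm X) 1)
  convert this using 1
  rw [conjTranspose_fromRows_eq_fromCols_conjTranspose, blk, fromCols_mul_fromBlocks,
    fromCols_mul_fromRows, conjTranspose_neg, cm_conj hX, qm_one, El]
  simp
  abel

lemma prd_of {X : Fin 3 → Matrix ι ι ℝ} {D : Matrix ι ι ℝ} (s : ι → ℝ) (α : ℝ) (q : Fin 3 → ℝ)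
    (y : ι → ℍ[ℝ]) (hw : wv s α q ≠ 0) (h : α • cb X *ᵥ rv s + El X D *ᵥ y = bv q s) :
    Prd (1, X, D) := by
  refine ⟨s, α, q, Sum.elim (α • rv s - cm X *ᵥ y) y, hw, ?_⟩
  rw [blk, fromBlocks_mulVec, wv]
  congr 1
  · simp [qm_one]
  · rw [← h, El]
    simp [mulVec_sub, sub_mulVec, mulVec_smul, mulVec_mulVec]
    abel

lemma wv_ne_left {s : ι → ℝ} (hs : s ≠ 0) (q : Fin 3 → ℝ) : wv s 1 q ≠ 0 := by
  intro h
  apply rv_ne hs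
  funext i
  simpa [wv] using congrFun h (Sum.inl i)

lemma wv_ne_right {s : ι → ℝ} (hs : s ≠ 0) : wv s 0 ![1, 0, 0] ≠ 0 := by
  intro h
  apply rv_ne hs
  funext i
  have := congrFun h (Sum.inr i)
  have := congrArg QuaternionAlgebra.re this
  simp [wv, bv] at this
  simp [rv, this]

lemma bv_one (s : ι → ℝ) : bv ![1, 0, 0] s = rv s := by
  funext i; ext <;> simp [bv, rv]

lemma case_rank_one {n : ℕ} (hn : n ≤ 3) {X : Fin 3 → Matrix (Fin n) (Fin n) ℝ}
    {D : Matrix (Fin n) (Fin n) ℝ} (hX : ∀ a, (X a).IsSymm) (g : Fin n → ℍ[ℝ])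
    (hg : El X D = vecMulVec g (star g)) : RS (1, X, D) ∨ Prd (1, X, D) := by
  -- rotate `g` on the right so that it has no `k` part
  obtain ⟨h, hh, hk⟩ : ∃ h : Fin n → ℍ[ℝ], El X D = vecMulVec h (star h) ∧ ∀ i, (h i).imK = 0 := by
    let f : ℍ[ℝ] →ₗ[ℝ] (Fin n → ℝ) :=
      { toFun := fun x i => (g i * x).imK
        map_add' := fun x y => by funext i; simp [mul_add]
        map_smul' := fun c x => by funext i; simp [mul_smul_comm] }
    have hf : LinearMap.ker f ≠ ⊥ := LinearMap.ker_ne_bot_of_finrank_lt (by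
      rw [Quaternion.finrank_eq_four]; simp; omega)
    obtain ⟨x, hx, hx0⟩ := (Submodule.ne_bot_iff _).1 hf
    have hpos : 0 < normSq x := lt_of_le_of_ne normSq_nonneg (fun h => hx0 (normSq_eq_zero.1 h.symm))
    have hr := Real.mul_self_sqrt hpos.le
    have hr0 := Real.sqrt_pos.2 hpos
    set r := √(normSq x)
    refine ⟨fun i => r⁻¹ • (g i * x), ?_, fun i => ?_⟩
    · rw [hg]
      ext1 i j
      simp only [vecMulVec_apply, Pi.star_apply, Quaternion.star_smul, star_mul]
      rw [smul_mul_smul_comm, mul_assoc, ← mul_assoc x, Quaternion.self_mul_star, ← hr,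
        Quaternion.coe_mul_eq_smul, mul_smul_comm, smul_smul]
      have : r⁻¹ * r⁻¹ * (r * r) = 1 := by field_simp
      rw [this, one_smul]
    · have : (g i * x).imK = 0 := congrFun (LinearMap.mem_ker.1 hx) i
      rw [Quaternion.imK_smul, this, smul_zero]
  let H : Fin 3 → Fin n → ℝ := ![fun i => (h i).re, fun i => - (h i).imI, fun i => - (h i).imJ]
  have hE : El X D = qm (D - (X 0 * X 0 + X 1 * X 1 + X 2 * X 2)) (X 1 * X 0 - X 0 * X 1)
      (X 2 * X 0 - X 0 * X 2) (X 1 * X 2 - X 2 * X 1) := by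
    rw [El, cb, cm, qm_mul, qm_sub]
    simp
    congr 1 <;> abel
  have hE2 : vecMulVec h (star h) = qm (vecMulVec (H 0) (H 0) + vecMulVec (H 1) (H 1) +
      vecMulVec (H 2) (H 2)) (vecMulVec (H 0) (H 1) - vecMulVec (H 1) (H 0))
      (vecMulVec (H 0) (H 2) - vecMulVec (H 2) (H 0))
      (vecMulVec (H 2) (H 1) - vecMulVec (H 1) (H 2)) := by
    ext i j <;> simp [vecMulVec_apply, H, hk] <;> ring
  rw [hE2, hE] at hh
  obtain ⟨z0, z1, z2, z3⟩ := qm_inj hh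
  have hD : D = ∑ a, X a * X a + ∑ a, vecMulVec (H a) (H a) := by
    rw [Fin.sum_univ_three, Fin.sum_univ_three, ← z0]; abel
  have hc : ∀ a b, X a * X b - X b * X a = vecMulVec (H b) (H a) - vecMulVec (H a) (H b) := by
    have e1 : X 0 * X 1 - X 1 * X 0 = vecMulVec (H 1) (H 0) - vecMulVec (H 0) (H 1) := by
      rw [← neg_inj, neg_sub, neg_sub, z1]
    have e2 : X 0 * X 2 - X 2 * X 0 = vecMulVec (H 2) (H 0) - vecMulVec (H 0) (H 2) := by
      rw [← neg_inj, neg_sub, neg_sub, z2]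
    intro a b
    fin_cases a <;> fin_cases b
    · simp
    · exact e1
    · exact e2
    · exact z1
    · simp
    · exact z3
    · exact z2
    · change X 2 * X 1 - X 1 * X 2 = vecMulVec (H 1) (H 2) - vecMulVec (H 2) (H 1)
      rw [← neg_inj, neg_sub, neg_sub, z3]
    · simp
  rcases alpha hn X hX H hc with hr | ⟨s, q, l, e, hs, e0, x0, x1, x2⟩
  · left; rwa [hD]
  right
  obtain ⟨μ, m0, m1, m2, m3⟩ : ∃ μ : ℍ[ℝ], μ.re = l ∧ μ.imI = -e 2 ∧ μ.imJ = e 1 ∧ μ.imK = -e 0 :=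
    ⟨⟨l, -e 2, e 1, -e 0⟩, rfl, rfl, rfl, rfl⟩
  have ht : ∀ i, (cb X *ᵥ rv s) i - h i * μ = bv q s i := by
    intro i
    have y0 := congrFun x0 i
    have y1 := congrFun x1 i
    have y2 := congrFun x2 i
    have y3 := congrFun e0 i
    have c0 : ((cb X *ᵥ rv s) i).re = (X 0 *ᵥ s) i := by
      simp [mulVec, dotProduct, re_sum, cb, rv]
    have c1 : ((cb X *ᵥ rv s) i).imI = -(X 1 *ᵥ s) i := by
      simp [mulVec, dotProduct, imI_sum, cb, rv]
    have c2 : ((cb X *ᵥ rv s) i).imJ = -(X 2 *ᵥ s) i := by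
      simp [mulVec, dotProduct, imJ_sum, cb, rv]
    have c3 : ((cb X *ᵥ rv s) i).imK = 0 := by
      simp [mulVec, dotProduct, imK_sum, cb, rv]
    simp [H] at y0 y1 y2 y3
    ext <;> simp [c0, c1, c2, c3, bv, hk, m0, m1, m2, m3] <;> linarith
  have hE3 : El X D = vecMulVec h (star h) := by rw [hE, hE2, hh]
  by_cases h0 : h = 0
  · refine prd_of s 1 q 0 (wv_ne_left hs q) ?_
    funext i
    have := ht i
    simpa [h0] using this
  set N := (star h ⬝ᵥ h).re with hN
  have hN0 : N ≠ 0 := fun hz => h0 (dot_star_self_eq_zero hz)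
  have hNN : star h ⬝ᵥ h = (N : ℍ[ℝ]) := by
    have := herm_im (A := (1 : Matrix (Fin n) (Fin n) ℍ[ℝ])) isHermitian_one h
    rwa [one_mulVec] at this
  refine prd_of s 1 q (fun i => h i * (-(N⁻¹) • μ)) (wv_ne_left hs q) ?_
  funext i
  rw [← ht i, hE3]
  have : star h ⬝ᵥ (fun i => h i * (-(N⁻¹) • μ)) = (star h ⬝ᵥ h) * (-(N⁻¹) • μ) := by
    simp only [dotProduct, Finset.sum_mul, mul_assoc]
  rw [Pi.add_apply, vecMulVec_mulVec, this, hNN, Quaternion.coe_mul_eq_smul, smul_smul]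
  simp [hN0, sub_eq_add_neg]

end quat

section stepone

lemma rank_one_of {n : ℕ} {E : Matrix (Fin n) (Fin n) ℍ[ℝ]} (hE : QuatPSD E)
    (hr : Module.finrank ℍ[ℝ] (LinearMap.range E.vecMulLinear) ≤ 1) :
    ∃ g : Fin n → ℍ[ℝ], E = vecMulVec g (star g) := by
  by_cases h0 : E = 0
  · exact ⟨0, by simp [h0]⟩
  obtain ⟨z, hz⟩ : ∃ z, E *ᵥ z ≠ 0 := by
    by_contra hcon
    push Not at hcon
    apply h0
    ext1 i j
    have := congrFun (hcon (Pi.single j 1)) i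
    simpa using this
  obtain ⟨c, hc, h1, h2, h3⟩ := psd_sub hE rfl hz
  set w := E *ᵥ z
  set E1 := E - c • vecMulVec w (star w) with hE1
  have hlt : LinearMap.ker E.vecMulLinear < LinearMap.ker E1.vecMulLinear := by
    have tr : ∀ (A : Matrix (Fin n) (Fin n) ℍ[ℝ]) (_ : A.IsHermitian) x,
        x ∈ LinearMap.ker A.vecMulLinear ↔ A *ᵥ star x = 0 := by
      intro A hA x
      rw [LinearMap.mem_ker, vecMulLinear_apply, ← star_eq_zero, star_vecMul, hA.eq]
    refine lt_of_le_of_ne (fun x hx => ?_) (fun heq => hz ?_)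
    · rw [tr _ h1.1]; exact h3 _ ((tr _ hE.1 x).1 hx)
    · have : star z ∈ LinearMap.ker E1.vecMulLinear := by rw [tr _ h1.1, star_star]; exact h2
      rw [← heq, tr _ hE.1, star_star] at this
      exact this
  have hf := Submodule.finrank_lt_finrank_of_lt hlt
  have hs := LinearMap.finrank_range_add_finrank_ker E.vecMulLinear
  rw [Module.finrank_fin_fun] at hs
  have htop : LinearMap.ker E1.vecMulLinear = ⊤ := by
    apply Submodule.eq_top_of_finrank_eq
    have := Submodule.finrank_le (LinearMap.ker E1.vecMulLinear)
    rw [Module.finrank_fin_fun] at this ⊢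
    omega
  have hE10 : E1 = 0 := by
    ext1 i j
    have : (Pi.single i 1) ∈ LinearMap.ker E1.vecMulLinear := by rw [htop]; trivial
    have := congrFun (LinearMap.mem_ker.1 this) j
    simpa [vecMulLinear_apply] using this
  have hc2 := Real.mul_self_sqrt hc.le
  refine ⟨√c • w, ?_⟩
  have : E = c • vecMulVec w (star w) := by rwa [hE1, sub_eq_zero] at hE10
  rw [this, star_smul_fun]
  ext1 i j
  simp only [vecMulVec_apply, Matrix.smul_apply, Pi.smul_apply]
  rw [smul_mul_smul_comm, hc2]

lemma imK_dot {n : ℕ} (s : Fin n → ℝ) (u y : Fin n → ℍ[ℝ]) :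
    ((rv s ⬝ᵥ u) * star (rv s ⬝ᵥ y)).imK =
      s ⬝ᵥ (of fun i j => (u i * star (y j)).imK : Matrix (Fin n) (Fin n) ℝ) *ᵥ s := by
  simp only [dotProduct, star_sum, Finset.sum_mul, Finset.mul_sum, imK_sum, mulVec, of_apply]
  rw [Finset.sum_comm]
  refine Finset.sum_congr rfl fun i _ => Finset.sum_congr rfl fun j _ => ?_
  simp [rv]
  ring

lemma step_one {n : ℕ} (hn : n ≤ 3) {X : Fin 3 → Matrix (Fin n) (Fin n) ℝ}
    {D : Matrix (Fin n) (Fin n) ℝ} (hX : ∀ a, (X a).IsSymm)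
    (h : QuatPSD (blk (1, X, D))) : RS (1, X, D) ∨ Prd (1, X, D) := by
  have hE := El_psd hX h
  set E := El X D with hEE
  by_cases hr : Module.finrank ℍ[ℝ] (LinearMap.range E.vecMulLinear) ≤ 1
  · obtain ⟨g, hg⟩ := rank_one_of hE hr
    exact case_rank_one hn hX g hg
  right
  push Not at hr
  have hs := LinearMap.finrank_range_add_finrank_ker E.vecMulLinear
  rw [Module.finrank_fin_fun] at hs
  have lift : ∀ t : Fin n → ℍ[ℝ], star t ∈ LinearMap.range E.vecMulLinear → ∃ y, E *ᵥ y = t := by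
    rintro t ⟨x, hx⟩
    refine ⟨star x, ?_⟩
    have := star_vecMul E x
    rw [hE.1.eq] at this
    rw [← this, ← vecMulLinear_apply, hx, star_star]
  by_cases hk : LinearMap.ker E.vecMulLinear = ⊥
  · have hsurj := LinearMap.range_eq_top.2 (LinearMap.injective_iff_surjective.1 (LinearMap.ker_eq_bot.1 hk))
    have hn0 : 0 < n := by
      have := Submodule.finrank_le (LinearMap.range E.vecMulLinear)
      rw [Module.finrank_fin_fun] at this
      omega
    have h1 : (fun _ => 1 : Fin n → ℝ) ≠ 0 := fun hh => by
      have := congrFun hh ⟨0, hn0⟩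
      simp at this
    obtain ⟨y, hy⟩ := lift (rv (fun _ => 1)) (by rw [hsurj]; trivial)
    exact prd_of _ 0 ![1, 0, 0] y (wv_ne_right h1) (by rw [← hEE, hy, bv_one]; simp)
  obtain ⟨y', hy', hy0'⟩ := (Submodule.ne_bot_iff _).1 hk
  have hkp : 0 < Module.finrank ℍ[ℝ] (LinearMap.ker E.vecMulLinear) := by
    rw [Nat.pos_iff_ne_zero, Ne, Submodule.finrank_eq_zero]; exact hk
  have hn3 : n = 3 := by omega
  set y := star y' with hyy
  have hy0 : y ≠ 0 := by rw [hyy, Ne, star_eq_zero]; exact hy0'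
  have hy : E *ᵥ y = 0 := by
    rw [LinearMap.mem_ker, vecMulLinear_apply, ← star_eq_zero, star_vecMul, hE.1.eq] at hy'
    exact hy'
  let F : (Fin n → ℍ[ℝ]) →ₗ[ℍ[ℝ]] ℍ[ℝ] :=
    { toFun := fun x => x ⬝ᵥ y
      map_add' := fun a b => add_dotProduct a b y
      map_smul' := fun c a => smul_dotProduct c a y }
  have hFr : LinearMap.range E.vecMulLinear = LinearMap.ker F := by
    apply Submodule.eq_of_le_of_finrank_le
    · rintro _ ⟨x, rfl⟩
      rw [LinearMap.mem_ker]
      change x ᵥ* E ⬝ᵥ y = 0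
      rw [← dotProduct_mulVec, hy, dotProduct_zero]
    · have hlt : LinearMap.ker F < ⊤ := by
        refine lt_top_iff_ne_top.2 fun htop => hy0 ?_
        apply dot_star_self_eq_zero
        have : star y ∈ LinearMap.ker F := by rw [htop]; trivial
        have : star y ⬝ᵥ y = 0 := LinearMap.mem_ker.1 this
        rw [this]; rfl
      have := Submodule.finrank_lt hlt.ne
      rw [Module.finrank_fin_fun] at this
      omega
  have lift' : ∀ t : Fin n → ℍ[ℝ], star t ⬝ᵥ y = 0 → ∃ y, E *ᵥ y = t := by
    intro t ht
    apply lift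
    rw [hFr]
    exact LinearMap.mem_ker.2 ht
  clear_value y
  clear hFr F hy' hy0' hyy
  subst hn3
  let M : Matrix (Fin 3) (Fin 3) ℝ := of fun i j => ((cm X *ᵥ y) i * star (y j)).imK
  have hM : M.trace = 0 := by
    have e1 : M.trace = ∑ i, ∑ j, (cm X i j * (y j * star (y i))).imK := by
      simp only [M, trace, diag_apply, of_apply, mulVec, dotProduct, Finset.sum_mul, imK_sum,
        mul_assoc]
    have e2 : M.trace = ∑ i, ∑ j, (cm X i j * (y i * star (y j))).imK := by
      rw [e1, Finset.sum_comm]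
      refine Finset.sum_congr rfl fun i _ => Finset.sum_congr rfl fun j _ => ?_
      have : cm X j i = cm X i j := by
        ext <;> simp [cm, (hX _).apply i j]
      rw [this]
    have : M.trace + M.trace = 0 := by
      nth_rewrite 1 [e1]
      rw [e2, ← Finset.sum_add_distrib]
      refine Finset.sum_eq_zero fun i _ => ?_
      rw [← Finset.sum_add_distrib]
      refine Finset.sum_eq_zero fun j _ => ?_
      simp [cm]
      ring
    linarith
  obtain ⟨s, hs0, hsM, -⟩ := quad M 0 hM (by simp)
  set β := rv s ⬝ᵥ y with hβ
  set γ := rv s ⬝ᵥ cm X *ᵥ y with hγ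
  have hgb : (γ * star β).imK = 0 := by
    rw [hγ, hβ]
    exact (imK_dot s _ y).trans hsM
  by_cases hb0 : β = 0
  · obtain ⟨y2, hy2⟩ := lift' (rv s) (by
      rw [← hb0, hβ]; congr 1; funext i; simp [rv])
    exact prd_of _ 0 ![1, 0, 0] y2 (wv_ne_right hs0) (by rw [← hEE, hy2, bv_one]; simp)
  obtain ⟨q, hq, hqk⟩ : ∃ q : ℍ[ℝ], q * β = γ ∧ q.imK = 0 := by
    refine ⟨γ * β⁻¹, by rw [mul_assoc, inv_mul_cancel₀ hb0, mul_one], ?_⟩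
    rw [Quaternion.inv_def, mul_smul_comm, Quaternion.imK_smul, hgb, smul_zero]
  have hbv : ∀ i, bv ![q.re, q.imI, q.imJ] s i = star q * (s i : ℍ[ℝ]) := by
    intro i
    ext <;> simp [bv, hqk]
  obtain ⟨y2, hy2⟩ := lift' (bv ![q.re, q.imI, q.imJ] s - cb X *ᵥ rv s) (by
    have e1 : star (bv ![q.re, q.imI, q.imJ] s) ⬝ᵥ y = q * β := by
      simp only [hβ, dotProduct, Pi.star_apply, hbv, Finset.mul_sum, star_mul, star_star, rv]
      refine Finset.sum_congr rfl fun i _ => ?_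
      rw [Quaternion.star_coe, ← mul_assoc, Quaternion.coe_commutes]
    have e2 : star (cb X *ᵥ rv s) ⬝ᵥ y = γ := by
      rw [star_mulVec, cb_conj hX, hγ, dotProduct_mulVec]
      congr 2
      funext i; simp [rv]
    rw [star_sub, sub_dotProduct, e1, e2, hq, sub_self])
  exact prd_of s 1 ![q.re, q.imI, q.imJ] y2 (wv_ne_left hs0 _) (by rw [← hEE, hy2]; simp)

end stepone

section fin

variable {ι κ : Type*} [Fintype ι] [Fintype κ] [DecidableEq ι] [DecidableEq κ]

noncomputable def hat (T : Matrix ι κ ℝ) : Matrix (ι ⊕ ι) (κ ⊕ κ) ℍ[ℝ] :=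
  fromBlocks (qm T 0 0 0) 0 0 (qm T 0 0 0)

lemma blk_cong (T : Matrix ι κ ℝ) (d : Dat ι) : blk (cong T d) = (hat T)ᴴ * blk d * hat T := by
  simp only [blk, hat, fromBlocks_conjTranspose, fromBlocks_multiply, cm, cb, qm_conjTranspose, qm_mul,
    cong]
  simp [qm_mul]

lemma hat_mul (T : Matrix ι κ ℝ) (S : Matrix κ ι ℝ) (h : T * S = 1) : hat T * hat S = 1 := by
  simp only [hat, fromBlocks_multiply, qm_mul]
  simp [h, qm_one]

lemma sym_cong {d : Dat ι} (h : Sym d) (T : Matrix ι κ ℝ) : Sym (cong T d) := by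
  have key : ∀ M : Matrix ι ι ℝ, M.IsSymm → (Tᵀ * M * T).IsSymm := fun M hM => by
    rw [Matrix.IsSymm, transpose_mul, transpose_mul, transpose_transpose, hM.eq, Matrix.mul_assoc]
  exact ⟨key _ h.p, fun a => key _ (h.x a), key _ h.d⟩

lemma psd_cong {d : Dat ι} (h : QuatPSD (blk d)) (T : Matrix ι κ ℝ) : QuatPSD (blk (cong T d)) := by
  rw [blk_cong]; exact psd_congr h _

lemma cong_cong {T : Matrix ι ι ℝ} {S : Matrix ι ι ℝ} (h : T * S = 1) (d : Dat ι) :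
    cong S (cong T d) = d := by
  have h' : Sᵀ * Tᵀ = 1 := by rw [← transpose_mul, h, transpose_one]
  have key : ∀ M : Matrix ι ι ℝ, Sᵀ * (Tᵀ * M * T) * S = M := fun M => by
    calc _ = (Sᵀ * Tᵀ) * M * (T * S) := by simp only [Matrix.mul_assoc]
      _ = M := by rw [h, h']; simp
  refine Prod.ext (key _) (Prod.ext (funext fun a => key _) (key _))

lemma bv_re (q : Fin 3 → ℝ) (s : ι → ℝ) (i) : (bv q s i).re = q 0 * s i := rfl
lemma bv_imI (q : Fin 3 → ℝ) (s : ι → ℝ) (i) : (bv q s i).imI = - q 1 * s i := rfl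
lemma bv_imJ (q : Fin 3 → ℝ) (s : ι → ℝ) (i) : (bv q s i).imJ = - q 2 * s i := rfl
lemma bv_imK (q : Fin 3 → ℝ) (s : ι → ℝ) (i) : (bv q s i).imK = 0 := rfl

lemma blk_sub (d : Dat ι) (c : ℝ) (s : ι → ℝ) (α : ℝ) (q : Fin 3 → ℝ) :
    blk d - c • vecMulVec (wv s α q) (star (wv s α q)) =
      blk (d - ((c * α ^ 2) • vecMulVec s s, (fun a => (c * α * q a) • vecMulVec s s),
        (c * (q 0 ^ 2 + q 1 ^ 2 + q 2 ^ 2)) • vecMulVec s s)) := by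
  ext i j <;> rcases i with i | i <;> rcases j with j | j <;>
    simp [blk, cm, cb, wv, rv, bv_re, bv_imI, bv_imJ, bv_imK, vecMulVec_apply] <;> first | ring1 | (right; ring1)

lemma gen_mem (c : ℝ) (hc : 0 < c) (s : ι → ℝ) (α : ℝ) (q : Fin 3 → ℝ) :
    RS ((c * α ^ 2) • vecMulVec s s, (fun a => (c * α * q a) • vecMulVec s s),
        (c * (q 0 ^ 2 + q 1 ^ 2 + q 2 ^ 2)) • vecMulVec s s) := by
  refine AddSubmonoid.subset_closure ⟨_, _, fun a => c * α * q a, _, ?_, ?_, ?_, posSemidef_vv s, rfl⟩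
  · positivity
  · positivity
  · apply le_of_eq; ring

lemma hat_wv (T : Matrix ι κ ℝ) (s : ι → ℝ) (α : ℝ) (q : Fin 3 → ℝ) :
    (hat T)ᴴ *ᵥ wv s α q = wv (Tᵀ *ᵥ s) α q := by
  rw [hat, fromBlocks_conjTranspose, wv, fromBlocks_mulVec, wv]
  congr 1
  · funext i
    ext <;> simp [mulVec, dotProduct, qm_conjTranspose, re_sum, imI_sum, imJ_sum, imK_sum, rv,
      Finset.mul_sum]
  · funext i
    ext <;> simp [mulVec, dotProduct, qm_conjTranspose, re_sum, imI_sum, imJ_sum, imK_sum, bv_re,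
      bv_imI, bv_imJ, bv_imK, Finset.mul_sum]
    all_goals refine Finset.sum_congr rfl fun i _ => by ring

lemma prd_cong {d : Dat ι} {T S : Matrix ι ι ℝ} (h : T * S = 1) (hd : Prd d) : Prd (cong T d) := by
  obtain ⟨s, α, q, z, hw, hz⟩ := hd
  refine ⟨Tᵀ *ᵥ s, α, q, hat S *ᵥ z, ?_, ?_⟩
  · rw [← hat_wv]
    intro h0
    apply hw
    have : (hat S)ᴴ *ᵥ ((hat T)ᴴ *ᵥ wv s α q) = 0 := by rw [h0, mulVec_zero]
    rwa [mulVec_mulVec, ← conjTranspose_mul, hat_mul _ _ h, conjTranspose_one, one_mulVec] at this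
  · rw [blk_cong, mulVec_mulVec, Matrix.mul_assoc, hat_mul _ _ h, Matrix.mul_one, ← mulVec_mulVec, hz, hat_wv]

lemma mulVec_rv (M : Matrix ι ι ℝ) (s : ι → ℝ) : qm M 0 0 0 *ᵥ rv s = rv (M *ᵥ s) := by
  funext i
  ext <;> simp [mulVec, dotProduct, re_sum, imI_sum, imJ_sum, imK_sum, rv]

lemma cm_rv (X : Fin 3 → Matrix ι ι ℝ) (s : ι → ℝ) (h : ∀ a, X a *ᵥ s = 0) : cm X *ᵥ rv s = 0 := by
  have h0 := fun i => congrFun (h 0) i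
  have h1 := fun i => congrFun (h 1) i
  have h2 := fun i => congrFun (h 2) i
  simp only [mulVec, dotProduct, Pi.zero_apply] at h0 h1 h2
  funext i
  ext <;> simp [mulVec, dotProduct, re_sum, imI_sum, imJ_sum, imK_sum, rv, cm, h0, h1, h2]

lemma cb_rv (X : Fin 3 → Matrix ι ι ℝ) (s : ι → ℝ) (h : cb X *ᵥ rv s = 0) (a) : X a *ᵥ s = 0 := by
  funext i
  have := congrFun h i
  have h0 := congrArg QuaternionAlgebra.re this
  have h1 := congrArg QuaternionAlgebra.imI this
  have h2 := congrArg QuaternionAlgebra.imJ this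
  simp [mulVec, dotProduct, re_sum, imI_sum, imJ_sum, rv, cb] at h0 h1 h2
  fin_cases a
  · exact h0
  · exact h1
  · exact h2

/-- The real form. -/
lemma real_psd (d : Dat ι) (s : ι → ℝ) :
    star (Sum.elim (rv s) 0 : ι ⊕ ι → ℍ[ℝ]) ⬝ᵥ blk d *ᵥ Sum.elim (rv s) 0 =
      ((s ⬝ᵥ d.1 *ᵥ s : ℝ) : ℍ[ℝ]) := by
  rw [blk, fromBlocks_mulVec]
  rw [Sum.elim_comp_inl, Sum.elim_comp_inr, mulVec_rv, mulVec_zero, mulVec_zero]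
  ext <;> simp [dotProduct, re_sum, imI_sum, imJ_sum, imK_sum, rv]

end fin

section main

lemma reduce {n : ℕ} (s : Fin (n + 1) → ℝ) (hs : s ≠ 0) :
    ∃ (J : Matrix (Fin (n + 1)) (Fin n) ℝ) (Q : Matrix (Fin n) (Fin (n + 1)) ℝ),
      ∀ M : Matrix (Fin (n + 1)) (Fin (n + 1)) ℝ, M.IsSymm → M *ᵥ s = 0 →
        Qᵀ * (Jᵀ * M * J) * Q = M := by
  obtain ⟨i, hi⟩ := Function.ne_iff.1 hs
  have hi : s i ≠ 0 := hi
  let J : Matrix (Fin (n + 1)) (Fin n) ℝ := of fun b a => if b = i.succAbove a then 1 else 0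
  let Q : Matrix (Fin n) (Fin (n + 1)) ℝ := of fun a b =>
    (if b = i.succAbove a then 1 else 0) - (if b = i then s (i.succAbove a) / s i else 0)
  have hJQ : J * Q = 1 - vecMulVec s (Pi.single i (s i)⁻¹) := by
    ext a b
    rw [Matrix.mul_apply, Matrix.sub_apply, vecMulVec_apply, Matrix.one_apply]
    simp only [J, Q, of_apply]
    rcases Fin.eq_self_or_eq_succAbove i a with rfl | ⟨c, rfl⟩
    · rw [Finset.sum_eq_zero]
      · by_cases hb : a = b
        · subst hb; simp [hi]
        · simp [hb, Pi.single_apply, Ne.symm hb]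
      · intro c _
        rw [if_neg (Fin.succAbove_ne a c).symm, zero_mul]
    · rw [Finset.sum_eq_single c]
      · simp [Pi.single_apply, eq_comm]
        split_ifs <;> simp [div_eq_mul_inv]
      · intro c' _ hc
        rw [if_neg (fun h => hc (Fin.succAbove_right_injective h).symm), zero_mul]
      · simp
  refine ⟨J, Q, fun M hM h0 => ?_⟩
  have h1 : M * (J * Q) = M := by
    rw [hJQ, Matrix.mul_sub, mul_vecMulVec, h0]; simp
  have h2 : (J * Q)ᵀ * M = M := by
    have := congrArg transpose h1
    rwa [transpose_mul, hM.eq] at this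
  calc Qᵀ * (Jᵀ * M * J) * Q = ((J * Q)ᵀ * M) * (J * Q) := by
        rw [transpose_mul]; simp only [Matrix.mul_assoc]
    _ = M := by rw [h2, h1]

open scoped MatrixOrder Matrix.Norms.L2Operator in
lemma fact {n : ℕ} {P : Matrix (Fin n) (Fin n) ℝ} (hP : P.PosDef) :
    ∃ T S : Matrix (Fin n) (Fin n) ℝ, T * S = 1 ∧ P = Tᵀ * T := by
  obtain ⟨T, hT⟩ := CStarAlgebra.nonneg_iff_eq_star_mul_self.1 hP.posSemidef.nonneg
  have hT' : P = Tᵀ * T := by simpa [star_eq_conjTranspose] using hT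
  have hu : IsUnit T.det := by
    have := hP.det_pos
    rw [hT', det_mul, det_transpose] at this
    exact isUnit_iff_ne_zero.2 fun h => by simp [h] at this
  exact ⟨T, T⁻¹, mul_nonsing_inv T hu, hT'⟩

lemma step {n : ℕ} (hn : n ≤ 3)
    (ih : ∀ m, m < n → ∀ d : Dat (Fin m), Sym d → QuatPSD (blk d) → RS d)
    (d : Dat (Fin n)) (hd : Sym d) (h : QuatPSD (blk d)) : RS d ∨ Prd d := by
  by_cases hP : d.1.PosDef
  · obtain ⟨T, S, hTS, hT⟩ := fact hP
    have hST : S * T = 1 := mul_eq_one_comm.1 hTS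
    have e1 : (cong S d).1 = 1 := by
      change Sᵀ * d.1 * S = 1
      rw [hT]
      calc _ = (T * S)ᵀ * (T * S) := by rw [transpose_mul]; simp only [Matrix.mul_assoc]
        _ = 1 := by rw [hTS]; simp
    have e2 : cong S d = (1, (cong S d).2.1, (cong S d).2.2) := Prod.ext e1 rfl
    have h' := psd_cong h S
    rw [e2] at h'
    rw [← cong_cong hST d]
    rcases step_one hn (sym_cong hd S).x h' with hr | hr
    · left; apply RS_cong; rw [e2]; exact hr
    · right; apply prd_cong hTS; rw [e2]; exact hr
  · obtain ⟨s, hs, hs0⟩ : ∃ s, s ≠ 0 ∧ s ⬝ᵥ d.1 *ᵥ s = 0 := by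
      by_contra hcon
      push Not at hcon
      apply hP
      refine PosDef.of_dotProduct_mulVec_pos hd.p fun s hs => ?_
      have := h.2 (Sum.elim (rv s) 0)
      rw [real_psd, Quaternion.re_coe] at this
      exact lt_of_le_of_ne this (hcon s hs).symm
    have hk := psd_ker h (z := Sum.elim (rv s) 0) (by rw [real_psd, hs0]; rfl)
    rw [blk, fromBlocks_mulVec, Sum.elim_comp_inl, Sum.elim_comp_inr, mulVec_rv, mulVec_zero,
      mulVec_zero, add_zero, add_zero] at hk
    have hk1 : rv (d.1 *ᵥ s) = 0 := funext fun i => congrFun hk (Sum.inl i)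
    have hk2 : cb d.2.1 *ᵥ rv s = 0 := funext fun i => congrFun hk (Sum.inr i)
    have k1 : d.1 *ᵥ s = 0 := by by_contra hh; exact rv_ne hh hk1
    have k2 := cb_rv _ _ hk2
    by_cases hD : d.2.2 *ᵥ s = 0
    · left
      obtain _ | n := n
      · exact absurd (Subsingleton.elim _ _) hs
      obtain ⟨J, Q, hJQ⟩ := reduce s hs
      have : cong Q (cong J d) = d :=
        Prod.ext (hJQ _ hd.p k1) (Prod.ext (funext fun a => hJQ _ (hd.x a) (k2 a)) (hJQ _ hd.d hD))
      rw [← this]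
      exact RS_cong (ih n (Nat.lt_succ_self n) _ (sym_cong hd J) (psd_cong h J)) Q
    · right
      refine ⟨d.2.2 *ᵥ s, 0, ![1, 0, 0], Sum.elim 0 (rv s), wv_ne_right hD, ?_⟩
      rw [blk, fromBlocks_mulVec, Sum.elim_comp_inl, Sum.elim_comp_inr, mulVec_rv, mulVec_zero,
        mulVec_zero, zero_add, zero_add, cm_rv _ _ k2, wv, bv_one, zero_smul]

def kerB {n : ℕ} (d : Dat (Fin n)) : Submodule ℝ (Fin n ⊕ Fin n → ℍ[ℝ]) where
  carrier := {z | blk d *ᵥ z = 0}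
  zero_mem' := mulVec_zero _
  add_mem' := fun {a b} (ha : blk d *ᵥ a = 0) (hb : blk d *ᵥ b = 0) => by
    change blk d *ᵥ (a + b) = 0
    rw [mulVec_add, ha, hb, add_zero]
  smul_mem' := fun c a (ha : blk d *ᵥ a = 0) => by
    change blk d *ᵥ (c • a) = 0
    rw [mulVec_smul, ha, smul_zero]

lemma mem_kerB {n : ℕ} {d : Dat (Fin n)} {z} : z ∈ kerB d ↔ blk d *ᵥ z = 0 := Iff.rfl

theorem all_RS : ∀ n, n ≤ 3 → ∀ d : Dat (Fin n), Sym d → QuatPSD (blk d) → RS d := by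
  intro n
  induction n using Nat.strong_induction_on with
  | _ n ih =>
  intro hn
  have key : ∀ K : Submodule ℝ (Fin n ⊕ Fin n → ℍ[ℝ]), ∀ d : Dat (Fin n), kerB d = K → Sym d →
      QuatPSD (blk d) → RS d := by
    intro K
    induction K using WellFoundedGT.induction with
    | _ K ihK =>
    intro d hK hd h
    rcases step hn (fun m hm => ih m hm (by omega)) d hd h with hr | ⟨s, α, q, z, hw, hz⟩
    · exact hr
    obtain ⟨c, hc, h1, h2, h3⟩ := psd_sub h hz hw
    rw [blk_sub] at h1 h2 h3
    have hg := gen_mem c hc s α q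
    set g : Dat (Fin n) := ((c * α ^ 2) • vecMulVec s s, (fun a => (c * α * q a) • vecMulVec s s),
        (c * (q 0 ^ 2 + q 1 ^ 2 + q 2 ^ 2)) • vecMulVec s s) with hgd
    have hsym : ∀ t : ℝ, (t • vecMulVec s s).IsSymm := fun t => by
      rw [Matrix.IsSymm, transpose_smul, transpose_vecMulVec]
    have hd' : Sym (d - g) := ⟨hd.p.sub (hsym _), fun a => (hd.x a).sub (hsym _), hd.d.sub (hsym _)⟩
    have hlt : K < kerB (d - g) := by
      rw [← hK]
      refine lt_of_le_of_ne h3 fun heq => hw ?_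
      have : z ∈ kerB (d - g) := h2
      rw [← heq, mem_kerB, hz] at this
      exact this
    have := add_mem (ihK _ hlt (d - g) rfl hd' h1) hg
    rwa [sub_add_cancel] at this
  exact fun d => key _ d rfl

end main

section final

lemma psd_submatrix {ι κ : Type*} [Fintype ι] [Fintype κ] [DecidableEq ι] {A : Matrix ι ι ℍ[ℝ]}
    (h : QuatPSD A) (e : κ → ι) : QuatPSD (A.submatrix e e) := by
  have := psd_congr h ((1 : Matrix ι ι ℍ[ℝ]).submatrix id e)
  convert this using 1
  ext1 i j
  simp [Matrix.mul_apply, Matrix.one_apply]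

lemma psd_two {α δ : ℝ} {q : Fin 3 → ℝ} (hα : 0 ≤ α) (hδ : 0 ≤ δ)
    (h : q 0 ^ 2 + q 1 ^ 2 + q 2 ^ 2 ≤ α * δ) :
    QuatPSD (!![(α : ℍ[ℝ]), ⟨q 0, q 1, q 2, 0⟩; ⟨q 0, -q 1, -q 2, 0⟩, (δ : ℍ[ℝ])]) := by
  obtain ⟨p, hp, p0, p1, p2, p3⟩ : ∃ p : ℍ[ℝ], p = ⟨q 0, q 1, q 2, 0⟩ ∧ p.re = q 0 ∧ p.imI = q 1 ∧
    p.imJ = q 2 ∧ p.imK = 0 := ⟨_, rfl, rfl, rfl, rfl, rfl⟩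
  have hp' : (⟨q 0, -q 1, -q 2, 0⟩ : ℍ[ℝ]) = star p := by
    ext
    · rw [Quaternion.re_star, p0]
    · rw [Quaternion.imI_star, p1]
    · rw [Quaternion.imJ_star, p2]
    · rw [Quaternion.imK_star, p3, neg_zero]
  rw [← hp, hp']
  constructor
  · ext1 i j
    fin_cases i <;> fin_cases j <;> simp
  intro x
  have hn : normSq p ≤ α * δ := by rw [normSq_def', p0, p1, p2, p3]; linarith
  have e : (star x ⬝ᵥ !![(α : ℍ[ℝ]), p; star p, (δ : ℍ[ℝ])] *ᵥ x).re =
      α * normSq (x 0) + δ * normSq (x 1) + 2 * (star (x 0) * (p * x 1)).re := by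
    simp [dotProduct, Fin.sum_univ_two, mulVec, normSq_def']
    ring
  rw [e]
  have hb : (star (x 0) * (p * x 1)).re ^ 2 ≤ normSq (x 0) * (normSq p * normSq (x 1)) := by
    rw [← map_mul, ← normSq_star (a := x 0), ← map_mul, normSq_def']
    nlinarith [sq_nonneg (star (x 0) * (p * x 1)).imI, sq_nonneg (star (x 0) * (p * x 1)).imJ,
      sq_nonneg (star (x 0) * (p * x 1)).imK]
  set t := (star (x 0) * (p * x 1)).re
  have n0 : 0 ≤ normSq (x 0) := normSq_nonneg
  have n1 : 0 ≤ normSq (x 1) := normSq_nonneg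
  have hb2 : t ^ 2 ≤ (α * normSq (x 0)) * (δ * normSq (x 1)) := by
    have := mul_le_mul_of_nonneg_left hn (mul_nonneg n0 n1)
    nlinarith
  have u0 := mul_nonneg hα n0
  have u1 := mul_nonneg hδ n1
  have : |2 * t| ≤ α * normSq (x 0) + δ * normSq (x 1) := by
    apply abs_le_of_sq_le_sq _ (by positivity)
    nlinarith [sq_nonneg (α * normSq (x 0) - δ * normSq (x 1))]
  linarith [neg_abs_le (2 * t)]

end final




end Q6

open Q6 in
/-- A quaternionic hermitian `6 × 6` matrix with zero `k`-components
lying in `Q^k(2) ⊗ S(3)` (blocks `[[B11, B12], [conj B12, B22]]` with `B11, B22`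
real symmetric and `B12` symmetric with zero `k`-components) which is PPT (both it
and its entrywise quaternionic conjugate are PSD) is a sum of Kronecker products
of PSD quaternionic hermitian `2 × 2` matrices with zero `k`-components with PSD
real symmetric `3 × 3` matrices. -/
theorem stmt_6
    (B : Matrix (Fin 2 × Fin 3) (Fin 2 × Fin 3) (Quaternion ℝ))
    (hBk : ∀ p q, (B p q).imK = 0)
    (B11 B22 : Matrix (Fin 3) (Fin 3) ℝ)
    (B12 : Matrix (Fin 3) (Fin 3) (Quaternion ℝ))
    (h11 : B11.IsSymm) (h22 : B22.IsSymm) (h12 : B12.IsSymm)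
    (h12k : ∀ i j, (B12 i j).imK = 0)
    (hblock : ∀ (a b : Fin 2) (i j : Fin 3),
      B (a, i) (b, j) =
        ![![B11.map (algebraMap ℝ (Quaternion ℝ)), B12],
          ![B12.map (star : Quaternion ℝ → Quaternion ℝ),
            B22.map (algebraMap ℝ (Quaternion ℝ))]] a b i j)
    (hpsd : QuatPSD B)
    (hpsdc : QuatPSD (B.map (star : Quaternion ℝ → Quaternion ℝ))) :
    ∃ (N : ℕ) (A : Fin N → Matrix (Fin 2) (Fin 2) (Quaternion ℝ))
      (S : Fin N → Matrix (Fin 3) (Fin 3) ℝ),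
      (∀ l, QuatPSD (A l)) ∧ (∀ l a b, (A l a b).imK = 0) ∧
      (∀ l, (S l).PosSemidef) ∧
      B = ∑ l, A l ⊗ₖ (S l).map (algebraMap ℝ (Quaternion ℝ)) := by
  obtain ⟨d, hd⟩ : ∃ d : Dat (Fin 3), d = (B11, ![of fun i j => (B12 i j).re,
    of fun i j => (B12 i j).imI, of fun i j => (B12 i j).imJ], B22) := ⟨_, rfl⟩
  have hs : Sym d := by
    subst hd
    refine ⟨h11, fun a => ?_, h22⟩
    fin_cases a <;> ext i j <;> simp [h12.apply i j]
  have hB : blk d = B.submatrix (Sum.elim (fun i => (0, i)) (fun i => (1, i)))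
      (Sum.elim (fun i => (0, i)) (fun i => (1, i))) := by
    subst hd
    ext i j <;> rcases i with i | i <;> rcases j with j | j <;>
      simp [blk, hblock, cm, cb, h12k]
  have hr := all_RS 3 le_rfl d hs (hB ▸ psd_submatrix hpsd _)
  obtain ⟨l, hl, hsum⟩ := AddSubmonoid.exists_list_of_mem_closure hr
  have hl' : ∀ i : Fin l.length, l[i] ∈ gen (Fin 3) := fun i => hl _ (List.getElem_mem _)
  choose α δ q S hα hδ hq hS he using hl'
  refine ⟨l.length, fun i => !![(α i : Quaternion ℝ), ⟨q i 0, q i 1, q i 2, 0⟩;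
    ⟨q i 0, -q i 1, -q i 2, 0⟩, (δ i : Quaternion ℝ)], S, fun i => psd_two (hα i) (hδ i) (hq i), ?_,
    hS, ?_⟩
  · intro i a b
    fin_cases a <;> fin_cases b <;> rfl
  · have hd2 : d = ∑ i, (α i • S i, (fun a => q i a • S i), δ i • S i) := by
      rw [← hsum, ← Fin.sum_univ_getElem]
      exact Finset.sum_congr rfl fun i _ => he i
    have g1 : ∀ i j, d.1 i j = ∑ k, α k * S k i j := fun i j => by
      rw [hd2, Prod.fst_sum, Matrix.sum_apply]; rfl
    have g2 : ∀ a i j, d.2.1 a i j = ∑ k, q k a * S k i j := fun a i j => by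
      rw [hd2, Prod.snd_sum, Prod.fst_sum, Finset.sum_apply, Matrix.sum_apply]; rfl
    have g3 : ∀ i j, d.2.2 i j = ∑ k, δ k * S k i j := fun i j => by
      rw [hd2, Prod.snd_sum, Prod.snd_sum, Matrix.sum_apply]; rfl
    have hB' : ∀ a b i j, B (a, i) (b, j) = blk d (if a = 0 then Sum.inl i else Sum.inr i)
        (if b = 0 then Sum.inl j else Sum.inr j) := by
      intro a b i j
      rw [hB]
      fin_cases a <;> fin_cases b <;> rfl
    ext1 ⟨a, i⟩ ⟨b, j⟩
    rw [hB', Matrix.sum_apply]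
    have c : ∀ (p : Quaternion ℝ) (r : ℝ), p * algebraMap ℝ (Quaternion ℝ) r = r • p := fun p r => by
      rw [← Algebra.commutes, Algebra.smul_def]
    simp only [kronecker_apply, map_apply, c]
    fin_cases a <;> fin_cases b <;>
      ext <;> simp [blk, cm, cb, re_sum, imI_sum, imJ_sum, imK_sum, g1, g2, g3, mul_comm]
    all_goals first
      | exact Finset.sum_congr rfl fun _ _ => rfl
      | exact (Finset.sum_eq_zero fun _ _ => mul_zero _).symm
      | exact (Finset.sum_neg_distrib _).symm.trans
          (Finset.sum_congr rfl fun x _ => (mul_neg (S x i j) _).symm)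
end
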